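/- Let γ > 0. There exists n'' = n''(γ) ∈ ℕ such that for every n ≥ n'' and every t with 1 ≤ t ≤ n/(3√2) the following holds. Let H be a 3-graph on n vertices with degree sequence d₁ ≤ … ≤ dₙ such that dᵢ ≥ (1/3 + 4γ)·C(n,2) + i·t for 1 ≤ i ≤ t, dᵢ ≥ (4/9 + 4γ)·C(n,2) for t < i ≤ n/3, and dᵢ ≥ (5/9 + 4γ)·C(n,2) for i > n/3. Then H contains a matching M of size ⌊(n − γn)/3⌋ such that |L(M) ∩ V_{5/9}| ≥ (2/3)·|L(M)|. -/

import Mathlib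

open Finset
open scoped Classical

noncomputable section

/-- The degree of a vertex `v` in a `3`-graph `H` on `Fin n`. -/
def deg {n : ℕ} (H : Finset (Finset (Fin n))) (v : Fin n) : ℕ :=
  (H.filter fun e => v ∈ e).card

/-- `H` is a `3`-graph: every edge has exactly three vertices. -/
def Is3Graph (n : ℕ) (H : Finset (Finset (Fin n))) : Prop :=
  ∀ e ∈ H, e.card = 3

/-- `M` is a matching in `H`. -/
def IsMatching {n : ℕ} (H M : Finset (Finset (Fin n))) : Prop :=
  M ⊆ H ∧ ∀ e ∈ M, ∀ f ∈ M, e ≠ f → Disjoint e f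

/-- The set of vertices covered by a collection `M` of edges. -/
def cover {n : ℕ} (M : Finset (Finset (Fin n))) : Finset (Fin n) :=
  M.biUnion id

/-- The leave of `M`: the vertices not covered by `M`. -/
def leave {n : ℕ} (M : Finset (Finset (Fin n))) : Finset (Fin n) :=
  univ \ cover M

/-- `v` is a big (5/9th) vertex: `deg v ≥ (5/9 + γ)·C(n,2)`. -/
def big {n : ℕ} (γ : ℝ) (H : Finset (Finset (Fin n))) (v : Fin n) : Prop :=
  ((5 : ℝ)/9 + γ) * (n.choose 2) ≤ (deg H v : ℝ)

/-- `V_{5/9}`: the set of big vertices. -/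
def V59 {n : ℕ} (γ : ℝ) (H : Finset (Finset (Fin n))) : Finset (Fin n) :=
  univ.filter fun v => big γ H v

/-- `σ` witnesses the degree sequence condition of Theorem `almostmainthm`
(with `4γ` error terms): `σ` is a monotone-degree ordering of the vertices and,
writing `dᵢ = deg (σ i)` for the `i`-th smallest degree (1-based),
`dᵢ ≥ (1/3 + 4γ)·C(n,2) + i·t` for `1 ≤ i ≤ t`,
`dᵢ ≥ (4/9 + 4γ)·C(n,2)` for `t < i ≤ n/3`, and
`dᵢ ≥ (5/9 + 4γ)·C(n,2)` for `i > n/3`. -/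
def DegSeq4 {n : ℕ} (γ : ℝ) (t : ℕ) (H : Finset (Finset (Fin n)))
    (σ : Fin n ≃ Fin n) : Prop :=
  Monotone (fun i => deg H (σ i)) ∧
  ∀ i : Fin n,
    ((i : ℕ) + 1 ≤ t →
      ((1 : ℝ)/3 + 4*γ) * (n.choose 2) + ((i : ℕ) + 1) * t ≤ (deg H (σ i) : ℝ)) ∧
    (t < (i : ℕ) + 1 → 3 * ((i : ℕ) + 1) ≤ n →
      ((4 : ℝ)/9 + 4*γ) * (n.choose 2) ≤ (deg H (σ i) : ℝ)) ∧
    (n < 3 * ((i : ℕ) + 1) →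
      ((5 : ℝ)/9 + 4*γ) * (n.choose 2) ≤ (deg H (σ i) : ℝ))

set_option maxHeartbeats 1000000 in
/-- The six-level case of the weight inequality, in terms of level-set sizes. -/
lemma level_ineq_six {a₁ a₂ e₁ e₂ s C : ℝ} (ha2 : 0 ≤ a₂) (ha : a₂ ≤ a₁) (ha1 : a₁ ≤ 1)
    (he2 : 0 ≤ e₂) (he : e₂ ≤ e₁) (hes : e₁ ≤ s) (hsC : s ≤ C) (hC : C ≤ 2)
    (h0 : 3 ≤ 4 * s + C ^ 2 - 2 * C * s
      + 2 * (a₂ * s + (a₁ - a₂) * e₁ + (1 - a₁) * e₂))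
    (h1 : 5 ≤ 4 + 4 * a₂ + a₂ ^ 2 + 2 * C * (a₁ - a₂) + 2 * s * (1 - a₁)) :
    2 ≤ a₁ + a₂ + C + s + e₁ + e₂ := by
  by_contra hcon
  push Not at hcon
  have hSA : 2 * (a₂ * s + (a₁ - a₂) * e₁ + (1 - a₁) * e₂) ≤ (e₁ + e₂) + s * (a₁ + a₂) := by
    nlinarith [mul_nonneg (sub_nonneg.2 ha) (sub_nonneg.2 hes),
      mul_nonneg (sub_nonneg.2 ha1) (sub_nonneg.2 he), mul_nonneg (sub_nonneg.2 ha) he2,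
      mul_nonneg ha2 (sub_nonneg.2 he), mul_nonneg ha2 he2]
  obtain ⟨q, rfl⟩ : ∃ q, C = s + q := ⟨C - s, by ring⟩
  obtain ⟨d, rfl⟩ : ∃ d, s = 1 - d := ⟨1 - s, by ring⟩
  have hq0 : 0 ≤ q := by linarith
  have hd1 : d ≤ 1 := by linarith
  -- `q ^ 2 + G ≥ 2 d + d ^ 2`, `q + G < 2 d`
  have hGA : (1 - d) * (a₁ + a₂) ≤ a₁ + a₂ := by nlinarith
  have hq : d ^ 2 < q * (q - 1) := by nlinarith
  have hq1 : 1 < q := by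
    by_contra h
    push Not at h
    nlinarith [sq_nonneg d]
  have hd : 1 / 2 < d := by linarith
  have hL : 4 * d + d ^ 2 - 1 ≤ q ^ 2 + 2 * q * a₁ + 2 * (1 + d - q) * a₂ + a₂ ^ 2
      + (e₁ + e₂) + (1 - d) * (a₁ + a₂) := by nlinarith
  obtain ⟨Q, hQ⟩ : ∃ Q, Q = q + a₁ := ⟨_, rfl⟩
  have hy : 0 ≤ a₂ + e₁ + e₂ := by linarith
  have hL2 : 4 * d + d ^ 2 - 1 ≤ Q ^ 2 + (1 - d) * a₁ + (1 + d) * (a₂ + e₁ + e₂) := by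
    have : a₂ ^ 2 ≤ a₁ ^ 2 := by nlinarith
    have h3 : q * a₂ ≥ a₂ := by nlinarith
    have h4 : 0 ≤ d * (e₁ + e₂) := by nlinarith
    subst hQ
    nlinarith
  have hQ1 : 1 < Q := by linarith
  have hQd : Q < 2 * d - (a₂ + e₁ + e₂) := by linarith
  have hQ2 : Q ^ 2 < (2 * d - (a₂ + e₁ + e₂)) ^ 2 := by
    apply pow_lt_pow_left₀ hQd <;> linarith
  have h5 : (2 * d - (a₂ + e₁ + e₂)) ^ 2 + (1 + d) * (a₂ + e₁ + e₂) ≤ 4 * d ^ 2 := by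
    have : 0 ≤ (a₂ + e₁ + e₂) * (3 * d - 1 - (a₂ + e₁ + e₂)) := by
      apply mul_nonneg hy; linarith
    linarith
  have h6 : (1 - d) * a₁ ≤ (1 - d) * (2 * d - 1) := by
    apply mul_le_mul_of_nonneg_left <;> linarith
  have hdd : 0 ≤ d * (1 - d) := mul_nonneg (by linarith) (by linarith)
  linarith

/-- The quadratic core of `level_ineq_eight`. -/
lemma level_ineq_eight_aux {G E x d t q T : ℝ} (hG0 : 0 ≤ G) (hE0 : 0 ≤ E) (hd0 : 0 ≤ d)
    (hd1 : d ≤ 1) (hq0 : 0 ≤ q) (hx0 : 0 ≤ x) (hTC : T ≤ t + (1 - d))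
    (hc : t + (1 - d) + q ≤ 2) (hCT : t + (1 - d) + T ≤ 2)
    (hxT : x + (1 - d) ≤ T)
    (h0 : 3 ≤ 4 * T + (t + (1 - d)) ^ 2 - 2 * (t + (1 - d)) * T + E + (1 - d) * G)
    (H1 : 4 * d + d ^ 2 - (2 * t * (1 + d) - t ^ 2 + q ^ 2) ≤ x + t * G) :
    2 * d - 2 * (t - d) - q ≤ G + E + x := by
  rcases le_total t d with htd | htd
  · obtain ⟨v, rfl⟩ : ∃ v, t = d - v := ⟨d - t, by ring⟩
    have hv : 0 ≤ v := by linarith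
    have H0 : 2 * v + v ^ 2 ≤ E + (1 - d) * G := by
      have : T * (4 - 2 * (d - v + (1 - d))) ≤
          (d - v + (1 - d)) * (4 - 2 * (d - v + (1 - d))) := by
        apply mul_le_mul_of_nonneg_right <;> linarith
      linarith
    have : 0 ≤ v * G := mul_nonneg hv hG0
    have hqq : q * (q - 1) ≤ (1 + v) * v := by
      rcases le_total q 1 with h | h
      · have h1 : q * (q - 1) ≤ 0 := mul_nonpos_of_nonneg_of_nonpos hq0 (by linarith)
        have h2 : 0 ≤ (1 + v) * v := by positivity
        linarith
      · apply mul_le_mul <;> linarith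
    linarith [sq_nonneg v]
  · obtain ⟨p, rfl⟩ : ∃ p, t = d + p := ⟨t - d, by ring⟩
    have hp0 : 0 ≤ p := by linarith
    have hqp : q ≤ 1 - p := by linarith
    have hpd : p ≤ d := by linarith
    have H1' : 2 * d - 2 * p + p ^ 2 - q ^ 2 ≤ x + (d + p) * G := by linarith
    have hqq : q ^ 2 ≤ q := by
      have : 0 ≤ q * (1 - q) := mul_nonneg hq0 (by linarith)
      linarith
    rcases le_total (d + p) 1 with h | h
    · have : (d + p) * G ≤ 1 * G := mul_le_mul_of_nonneg_right h hG0
      linarith [sq_nonneg p]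
    · have H0 : 2 * p - 3 * p ^ 2 ≤ E + (1 - d) * G := by
        have : T * (4 - 2 * (d + p + (1 - d))) ≤
            (1 - p) * (4 - 2 * (d + p + (1 - d))) := by
          apply mul_le_mul_of_nonneg_right <;> linarith
        linarith
      have hdp : 0 < d + p := by linarith
      suffices h2 : (d + p) * (2 * d - 2 * p - q) ≤ (d + p) * (G + E + x) by
        have := le_of_mul_le_mul_left h2 hdp
        linarith
      have hqdp : q ^ 2 ≤ (d + p) * q := by
        rw [sq]
        apply mul_le_mul_of_nonneg_right <;> linarith
      rcases le_total (3 * p) 2 with hp | hp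
      · have hqd : d * q ^ 2 ≤ (d + p) * q := by
          have := mul_le_mul_of_nonneg_left hqq hd0
          linarith [mul_nonneg hp0 hq0]
        have hA : d * (2 * d - 2 * p + p ^ 2 - q ^ 2) ≤ d * (x + (d + p) * G) :=
          mul_le_mul_of_nonneg_left H1' hd0
        have hB : (d + p) * (2 * p - 3 * p ^ 2) ≤ (d + p) * (E + (1 - d) * G) :=
          mul_le_mul_of_nonneg_left H0 hdp.le
        have hpx : 0 ≤ p * x := mul_nonneg hp0 hx0
        have hP : 0 ≤ p ^ 2 * (4 - 2 * d - 3 * p) := by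
          apply mul_nonneg (sq_nonneg _); linarith
        linarith
      · have hx' : 0 ≤ (d + p - 1) * x := mul_nonneg (by linarith) hx0
        have hE' : 0 ≤ (d + p) * E := mul_nonneg hdp.le hE0
        have h3 : (d - p) * (d + p - 1) ≤ 1 / 3 * p := by
          apply mul_le_mul <;> linarith
        have h4 : 0 ≤ p * (3 * p - 2) := mul_nonneg hp0 (by linarith)
        linarith

/-- The case of at least eight levels of the weight inequality. -/
lemma level_ineq_eight {a₁ a₂ e₁ e₂ s X Y T C c : ℝ} (ha2 : 0 ≤ a₂) (ha : a₂ ≤ a₁)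
    (ha1 : a₁ ≤ 1) (he2 : 0 ≤ e₂) (he : e₂ ≤ e₁) (hes : e₁ ≤ s) (hsX : s ≤ X) (hXY : X ≤ Y)
    (hYC : Y ≤ C) (hXT : X ≤ T) (hTC : T ≤ C) (hCc : C ≤ c) (hc : c ≤ 2) (hCT : C + T ≤ 2)
    (h0 : 3 ≤ 4 * T + C ^ 2 - 2 * C * T
      + 2 * (a₂ * s + (a₁ - a₂) * e₁ + (1 - a₁) * e₂))
    (h1 : 5 ≤ 4 * C + c ^ 2 - 2 * c * C
      + 2 * (a₂ * Y + (a₁ - a₂) * X + (1 - a₁) * s)) :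
    4 ≤ a₁ + a₂ + e₁ + e₂ + c + C + X + s := by
  rcases le_total 1 s with hs1 | hs1
  · linarith
  have hSA : 2 * (a₂ * s + (a₁ - a₂) * e₁ + (1 - a₁) * e₂) ≤ (e₁ + e₂) + s * (a₁ + a₂) := by
    nlinarith [mul_nonneg (sub_nonneg.2 ha) (sub_nonneg.2 hes),
      mul_nonneg (sub_nonneg.2 ha1) (sub_nonneg.2 he), mul_nonneg (sub_nonneg.2 ha) he2,
      mul_nonneg ha2 (sub_nonneg.2 he), mul_nonneg ha2 he2]
  obtain ⟨G, hG⟩ : ∃ G, G = a₁ + a₂ := ⟨_, rfl⟩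
  have hG0 : 0 ≤ G := by linarith
  have hG2 : G ≤ 2 := by linarith
  have hAR : 2 * (a₂ * Y + (a₁ - a₂) * X + (1 - a₁) * s) ≤ 2 * s + (X - s) + (Y - s) * G := by
    subst hG
    nlinarith [mul_nonneg (sub_nonneg.2 ha1) (sub_nonneg.2 hsX),
      mul_nonneg ha2 (sub_nonneg.2 hsX), mul_nonneg (sub_nonneg.2 ha) (sub_nonneg.2 hXY)]
  have hAR2 : 2 * (a₂ * Y + (a₁ - a₂) * X + (1 - a₁) * s) ≤ 2 * s + (X - s) + (C - s) * G := by
    have : (Y - s) * G ≤ (C - s) * G := by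
      apply mul_le_mul_of_nonneg_right _ hG0; linarith
    linarith
  rw [← hG] at hSA
  clear hAR
  obtain ⟨d, rfl⟩ : ∃ d, s = 1 - d := ⟨1 - s, by ring⟩
  obtain ⟨q, rfl⟩ : ∃ q, c = C + q := ⟨c - C, by ring⟩
  have hd0 : 0 ≤ d := by linarith
  have hd1 : d ≤ 1 := by linarith
  have hq0 : 0 ≤ q := by linarith
  suffices h : 4 - (C + q) - C - (1 - d) ≤ G + (e₁ + e₂) + X by linarith
  obtain ⟨x, rfl⟩ : ∃ x, X = x + (1 - d) := ⟨X - (1 - d), by ring⟩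
  have hx0 : 0 ≤ x := by linarith
  obtain ⟨E, hE⟩ : ∃ E, E = e₁ + e₂ := ⟨_, rfl⟩
  rw [← hE] at hSA ⊢
  have hE0 : 0 ≤ E := by linarith
  obtain ⟨t, rfl⟩ : ∃ t, C = t + (1 - d) := ⟨C - (1 - d), by ring⟩
  have H1 : 4 * d + d ^ 2 - (2 * t * (1 + d) - t ^ 2 + q ^ 2) ≤ x + t * G := by linarith
  have h0' : 3 ≤ 4 * T + (t + (1 - d)) ^ 2 - 2 * (t + (1 - d)) * T + E + (1 - d) * G := by
    linarith
  have := level_ineq_eight_aux hG0 hE0 hd0 hd1 hq0 hx0 hTC hc hCT hXT h0' H1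
  linarith

/-- The number of vertices of value at least `l`. -/
def levelCard {V : Type*} [Fintype V] (i : V → ℕ) (l : ℕ) : ℕ :=
  (univ.filter fun v => l ≤ i v).card

section
variable {V : Type*} [Fintype V]

lemma levelCard_antitone (i : V → ℕ) : Antitone (levelCard i) := fun a b hab => by
  apply card_le_card
  intro v
  simp only [mem_filter, mem_univ, true_and]
  exact hab.trans

lemma levelCard_le (i : V → ℕ) (l : ℕ) : levelCard i l ≤ Fintype.card V := card_le_univ _

lemma card_pairs_eq_sum (i : V → ℕ) (N : ℕ) :
    (univ.filter fun p : V × V => N ≤ i p.1 + i p.2).card = ∑ u, levelCard i (N - i u) := by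
  rw [card_filter, Fintype.sum_prod_type]
  refine sum_congr rfl fun u _ => ?_
  rw [levelCard, card_filter]
  refine sum_congr rfl fun v _ => ?_
  simp only [tsub_le_iff_left]

lemma sum_levelCard_le (i : V → ℕ) (N : ℕ) :
    ∑ l ∈ range N, levelCard i (l + 1) ≤ ∑ v, i v := by
  simp only [levelCard, card_filter]
  rw [sum_comm]
  refine sum_le_sum fun v _ => ?_
  rw [← card_filter]
  calc _ ≤ (range (i v)).card := by
        apply card_le_card
        intro l
        simp only [mem_filter, mem_range]
        omega
    _ = i v := card_range _

/-- Two complementary levels contain together at least two thirds of the vertices. -/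
lemma levelCard_add_ge {m : ℕ} (hV : Fintype.card V = 3 * m) (i : V → ℕ) {N l l' : ℕ}
    (hll : l ≤ l') (hN : l + l' = N + 1)
    (h : 5 * m ^ 2 ≤ (univ.filter fun p : V × V => N ≤ i p.1 + i p.2).card) :
    2 * m ≤ levelCard i l + levelCard i l' := by
  rw [card_pairs_eq_sum] at h
  have hrow : ∀ u, (levelCard i (N - i u) : ℝ) ≤ levelCard i l'
      + ((levelCard i l : ℝ) - levelCard i l') * (if l ≤ i u then 1 else 0)
      + (3 * m - (levelCard i l : ℝ)) * (if l' ≤ i u then 1 else 0) := by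
    intro u
    have h3 : (levelCard i (N - i u) : ℝ) ≤ 3 * m := by
      exact_mod_cast hV ▸ levelCard_le i (N - i u)
    split_ifs with h1 h2
    · linarith
    · have : (levelCard i (N - i u) : ℝ) ≤ levelCard i l := by
        exact_mod_cast levelCard_antitone i (by omega)
      linarith
    · omega
    · have : (levelCard i (N - i u) : ℝ) ≤ levelCard i l' := by
        exact_mod_cast levelCard_antitone i (by omega)
      linarith
  have hs := sum_le_sum fun u (_ : u ∈ (univ : Finset V)) => hrow u
  rw [sum_add_distrib, sum_add_distrib, ← mul_sum, ← mul_sum, sum_boole, sum_boole, sum_const,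
    card_univ, hV, nsmul_eq_mul] at hs
  change _ ≤ _ + _ * (levelCard i l : ℝ) + _ * (levelCard i l' : ℝ) at hs
  have h' : (5 * m ^ 2 : ℝ) ≤ ∑ u, (levelCard i (N - i u) : ℝ) := by exact_mod_cast h
  have hc3 : (levelCard i l : ℝ) ≤ 3 * m := by exact_mod_cast hV ▸ levelCard_le i l
  have htc : (levelCard i l' : ℝ) ≤ levelCard i l := by exact_mod_cast levelCard_antitone i hll
  have ht0 : (0 : ℝ) ≤ levelCard i l' := by positivity
  have hm0 : (0 : ℝ) ≤ m := by positivity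
  suffices (2 * m : ℝ) ≤ levelCard i l + levelCard i l' by exact_mod_cast this
  push_cast at hs
  generalize (levelCard i l : ℝ) = c at *
  generalize (levelCard i l' : ℝ) = t at *
  generalize (m : ℝ) = m at *
  clear hrow h hV
  have hq : 5 * m ^ 2 ≤ c ^ 2 + (6 * m - 2 * c) * t := by linarith
  clear hs h'
  by_contra hcon
  push Not at hcon
  have hmpos : 0 < m := by linarith
  rcases le_total c m with hcm | hcm
  · have h1 : (6 * m - 2 * c) * t ≤ (6 * m - 2 * c) * c :=
      mul_le_mul_of_nonneg_left htc (by linarith)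
    have h2 : 0 ≤ (m - c) * (5 * m - c) := mul_nonneg (by linarith) (by linarith)
    have h3 : (m - c) * (5 * m - c) = 0 := by linarith
    rcases mul_eq_zero.1 h3 with h4 | h4
    · have : c = m := by linarith
      subst this
      nlinarith
    · nlinarith
  · have h1 : (6 * m - 2 * c) * t < (6 * m - 2 * c) * (2 * m - c) :=
      mul_lt_mul_of_pos_left (by linarith) (by linarith)
    have h2 : 0 ≤ (c - m) * (7 * m - 3 * c) := mul_nonneg (by linarith) (by linarith)
    linarith

end

lemma level_ineq_six_scaled {m a₁ a₂ e₁ e₂ s C : ℝ} (hm : 0 < m) (ha2 : 0 ≤ a₂) (ha : a₂ ≤ a₁)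
    (ha1 : a₁ ≤ m) (he2 : 0 ≤ e₂) (he : e₂ ≤ e₁) (hes : e₁ ≤ s) (hsC : s ≤ C) (hC : C ≤ 2 * m)
    (h0 : 3 * m ^ 2 ≤ 4 * m * s + C ^ 2 - 2 * C * s
      + 2 * (a₂ * s + (a₁ - a₂) * e₁ + (m - a₁) * e₂))
    (h1 : 5 * m ^ 2 ≤ 4 * m ^ 2 + 4 * m * a₂ + a₂ ^ 2 + 2 * C * (a₁ - a₂) + 2 * s * (m - a₁)) :
    2 * m ≤ a₁ + a₂ + C + s + e₁ + e₂ := by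
  have key := @level_ineq_six (a₁ / m) (a₂ / m) (e₁ / m) (e₂ / m) (s / m) (C / m)
    (by positivity) (by gcongr) ((div_le_one hm).2 ha1) (by positivity) (by gcongr) (by gcongr)
    (by gcongr) ((div_le_iff₀ hm).2 hC)
    (by
      rw [← le_div_iff₀ (by positivity)] at h0
      refine h0.trans_eq ?_
      field_simp)
    (by
      rw [← le_div_iff₀ (by positivity)] at h1
      refine h1.trans_eq ?_
      field_simp)
  rw [← le_div_iff₀ hm]
  refine key.trans_eq ?_
  field_simp

lemma level_ineq_eight_scaled {m a₁ a₂ e₁ e₂ s X Y T C c : ℝ} (hm : 0 < m) (ha2 : 0 ≤ a₂)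
    (ha : a₂ ≤ a₁) (ha1 : a₁ ≤ m) (he2 : 0 ≤ e₂) (he : e₂ ≤ e₁) (hes : e₁ ≤ s) (hsX : s ≤ X)
    (hXY : X ≤ Y) (hYC : Y ≤ C) (hXT : X ≤ T) (hTC : T ≤ C) (hCc : C ≤ c) (hc : c ≤ 2 * m)
    (hCT : C + T ≤ 2 * m)
    (h0 : 3 * m ^ 2 ≤ 4 * m * T + C ^ 2 - 2 * C * T
      + 2 * (a₂ * s + (a₁ - a₂) * e₁ + (m - a₁) * e₂))
    (h1 : 5 * m ^ 2 ≤ 4 * m * C + c ^ 2 - 2 * c * C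
      + 2 * (a₂ * Y + (a₁ - a₂) * X + (m - a₁) * s)) :
    4 * m ≤ a₁ + a₂ + e₁ + e₂ + c + C + X + s := by
  have key := @level_ineq_eight (a₁ / m) (a₂ / m) (e₁ / m) (e₂ / m) (s / m) (X / m) (Y / m)
    (T / m) (C / m) (c / m)
    (by positivity) (by gcongr) ((div_le_one hm).2 ha1) (by positivity) (by gcongr) (by gcongr)
    (by gcongr) (by gcongr) (by gcongr) (by gcongr) (by gcongr) (by gcongr)
    ((div_le_iff₀ hm).2 hc) (by rw [← add_div]; exact (div_le_iff₀ hm).2 hCT)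
    (by
      rw [← le_div_iff₀ (by positivity)] at h0
      refine h0.trans_eq ?_
      field_simp)
    (by
      rw [← le_div_iff₀ (by positivity)] at h1
      refine h1.trans_eq ?_
      field_simp)
  rw [← le_div_iff₀ hm]
  refine key.trans_eq ?_
  field_simp

section
variable {V : Type*} [Fintype V]

/-- Lower bound for the total size of the middle levels via reflection. -/
lemma sum_middle_levels_ge (f : ℕ → ℝ) (m : ℝ) (k : ℕ)
    (h : ∀ j < 2 * k + 2, 2 * m ≤ f j + f (2 * k + 1 - j)) :
    2 * m * k + (f k + f (k + 1)) ≤ ∑ j ∈ range (2 * k + 2), f j := by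
  have h2 : 2 * ∑ j ∈ range (2 * k + 2), f j
      = ∑ j ∈ range (2 * k + 2), (f j + f (2 * k + 1 - j)) := by
    rw [sum_add_distrib, two_mul]
    congr 1
    rw [← sum_range_reflect]
    rfl
  have h3 : ∑ j ∈ range (2 * k + 2), (2 * m + (if j = k then f k + f (k + 1) - 2 * m else 0)
      + (if j = k + 1 then f k + f (k + 1) - 2 * m else 0))
      ≤ ∑ j ∈ range (2 * k + 2), (f j + f (2 * k + 1 - j)) := by
    refine sum_le_sum fun j hj => ?_
    rw [mem_range] at hj
    split_ifs with h1 h2 h2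
    · omega
    · subst h1
      rw [show 2 * j + 1 - j = j + 1 by omega]
      linarith
    · subst h2
      rw [show 2 * k + 1 - (k + 1) = k by omega]
      linarith
    · linarith [h j hj]
  rw [sum_add_distrib, sum_add_distrib, sum_ite_eq', sum_ite_eq', if_pos (by simp; omega),
    if_pos (by simp; omega), sum_const, card_range, nsmul_eq_mul] at h3
  push_cast at h3
  linarith

/-- Splitting a sum over `A` and its complement. -/
lemma sum_le_of_bound_on (A : Finset V) (f g h : V → ℝ) (hg : ∀ v ∈ A, f v ≤ g v)
    (hh : ∀ v ∈ Aᶜ, f v ≤ h v) : ∑ v, f v ≤ ∑ v ∈ A, g v + ∑ v ∈ Aᶜ, h v := by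
  rw [← sum_add_sum_compl A]
  exact add_le_add (sum_le_sum hg) (sum_le_sum hh)

lemma sum_high_indicator {A : Finset V} {i : V → ℕ} (hA : ∀ v ∈ A, i v ≤ 2) {l : ℕ} (hl : 3 ≤ l) :
    ∑ v ∈ Aᶜ, (if l ≤ i v then (1 : ℝ) else 0) = (levelCard i l : ℝ) := by
  rw [sum_boole, levelCard]
  congr 2
  ext v
  simp only [mem_filter, mem_compl, mem_univ, true_and, and_iff_right_iff_imp]
  intro h hv
  have := hA v hv
  omega

lemma levelCard_low {A : Finset V} {i : V → ℕ} (hB : ∀ v ∉ A, 2 ≤ i v) {l : ℕ} (hl : l ≤ 2) :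
    levelCard i l = (A.filter fun v => l ≤ i v).card + Aᶜ.card := by
  rw [levelCard, ← card_union_of_disjoint]
  · congr 1
    ext v
    simp only [mem_filter, mem_univ, true_and, mem_union, mem_compl]
    by_cases hv : v ∈ A
    · simp [hv]
    · simp [hv, hl.trans (hB v hv)]
  · rw [disjoint_left]
    intro v hv hv'
    exact (mem_compl.1 hv') (mem_filter.1 hv).1

lemma levelCard_high_le {A : Finset V} {i : V → ℕ} (hA : ∀ v ∈ A, i v ≤ 2) {l : ℕ} (hl : 3 ≤ l) :
    levelCard i l ≤ Aᶜ.card := by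
  apply card_le_card
  intro v hv
  rw [mem_compl]
  intro h
  have := hA v h
  have := (mem_filter.1 hv).2
  omega

/-- Row bound for the vertices of `A`. -/
lemma sum_low_rows (A : Finset V) (i : V → ℕ) (hA : ∀ v ∈ A, i v ≤ 2) (N : ℕ) :
    ∑ v ∈ A, (levelCard i (N + 2 - i v) : ℝ)
      = ((A.filter fun v => 2 ≤ i v).card : ℝ) * levelCard i N
        + (((A.filter fun v => 1 ≤ i v).card : ℝ) - (A.filter fun v => 2 ≤ i v).card)
          * levelCard i (N + 1)
        + ((A.card : ℝ) - (A.filter fun v => 1 ≤ i v).card) * levelCard i (N + 2) := by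
  have : ∀ v ∈ A, (levelCard i (N + 2 - i v) : ℝ) = levelCard i (N + 2)
      + ((levelCard i (N + 1) : ℝ) - levelCard i (N + 2)) * (if 1 ≤ i v then 1 else 0)
      + ((levelCard i N : ℝ) - levelCard i (N + 1)) * (if 2 ≤ i v then 1 else 0) := by
    intro v hv
    have := hA v hv
    interval_cases h : i v <;> simp
  rw [sum_congr rfl this, sum_add_distrib, sum_add_distrib, ← mul_sum, ← mul_sum,
    sum_boole, sum_boole, sum_const, nsmul_eq_mul]
  ring

end

section
variable {V : Type*} [Fintype V]

lemma lattice_six {m : ℕ} (hm : 0 < m) {A : Finset V} {i : V → ℕ}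
    (hAm : A.card = m) (hAc : Aᶜ.card = 2 * m)
    (hA : ∀ v ∈ A, i v ≤ 2) (hB : ∀ v ∉ A, 2 ≤ i v)
    (h0 : 3 * m ^ 2 ≤ ∑ u, levelCard i (6 - i u))
    (h1 : 5 * m ^ 2 ≤ ∑ u, levelCard i (4 - i u)) :
    6 * m ≤ ∑ v, i v := by
  have hs := sum_levelCard_le i 6
  simp only [sum_range_succ, range_zero, sum_empty, zero_add] at hs
  norm_num at hs
  obtain ⟨a₁, ha₁⟩ : ∃ a : ℕ, (A.filter fun v => 1 ≤ i v).card = a := ⟨_, rfl⟩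
  obtain ⟨a₂, ha₂⟩ : ∃ a : ℕ, (A.filter fun v => 2 ≤ i v).card = a := ⟨_, rfl⟩
  have hF1 : levelCard i 1 = a₁ + 2 * m := by rw [levelCard_low hB (by norm_num), ha₁, hAc]
  have hF2 : levelCard i 2 = a₂ + 2 * m := by rw [levelCard_low hB (by norm_num), ha₂, hAc]
  have hF0 : levelCard i 0 = 3 * m := by
    rw [levelCard_low hB (by norm_num), hAc]; simp [hAm]; ring
  have haa : a₂ ≤ a₁ := by
    have := levelCard_antitone i (show 1 ≤ 2 by norm_num)
    omega
  have ha1m : a₁ ≤ m := by rw [← ha₁, ← hAm]; exact card_filter_le _ _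
  have hC := levelCard_high_le hA (l := 3) le_rfl
  rw [hAc] at hC
  have m34 := levelCard_antitone i (show 3 ≤ 4 by norm_num)
  have m45 := levelCard_antitone i (show 4 ≤ 5 by norm_num)
  have m56 := levelCard_antitone i (show 5 ≤ 6 by norm_num)
  have r0 := sum_le_of_bound_on A (fun u => (levelCard i (6 - i u) : ℝ))
    (fun u => (levelCard i (6 - i u) : ℝ))
    (fun u => (levelCard i 4 : ℝ) + ((levelCard i 3 : ℝ) - levelCard i 4) * (if 3 ≤ i u then 1 else 0)
      + (2 * m + a₂ - levelCard i 3) * (if 4 ≤ i u then 1 else 0)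
      + ((a₁ : ℝ) - a₂) * (if 5 ≤ i u then 1 else 0) + ((m : ℝ) - a₁) * (if 6 ≤ i u then 1 else 0))
    (fun _ _ => le_rfl) (by
      intro v hv
      have h2 := hB v (mem_compl.1 hv)
      rcases lt_or_ge (i v) 6 with h | h
      · interval_cases hi : i v <;> simp [hF1, hF2] <;> linarith
      · have : 6 - i v = 0 := by omega
        simp only [this, hF0]
        rw [if_pos (by omega), if_pos (by omega), if_pos (by omega), if_pos (by omega)]
        push_cast
        linarith)
  have r1 := sum_le_of_bound_on A (fun u => (levelCard i (4 - i u) : ℝ))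
    (fun u => (levelCard i (4 - i u) : ℝ))
    (fun u => ((a₂ : ℝ) + 2 * m) + ((a₁ : ℝ) - a₂) * (if 3 ≤ i u then 1 else 0)
      + ((m : ℝ) - a₁) * (if 4 ≤ i u then 1 else 0))
    (fun _ _ => le_rfl) (by
      intro v hv
      have h2 := hB v (mem_compl.1 hv)
      rcases lt_or_ge (i v) 4 with h | h
      · interval_cases hi : i v <;> simp [hF1, hF2]
        linarith
      · have : 4 - i v = 0 := by omega
        simp only [this, hF0]
        rw [if_pos (by omega), if_pos (by omega)]
        push_cast
        linarith)
  rw [sum_low_rows A i hA 4] at r0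
  rw [sum_low_rows A i hA 2] at r1
  simp only [sum_add_distrib, ← mul_sum, sum_const, sum_high_indicator hA le_rfl,
    sum_high_indicator hA (show 3 ≤ 4 by norm_num), sum_high_indicator hA (show 3 ≤ 5 by norm_num),
    sum_high_indicator hA (show 3 ≤ 6 by norm_num), hAc, ha₁, ha₂, hAm, nsmul_eq_mul] at r0 r1
  norm_num [hF2] at r0 r1
  have h0' : (3 * m ^ 2 : ℝ) ≤ ∑ u, (levelCard i (6 - i u) : ℝ) := by exact_mod_cast h0
  have h1' : (5 * m ^ 2 : ℝ) ≤ ∑ u, (levelCard i (4 - i u) : ℝ) := by exact_mod_cast h1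
  have key := @level_ineq_six_scaled m a₁ a₂ (levelCard i 5) (levelCard i 6) (levelCard i 4)
    (levelCard i 3) (by exact_mod_cast hm) (by positivity) (by exact_mod_cast haa)
    (by exact_mod_cast ha1m) (by positivity) (by exact_mod_cast m56) (by exact_mod_cast m45)
    (by exact_mod_cast m34) (by exact_mod_cast hC) (by linarith) (by linarith)
  have : 2 * m ≤ a₁ + a₂ + levelCard i 3 + levelCard i 4 + levelCard i 5 + levelCard i 6 := by
    exact_mod_cast key
  omega

lemma lattice_eight {m : ℕ} (hm : 0 < m) {A : Finset V} {i : V → ℕ} (k : ℕ)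
    (hV : Fintype.card V = 3 * m) (hAm : A.card = m) (hAc : Aᶜ.card = 2 * m)
    (hA : ∀ v ∈ A, i v ≤ 2) (hB : ∀ v ∉ A, 2 ≤ i v)
    (h0 : 3 * m ^ 2 ≤ (univ.filter fun p : V × V => 2 * k + 8 ≤ i p.1 + i p.2).card)
    (h1 : 5 * m ^ 2 ≤ (univ.filter fun p : V × V => 2 * k + 6 ≤ i p.1 + i p.2).card)
    (hCT : levelCard i (k + 4) + levelCard i (k + 5) ≤ 2 * m) :
    (2 * k + 8) * m ≤ ∑ v, i v := by
  have hs := sum_levelCard_le i (2 * k + 8)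
  have hmid : ∀ j < 2 * k + 2, (2 * m : ℝ) ≤
      (levelCard i (j + 3) : ℝ) + levelCard i (2 * k + 1 - j + 3) := by
    intro j hj
    rcases le_total (j + 3) (2 * k + 1 - j + 3) with h | h
    · exact_mod_cast levelCard_add_ge hV i h (by omega) h1
    · rw [add_comm]
      exact_mod_cast levelCard_add_ge hV i h (by omega) h1
  have hmid := sum_middle_levels_ge (fun j => (levelCard i (j + 3) : ℝ)) m k hmid
  rw [card_pairs_eq_sum] at h0 h1
  rw [sum_range_succ, sum_range_succ, sum_range_succ, sum_range_succ, sum_range_succ',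
    sum_range_succ'] at hs
  norm_num [add_assoc] at hs
  norm_num [add_assoc] at hmid
  obtain ⟨a₁, ha₁⟩ : ∃ a : ℕ, (A.filter fun v => 1 ≤ i v).card = a := ⟨_, rfl⟩
  obtain ⟨a₂, ha₂⟩ : ∃ a : ℕ, (A.filter fun v => 2 ≤ i v).card = a := ⟨_, rfl⟩
  have hF1 : levelCard i 1 = a₁ + 2 * m := by rw [levelCard_low hB (by norm_num), ha₁, hAc]
  have hF2 : levelCard i 2 = a₂ + 2 * m := by rw [levelCard_low hB (by norm_num), ha₂, hAc]
  have hF0 : levelCard i 0 = 3 * m := by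
    rw [levelCard_low hB (by norm_num), hAc]; simp [hAm]; ring
  have haa : a₂ ≤ a₁ := by
    have := levelCard_antitone i (show 1 ≤ 2 by norm_num)
    omega
  have ha1m : a₁ ≤ m := by rw [← ha₁, ← hAm]; exact card_filter_le _ _
  have hc := levelCard_high_le hA (l := k + 3) (by omega)
  rw [hAc] at hc
  have mono : ∀ a b, a ≤ b → (levelCard i b : ℝ) ≤ levelCard i a := fun a b h => by
    exact_mod_cast levelCard_antitone i h
  have high : ∀ l, 3 ≤ l → (levelCard i l : ℝ) ≤ 2 * m := fun l hl => by
    exact_mod_cast hAc ▸ levelCard_high_le hA hl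
  have low2 : ∀ l, 2 ≤ l → (levelCard i l : ℝ) ≤ 2 * m + a₂ := fun l hl => by
    have : levelCard i l ≤ levelCard i 2 := levelCard_antitone i hl
    rw [hF2] at this
    rw [add_comm]
    exact_mod_cast this
  have low1 : ∀ l, 1 ≤ l → (levelCard i l : ℝ) ≤ 2 * m + a₁ := fun l hl => by
    have : levelCard i l ≤ levelCard i 1 := levelCard_antitone i hl
    rw [hF1] at this
    rw [add_comm]
    exact_mod_cast this
  have low0 : ∀ l, (levelCard i l : ℝ) ≤ 3 * m := fun l => by exact_mod_cast hV ▸ levelCard_le i l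
  have r0 := sum_le_of_bound_on A (fun u => (levelCard i (2 * k + 8 - i u) : ℝ))
    (fun u => (levelCard i (2 * k + 8 - i u) : ℝ))
    (fun u => (levelCard i (k + 5) : ℝ)
      + ((levelCard i (k + 4) : ℝ) - levelCard i (k + 5)) * (if k + 4 ≤ i u then 1 else 0)
      + (2 * m - levelCard i (k + 4)) * (if k + 5 ≤ i u then 1 else 0)
      + (a₂ : ℝ) * (if 2 * k + 6 ≤ i u then 1 else 0)
      + ((a₁ : ℝ) - a₂) * (if 2 * k + 7 ≤ i u then 1 else 0)
      + ((m : ℝ) - a₁) * (if 2 * k + 8 ≤ i u then 1 else 0))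
    (fun _ _ => le_rfl) (by
      intro v hv
      split_ifs <;> first
        | omega
        | linarith [mono (k + 5) (2 * k + 8 - i v) (by omega)]
        | linarith [mono (k + 4) (2 * k + 8 - i v) (by omega)]
        | linarith [high (2 * k + 8 - i v) (by omega)]
        | linarith [low2 (2 * k + 8 - i v) (by omega)]
        | linarith [low1 (2 * k + 8 - i v) (by omega)]
        | linarith [low0 (2 * k + 8 - i v)])
  have r1 := sum_le_of_bound_on A (fun u => (levelCard i (2 * k + 6 - i u) : ℝ))
    (fun u => (levelCard i (2 * k + 6 - i u) : ℝ))
    (fun u => (levelCard i (k + 4) : ℝ)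
      + ((levelCard i (k + 3) : ℝ) - levelCard i (k + 4)) * (if k + 3 ≤ i u then 1 else 0)
      + (2 * m - levelCard i (k + 3)) * (if k + 4 ≤ i u then 1 else 0)
      + (a₂ : ℝ) * (if 2 * k + 4 ≤ i u then 1 else 0)
      + ((a₁ : ℝ) - a₂) * (if 2 * k + 5 ≤ i u then 1 else 0)
      + ((m : ℝ) - a₁) * (if 2 * k + 6 ≤ i u then 1 else 0))
    (fun _ _ => le_rfl) (by
      intro v hv
      split_ifs <;> first
        | omega
        | linarith [mono (k + 4) (2 * k + 6 - i v) (by omega)]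
        | linarith [mono (k + 3) (2 * k + 6 - i v) (by omega)]
        | linarith [high (2 * k + 6 - i v) (by omega)]
        | linarith [low2 (2 * k + 6 - i v) (by omega)]
        | linarith [low1 (2 * k + 6 - i v) (by omega)]
        | linarith [low0 (2 * k + 6 - i v)])
  rw [show 2 * k + 8 = 2 * k + 6 + 2 by ring, sum_low_rows A i hA (2 * k + 6)] at r0
  rw [show 2 * k + 6 = 2 * k + 4 + 2 by ring, sum_low_rows A i hA (2 * k + 4)] at r1
  simp only [sum_add_distrib, ← mul_sum, sum_const,
    sum_high_indicator hA (show 3 ≤ k + 3 by omega), sum_high_indicator hA (show 3 ≤ k + 4 by omega),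
    sum_high_indicator hA (show 3 ≤ k + 5 by omega),
    sum_high_indicator hA (show 3 ≤ 2 * k + 4 by omega),
    sum_high_indicator hA (show 3 ≤ 2 * k + 5 by omega),
    sum_high_indicator hA (show 3 ≤ 2 * k + 6 by omega),
    sum_high_indicator hA (show 3 ≤ 2 * k + 7 by omega),
    sum_high_indicator hA (show 3 ≤ 2 * k + 6 + 2 by omega),
    hAc, ha₁, ha₂, hAm, nsmul_eq_mul] at r0 r1
  norm_num [add_assoc] at r0 r1
  have h0' : (3 * m ^ 2 : ℝ) ≤ ∑ u, (levelCard i (2 * k + 8 - i u) : ℝ) := by exact_mod_cast h0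
  have h1' : (5 * m ^ 2 : ℝ) ≤ ∑ u, (levelCard i (2 * k + 6 - i u) : ℝ) := by exact_mod_cast h1
  have key := @level_ineq_eight_scaled m a₁ a₂ (levelCard i (2 * k + 7)) (levelCard i (2 * k + 8))
    (levelCard i (2 * k + 6)) (levelCard i (2 * k + 5)) (levelCard i (2 * k + 4))
    (levelCard i (k + 5)) (levelCard i (k + 4)) (levelCard i (k + 3))
    (by exact_mod_cast hm) (by positivity) (by exact_mod_cast haa)
    (by exact_mod_cast ha1m) (by positivity) (mono _ _ (by omega)) (mono _ _ (by omega))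
    (mono _ _ (by omega)) (mono _ _ (by omega)) (mono _ _ (by omega)) (mono _ _ (by omega))
    (mono _ _ (by omega)) (mono _ _ (by omega)) (by exact_mod_cast hc) (by exact_mod_cast hCT)
    (by linarith) (by linarith)
  have hs' : (∑ j ∈ range (2 * k + 2), (levelCard i (j + 3) : ℝ)) + ((a₂ : ℝ) + 2 * m)
      + ((a₁ : ℝ) + 2 * m) + levelCard i (2 * k + 5) + levelCard i (2 * k + 6)
      + levelCard i (2 * k + 7) + levelCard i (2 * k + 8) ≤ ∑ v, (i v : ℝ) := by
    rw [hF1, hF2] at hs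
    simp only [← add_assoc] at hs ⊢
    exact_mod_cast hs
  have goal : ((2 * k + 8) * m : ℝ) ≤ ∑ v, (i v : ℝ) := by linarith
  exact_mod_cast goal

end

lemma lattice_claim {V : Type*} [Fintype V] {m : ℕ} (hm : 0 < m) {A : Finset V}
    (hV : Fintype.card V = 3 * m) (hAm : A.card = m) (K : ℕ) : ∀ i : V → ℕ,
    (∀ v ∈ A, i v ≤ 2) → (∀ v ∉ A, 2 ≤ i v) →
    3 * m ^ 2 ≤ (univ.filter fun p : V × V => 2 * K ≤ i p.1 + i p.2).card →
    5 * m ^ 2 ≤ (univ.filter fun p : V × V => 2 * K ≤ i p.1 + i p.2 + 2).card →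
    2 * K * m ≤ ∑ v, i v := by
  have hAc : Aᶜ.card = 2 * m := by rw [card_compl]; omega
  induction K with
  | zero => simp
  | succ K ih =>
    intro i hA hB h0 h1
    rcases Nat.lt_or_ge K 2 with hK | hK
    · calc 2 * (K + 1) * m ≤ 2 * 2 * m := by gcongr; omega
        _ = ∑ v ∈ Aᶜ, 2 := by rw [sum_const, hAc, smul_eq_mul]; ring
        _ ≤ ∑ v ∈ Aᶜ, i v := sum_le_sum fun v hv => hB v (mem_compl.1 hv)
        _ ≤ ∑ v, i v := sum_le_univ_sum_of_nonneg fun _ => Nat.zero_le _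
    rcases Nat.eq_or_lt_of_le hK with rfl | hK
    · refine lattice_six hm hAm hAc hA hB ?_ ?_
      · rwa [card_pairs_eq_sum] at h0
      · rw [← card_pairs_eq_sum]
        refine h1.trans (card_le_card fun p => ?_)
        simp only [mem_filter, mem_univ, true_and]
        omega
    obtain ⟨k, rfl⟩ : ∃ k, K = k + 3 := ⟨K - 3, by omega⟩
    rcases le_total (levelCard i (k + 4) + levelCard i (k + 5)) (2 * m) with h | h
    · have := lattice_eight hm k hV hAm hAc hA hB
        (by
          refine h0.trans (card_le_card fun p => ?_)
          simp only [mem_filter, mem_univ, true_and]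
          omega)
        (by
          refine h1.trans (card_le_card fun p => ?_)
          simp only [mem_filter, mem_univ, true_and]
          omega) h
      rwa [show 2 * (k + 3 + 1) = 2 * k + 8 by ring]
    set j : V → ℕ := fun v => i v - (if k + 4 ≤ i v then 1 else 0)
      - (if k + 5 ≤ i v then 1 else 0) with hj
    have hji : ∀ v, j v + (if k + 4 ≤ i v then 1 else 0) + (if k + 5 ≤ i v then 1 else 0) = i v := by
      intro v
      simp only [hj]
      split_ifs <;> omega
    have h2 := ih j
      (fun v hv => by have := hji v; have := hA v hv; omega)
      (fun v hv => by have := hji v; have := hB v hv; simp only [hj]; split_ifs <;> omega)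
      (h0.trans (by
        apply card_le_card
        intro p
        simp only [mem_filter, mem_univ, true_and]
        have h3 := hji p.1
        have h4 := hji p.2
        split_ifs at h3 h4 <;> omega))
      (h1.trans (by
        apply card_le_card
        intro p
        simp only [mem_filter, mem_univ, true_and]
        have h3 := hji p.1
        have h4 := hji p.2
        split_ifs at h3 h4 <;> omega))
    have h5 : ∑ v, i v = ∑ v, j v + levelCard i (k + 4) + levelCard i (k + 5) := by
      rw [← sum_congr rfl fun v _ => hji v, sum_add_distrib, sum_add_distrib]
      simp only [levelCard, card_filter]
    calc 2 * (k + 3 + 1) * m = 2 * (k + 3) * m + 2 * m := by ring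
      _ ≤ _ := by omega

lemma sum_range_add_div {β : ℕ} (hβ : 0 < β) (i : ℕ) : ∑ s ∈ range β, (i + s) / β = i := by
  induction i with
  | zero =>
    refine sum_eq_zero fun s hs => ?_
    rw [zero_add]
    exact Nat.div_eq_of_lt (mem_range.1 hs)
  | succ i ih =>
    have h1 := sum_range_succ (fun s => (i + s) / β) β
    have h2 := sum_range_succ' (fun s => (i + s) / β) β
    rw [h1, ih, Nat.add_div_right _ hβ] at h2
    simp only [add_zero] at h2
    rw [sum_congr rfl fun s _ => show (i + 1 + s) / β = (i + (s + 1)) / β by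
      rw [add_assoc, add_comm 1 s]]
    omega

/-- The weight inequality for integer valued weights. -/
lemma integer_weight_ineq {V : Type*} [Fintype V] (hn : 0 < Fintype.card V) (i : V → ℕ) {M β₀ : ℕ}
    (hi1 : ∀ v, 1 ≤ i v) (hiM : ∀ v, i v ≤ M)
    (h0 : Fintype.card V ^ 2 ≤ 3 * (univ.filter fun p : V × V => M ≤ i p.1 + i p.2).card)
    (hb : 3 * (univ.filter fun v => i v < β₀).card ≤ Fintype.card V)
    (h1 : 5 * Fintype.card V ^ 2
      ≤ 9 * (univ.filter fun p : V × V => M ≤ i p.1 + i p.2 + β₀).card) :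
    Fintype.card V * M ≤ 3 * ∑ v, i v := by
  obtain ⟨v₀⟩ : Nonempty V := Fintype.card_pos_iff.1 hn
  set n := Fintype.card V with hndef
  have hM1 : 1 ≤ M := (hi1 v₀).trans (hiM v₀)
  have hall : ∀ b, M < b → (univ.filter fun v => i v < b).card = n := by
    intro b hb
    rw [filter_true_of_mem fun v _ => (hiM v).trans_lt hb, card_univ]
  have hβ₀ : β₀ ≤ M := by
    by_contra h
    rw [hall β₀ (by omega)] at hb
    omega
  obtain ⟨β, hβdef⟩ : ∃ β, β = Nat.findGreatest
    (fun b => 3 * (univ.filter fun v => i v < b).card ≤ n) M := ⟨_, rfl⟩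
  have hPβ : 3 * (univ.filter fun v => i v < β).card ≤ n := by
    rw [hβdef]
    exact Nat.findGreatest_spec (P := fun b => 3 * (univ.filter fun v => i v < b).card ≤ n)
      (m := 0) (Nat.zero_le _) (by simp)
  have hββ₀ : β₀ ≤ β := by
    rw [hβdef]
    exact Nat.le_findGreatest hβ₀ hb
  have hβ1 : 1 ≤ β := by
    rw [hβdef]
    refine Nat.le_findGreatest hM1 ?_
    rw [filter_false_of_mem fun v _ => by have := hi1 v; omega]
    simp
  have hβM : β ≤ M := by
    rw [hβdef]
    exact Nat.findGreatest_le _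
  have hPβ' : n ≤ 3 * (univ.filter fun v => i v ≤ β).card := by
    by_contra hcon
    have h2 : 3 * (univ.filter fun v => i v < β + 1).card ≤ n := by
      simp only [Nat.lt_succ_iff]
      omega
    have h3 : β + 1 ≤ M := by
      by_contra h
      rw [hall (β + 1) (by omega)] at h2
      omega
    have := Nat.le_findGreatest (P := fun b => 3 * (univ.filter fun v => i v < b).card ≤ n) h3 h2
    omega
  have hcW : ∀ (P : V → Prop) [DecidablePred P], (univ.filter fun w : V × Fin 3 => P w.1).card
      = 3 * (univ.filter fun v => P v).card := by
    intro P _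
    rw [card_filter, Fintype.sum_prod_type, card_filter, mul_sum]
    refine sum_congr rfl fun v _ => ?_
    change ∑ y : Fin 3, (if P v then 1 else 0) = _
    rw [sum_const, card_univ, Fintype.card_fin, smul_eq_mul]
  have hcW2 : ∀ (P : V → V → Prop) [∀ u v, Decidable (P u v)],
      (univ.filter fun p : (V × Fin 3) × (V × Fin 3) => P p.1.1 p.2.1).card
      = 9 * (univ.filter fun p : V × V => P p.1 p.2).card := by
    intro P _
    rw [card_filter, Fintype.sum_prod_type, Fintype.sum_prod_type, card_filter,
      Fintype.sum_prod_type, mul_sum]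
    refine sum_congr rfl fun u _ => ?_
    calc _ = ∑ _a : Fin 3, ∑ v, ∑ _b : Fin 3, (if P u v then 1 else 0) :=
          sum_congr rfl fun a _ => Fintype.sum_prod_type _
      _ = 9 * ∑ v, (if P u v then 1 else 0) := by
        simp only [sum_const, card_univ, Fintype.card_fin, smul_eq_mul, ← mul_sum]
        ring
  obtain ⟨A, hA1, hA2, hAn⟩ := exists_subsuperset_card_eq
    (s := univ.filter fun w : V × Fin 3 => i w.1 < β)
    (t := univ.filter fun w : V × Fin 3 => i w.1 ≤ β) (n := n)
    (fun w => by simp only [mem_filter, mem_univ, true_and]; exact le_of_lt)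
    (by rw [hcW fun v => i v < β]; exact hPβ) (by rw [hcW fun v => i v ≤ β]; exact hPβ')
  have hW : Fintype.card (V × Fin 3) = 3 * n := by
    rw [Fintype.card_prod, Fintype.card_fin]; ring
  have key : ∀ s ∈ range β, 2 * ((M + s) / β) * n
      ≤ 3 * ∑ v, ((i v + s) / β + (M + s) / β - (M - i v + s) / β) := by
    intro s hs
    rw [mem_range] at hs
    have hK1 : (M - β + s) / β + 1 = (M + s) / β := by
      rw [← Nat.add_div_right _ hβ1]
      congr 1
      omega
    have hmono : ∀ a b, a ≤ b → a / β ≤ b / β := fun a b h => Nat.div_le_div_right h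
    have hs1 : (β + s) / β = 1 := by
      rw [Nat.add_div_left _ hβ1, Nat.div_eq_of_lt hs]
    have h2 := lattice_claim hn hW hAn ((M + s) / β)
      (fun w => (i w.1 + s) / β + (M + s) / β - (M - i w.1 + s) / β)
      (by
        intro w hw
        have h3 := (mem_filter.1 (hA2 hw)).2
        have h4 := hmono (i w.1 + s) (β + s) (by omega)
        have h5 := hmono (M - β + s) (M - i w.1 + s) (by omega)
        omega)
      (by
        intro w hw
        have h3 : β ≤ i w.1 := by
          by_contra h
          exact hw (hA1 (by simpa using h))
        have h4 := hmono (β + s) (i w.1 + s) (by omega)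
        have h5 := hmono (M - i w.1 + s) (M - β + s) (by omega)
        omega)
      (by
        have : (univ.filter fun p : (V × Fin 3) × (V × Fin 3) => M ≤ i p.1.1 + i p.2.1).card
          = 9 * (univ.filter fun p : V × V => M ≤ i p.1 + i p.2).card :=
            hcW2 fun u v => M ≤ i u + i v
        refine le_trans (by omega) (this.symm.le.trans ?_)
        apply card_le_card
        intro p
        simp only [mem_filter, mem_univ, true_and]
        intro h
        have h3 := hmono (M - i p.2.1 + s) (i p.1.1 + s) (by omega)
        have h4 := hmono (M - i p.1.1 + s) (i p.2.1 + s) (by omega)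
        have h5 := hmono (M - i p.1.1 + s) (M + s) (by omega)
        have h6 := hmono (M - i p.2.1 + s) (M + s) (by omega)
        omega)
      (by
        have : (univ.filter fun p : (V × Fin 3) × (V × Fin 3) => M ≤ i p.1.1 + i p.2.1 + β).card
          = 9 * (univ.filter fun p : V × V => M ≤ i p.1 + i p.2 + β).card :=
            hcW2 fun u v => M ≤ i u + i v + β
        have h7 : (univ.filter fun p : V × V => M ≤ i p.1 + i p.2 + β₀).card
          ≤ (univ.filter fun p : V × V => M ≤ i p.1 + i p.2 + β).card := by
          apply card_le_card
          intro p
          simp only [mem_filter, mem_univ, true_and]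
          omega
        refine le_trans (by omega) (this.symm.le.trans ?_)
        apply card_le_card
        intro p
        simp only [mem_filter, mem_univ, true_and]
        intro h
        have h3 := hmono (M - i p.2.1 + s) (i p.1.1 + s + β) (by omega)
        have h4 := hmono (M - i p.1.1 + s) (i p.2.1 + s + β) (by omega)
        rw [Nat.add_div_right _ hβ1] at h3 h4
        have h5 := hmono (M - i p.1.1 + s) (M + s) (by omega)
        have h6 := hmono (M - i p.2.1 + s) (M + s) (by omega)
        omega)
    refine h2.trans_eq ?_
    rw [Fintype.sum_prod_type, mul_sum]
    refine sum_congr rfl fun v _ => ?_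
    simp
  have h2 := sum_le_sum key
  rw [← sum_mul, ← mul_sum, ← mul_sum, sum_range_add_div hβ1, sum_comm] at h2
  have h3 : ∀ v, ∑ s ∈ range β, ((i v + s) / β + (M + s) / β - (M - i v + s) / β) = 2 * i v := by
    intro v
    have h4 : ∑ s ∈ range β, ((i v + s) / β + (M + s) / β - (M - i v + s) / β)
        + ∑ s ∈ range β, (M - i v + s) / β
        = ∑ s ∈ range β, (i v + s) / β + ∑ s ∈ range β, (M + s) / β := by
      rw [← sum_add_distrib, ← sum_add_distrib]
      refine sum_congr rfl fun s _ => ?_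
      have : (M - i v + s) / β ≤ (M + s) / β := Nat.div_le_div_right (by omega)
      exact Nat.sub_add_cancel (this.trans (Nat.le_add_left _ _))
    rw [sum_range_add_div hβ1, sum_range_add_div hβ1, sum_range_add_div hβ1] at h4
    have := hiM v
    omega
  rw [sum_congr rfl fun v _ => h3 v, ← mul_sum] at h2
  linarith

/-- The weight inequality for normalised real weights. -/
lemma normalised_weight_ineq {V : Type*} [Fintype V] (hn : 0 < Fintype.card V) (y : V → ℝ) {b : ℝ}
    (hy : ∀ v, 0 ≤ y v)
    (h0 : Fintype.card V ^ 2 ≤ 3 * (univ.filter fun p : V × V => 1 ≤ y p.1 + y p.2).card)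
    (hb : 3 * (univ.filter fun v => y v < b).card ≤ Fintype.card V)
    (h1 : 5 * Fintype.card V ^ 2
      ≤ 9 * (univ.filter fun p : V × V => 1 ≤ y p.1 + y p.2 + b).card) :
    (Fintype.card V : ℝ) ≤ 3 * ∑ v, y v := by
  have key : ∀ M : ℕ, 1 ≤ M → (Fintype.card V * M : ℝ) ≤ 3 * (M * ∑ v, y v + Fintype.card V) := by
    intro M hM
    have hlt : ∀ x : ℝ, (M : ℝ) * x < ((⌊(M : ℝ) * x⌋₊ + 1 : ℕ) : ℝ) := fun x => by
      push_cast
      exact Nat.lt_floor_add_one _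
    have h := integer_weight_ineq hn (fun v => min M (⌊(M : ℝ) * y v⌋₊ + 1)) (M := M)
      (β₀ := min M (⌊(M : ℝ) * b⌋₊ + 1)) (fun v => by simp [hM]) (fun v => min_le_left _ _)
      (h0.trans (Nat.mul_le_mul_left 3 (card_le_card fun p => by
        simp only [mem_filter, mem_univ, true_and]
        intro hp
        have h2 : M < (⌊(M : ℝ) * y p.1⌋₊ + 1) + (⌊(M : ℝ) * y p.2⌋₊ + 1) := by
          have h3 := hlt (y p.1)
          have h4 := hlt (y p.2)
          have h5 : (M : ℝ) ≤ M * (y p.1 + y p.2) := le_mul_of_one_le_right (by positivity) hp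
          have : (M : ℝ) < ((⌊(M : ℝ) * y p.1⌋₊ + 1 : ℕ) : ℝ) + ((⌊(M : ℝ) * y p.2⌋₊ + 1 : ℕ) : ℝ) := by
            linarith
          exact_mod_cast this
        omega)))
      (le_trans (Nat.mul_le_mul_left 3 (card_le_card fun v => by
        simp only [mem_filter, mem_univ, true_and]
        intro hv
        by_contra hcon
        push Not at hcon
        have : ⌊(M : ℝ) * b⌋₊ ≤ ⌊(M : ℝ) * y v⌋₊ :=
          Nat.floor_le_floor (mul_le_mul_of_nonneg_left hcon (by positivity))
        omega)) hb)
      (h1.trans (Nat.mul_le_mul_left 9 (card_le_card fun p => by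
        simp only [mem_filter, mem_univ, true_and]
        intro hp
        have h2 : M < (⌊(M : ℝ) * y p.1⌋₊ + 1) + (⌊(M : ℝ) * y p.2⌋₊ + 1)
            + (⌊(M : ℝ) * b⌋₊ + 1) := by
          have h3 := hlt (y p.1)
          have h4 := hlt (y p.2)
          have h6 := hlt b
          have h5 : (M : ℝ) ≤ M * (y p.1 + y p.2 + b) := le_mul_of_one_le_right (by positivity) hp
          have : (M : ℝ) < ((⌊(M : ℝ) * y p.1⌋₊ + 1 : ℕ) : ℝ) + ((⌊(M : ℝ) * y p.2⌋₊ + 1 : ℕ) : ℝ)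
              + ((⌊(M : ℝ) * b⌋₊ + 1 : ℕ) : ℝ) := by
            linarith
          exact_mod_cast this
        omega)))
    have h' : (Fintype.card V * M : ℝ) ≤ 3 * ∑ v, ((min M (⌊(M : ℝ) * y v⌋₊ + 1) : ℕ) : ℝ) := by
      exact_mod_cast h
    refine h'.trans ?_
    have : ∑ v, ((min M (⌊(M : ℝ) * y v⌋₊ + 1) : ℕ) : ℝ) ≤ ∑ v, ((M : ℝ) * y v + 1) := by
      refine sum_le_sum fun v _ => ?_
      have h2 : ((min M (⌊(M : ℝ) * y v⌋₊ + 1) : ℕ) : ℝ) ≤ ((⌊(M : ℝ) * y v⌋₊ + 1 : ℕ) : ℝ) := by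
        exact_mod_cast min_le_right _ _
      refine h2.trans ?_
      push_cast
      have := Nat.floor_le (mul_nonneg (Nat.cast_nonneg (α := ℝ) M) (hy v))
      linarith
    rw [sum_add_distrib, ← mul_sum, sum_const, card_univ, nsmul_eq_mul, mul_one] at this
    linarith
  by_contra hcon
  push Not at hcon
  obtain ⟨M, hM⟩ := exists_nat_gt (3 * Fintype.card V / (Fintype.card V - 3 * ∑ v, y v))
  rw [div_lt_iff₀ (by linarith)] at hM
  have hM1 : 1 ≤ M := by
    by_contra h
    have : M = 0 := by omega
    subst this
    have : (0 : ℝ) < Fintype.card V := by exact_mod_cast hn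
    norm_num at hM
    linarith
  have := key M hM1
  linarith

/-- The weight inequality: if the pairs of vertices whose weight complements the minimum weight,
respectively the lower third quantile, are dense, then the total weight is at least `n / 3`. -/
lemma weight_ineq {V : Type*} [Fintype V] (hn : 0 < Fintype.card V) (y : V → ℝ) {y₀ b : ℝ}
    (hy : ∀ v, y₀ ≤ y v)
    (h0 : Fintype.card V ^ 2 ≤ 3 * (univ.filter fun p : V × V => 1 - y₀ ≤ y p.1 + y p.2).card)
    (hb : 3 * (univ.filter fun v => y v < b).card ≤ Fintype.card V)
    (h1 : 5 * Fintype.card V ^ 2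
      ≤ 9 * (univ.filter fun p : V × V => 1 - b ≤ y p.1 + y p.2).card) :
    (Fintype.card V : ℝ) ≤ 3 * ∑ v, y v := by
  rcases le_or_gt (1 / 3) y₀ with h | h
  · have : ∑ v : V, (1 / 3 : ℝ) ≤ ∑ v, y v := sum_le_sum fun v _ => h.trans (hy v)
    rw [sum_const, card_univ, nsmul_eq_mul] at this
    linarith
  have hd : 0 < 1 - 3 * y₀ := by linarith
  have key := normalised_weight_ineq hn (fun v => (y v - y₀) / (1 - 3 * y₀))
    (b := (max b y₀ - y₀) / (1 - 3 * y₀))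
    (fun v => div_nonneg (by linarith [hy v]) hd.le)
    (h0.trans (Nat.mul_le_mul_left 3 (card_le_card fun p => by
      simp only [mem_filter, mem_univ, true_and]
      intro hp
      rw [← add_div, le_div_iff₀ hd]
      linarith)))
    (le_trans (Nat.mul_le_mul_left 3 (card_le_card fun v => by
      simp only [mem_filter, mem_univ, true_and]
      intro hv
      rw [div_lt_div_iff_of_pos_right hd, sub_lt_sub_iff_right, lt_max_iff] at hv
      exact hv.resolve_right (not_lt.2 (hy v)))) hb)
    (h1.trans (Nat.mul_le_mul_left 9 (card_le_card fun p => by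
      simp only [mem_filter, mem_univ, true_and]
      intro hp
      rw [← add_div, ← add_div, le_div_iff₀ hd]
      linarith [le_max_left b y₀])))
  rw [← sum_div, mul_div_assoc', le_div_iff₀ hd, sum_sub_distrib, sum_const, card_univ,
    nsmul_eq_mul] at key
  linarith

section
variable {V : Type*} [Fintype V] [DecidableEq V]

lemma card_pairs_of_triple (v : V) (e : Finset V) (he : e.card = 3) :
    (univ.filter fun p : V × V => ({v, p.1, p.2} : Finset V) = e).card = if v ∈ e then 2 else 0 := by
  split_ifs with hv
  · obtain ⟨a, b, hab, hE⟩ : ∃ a b, a ≠ b ∧ e.erase v = {a, b} := by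
      rw [← card_eq_two, card_erase_of_mem hv, he]
    have hva : v ≠ a := fun h => by
      have : a ∈ e.erase v := by rw [hE]; simp
      exact (mem_erase.1 this).1 h.symm
    have hvb : v ≠ b := fun h => by
      have : b ∈ e.erase v := by rw [hE]; simp
      exact (mem_erase.1 this).1 h.symm
    have he' : e = {v, a, b} := by rw [← hE, insert_erase hv]
    have : (univ.filter fun p : V × V => ({v, p.1, p.2} : Finset V) = e) = {(a, b), (b, a)} := by
      ext ⟨x, y⟩
      simp only [mem_filter, mem_univ, true_and, mem_insert, mem_singleton, Prod.mk.injEq]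
      rw [he']
      constructor
      · intro h
        have h1 : a ∈ ({v, x, y} : Finset V) := by rw [h]; simp
        have h2 : b ∈ ({v, x, y} : Finset V) := by rw [h]; simp
        simp only [mem_insert, mem_singleton] at h1 h2
        rcases h1 with h1 | h1 | h1
        · exact absurd h1.symm hva
        · rcases h2 with h2 | h2 | h2
          · exact absurd h2.symm hvb
          · exact absurd (h1.trans h2.symm) hab
          · exact Or.inl ⟨h1.symm, h2.symm⟩
        · rcases h2 with h2 | h2 | h2
          · exact absurd h2.symm hvb
          · exact Or.inr ⟨h2.symm, h1.symm⟩
          · exact absurd (h1.trans h2.symm) hab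
      · rintro (⟨rfl, rfl⟩ | ⟨rfl, rfl⟩)
        · rfl
        · rw [pair_comm]
    rw [this, card_pair]
    simp [hab]
  · rw [card_eq_zero, filter_eq_empty_iff]
    intro p _ h
    apply hv
    rw [← h]
    simp

/-- Passing from sums over ordered pairs to sums over triples through a vertex. -/
lemma sum_pairs_eq (f : Finset V → ℝ) (hf : ∀ e, e.card ≠ 3 → f e = 0) (v : V) :
    ∑ u, ∑ u', f {v, u, u'} = 2 * ∑ e ∈ univ.filter (fun e : Finset V => v ∈ e), f e := by
  rw [← Fintype.sum_prod_type' (fun u u' => f {v, u, u'}),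
    ← sum_fiberwise (s := univ) (g := fun p : V × V => ({v, p.1, p.2} : Finset V)),
    sum_filter, mul_sum]
  refine sum_congr rfl fun e _ => ?_
  rw [sum_congr rfl (g := fun _ => f e) fun p hp => by rw [(mem_filter.1 hp).2], sum_const,
    nsmul_eq_mul]
  by_cases he : e.card = 3
  · rw [card_pairs_of_triple v e he]
    split_ifs <;> simp
  · rw [hf e he]
    simp

/-- The total weight at a vertex. -/
def load (w : Finset V → ℝ) (v : V) : ℝ := ∑ e ∈ univ.filter (fun e : Finset V => v ∈ e), w e

lemma sum_mul_load (w : Finset V → ℝ) (y : V → ℝ) :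
    ∑ v, y v * load w v = ∑ e, w e * ∑ v ∈ e, y v := by
  simp only [load, mul_sum, sum_filter]
  rw [sum_comm]
  refine sum_congr rfl fun e _ => ?_
  simp only [mul_ite, mul_zero]
  rw [← sum_filter, filter_mem_eq_inter, univ_inter]
  exact sum_congr rfl fun v _ => mul_comm _ _

lemma sum_load (w : Finset V → ℝ) (hw : ∀ e, e.card ≠ 3 → w e = 0) :
    ∑ v, load w v = 3 * ∑ e, w e := by
  have := sum_mul_load w (fun _ => 1)
  simp only [one_mul] at this
  rw [this, mul_sum]
  refine sum_congr rfl fun e _ => ?_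
  by_cases he : e.card = 3
  · simp [he]; ring
  · simp [hw e he]

lemma load_add_single (w : Finset V → ℝ) (e : Finset V) (s : ℝ) (v : V) :
    load (fun f => w f + if f = e then s else 0) v = load w v + if v ∈ e then s else 0 := by
  rw [load, sum_add_distrib, sum_ite_eq']
  simp [load]

lemma sq_pos_part_add_le (x s : ℝ) :
    max (x + s) 0 ^ 2 ≤ max x 0 ^ 2 + 2 * s * max x 0 + s ^ 2 := by
  rcases max_cases x 0 with ⟨h1, h2⟩ | ⟨h1, h2⟩ <;>
  rcases max_cases (x + s) 0 with ⟨h3, h4⟩ | ⟨h3, h4⟩ <;> rw [h1, h3] <;> nlinarith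

/-- The penalised total weight. -/
def penalised (A : ℝ) (w : Finset V → ℝ) : ℝ :=
  ∑ e, w e - A / 2 * ∑ v, max (load w v - 1) 0 ^ 2

lemma continuous_penalised (A : ℝ) : Continuous (penalised (V := V) A) := by
  unfold penalised load
  fun_prop

lemma penalised_add_single {A : ℝ} (hA : 0 ≤ A) (w : Finset V → ℝ) {e : Finset V}
    (he : e.card = 3) (s : ℝ) :
    penalised A w + s * (1 - ∑ v ∈ e, A * max (load w v - 1) 0) - 3 * A / 2 * s ^ 2
      ≤ penalised A (fun f => w f + if f = e then s else 0) := by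
  have h1 : ∑ v, max (load (fun f => w f + if f = e then s else 0) v - 1) 0 ^ 2
      ≤ ∑ v, (max (load w v - 1) 0 ^ 2 + if v ∈ e then 2 * s * max (load w v - 1) 0 + s ^ 2 else 0) := by
    refine sum_le_sum fun v _ => ?_
    rw [load_add_single]
    split_ifs with h
    · have := sq_pos_part_add_le (load w v - 1) s
      rw [show load w v + s - 1 = load w v - 1 + s by ring]
      linarith
    · simp
  rw [sum_add_distrib, ← sum_filter, filter_mem_eq_inter, univ_inter, sum_add_distrib, sum_const,
    he, ← mul_sum] at h1
  have h2 := mul_le_mul_of_nonneg_left h1 (show 0 ≤ A / 2 by linarith)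
  unfold penalised
  rw [sum_add_distrib, sum_ite_eq', if_pos (mem_univ e), ← mul_sum]
  simp only [nsmul_eq_mul, Nat.cast_ofNat] at h2
  linarith

/-- Existence of bounded weights with complementary dual vertex weights. -/
lemma exists_weights (H : Finset (Finset V)) (hH : ∀ e ∈ H, e.card = 3) {A cap : ℝ} (hA : 0 < A)
    (hcap : 0 ≤ cap) :
    ∃ w : Finset V → ℝ, (∀ e, 0 ≤ w e) ∧ (∀ e, w e ≤ cap) ∧ (∀ e ∉ H, w e = 0) ∧
      (∀ e ∈ H, w e < cap → 1 ≤ ∑ v ∈ e, A * max (load w v - 1) 0) ∧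
      (∀ e ∈ H, 0 < w e → ∑ v ∈ e, A * max (load w v - 1) 0 ≤ 1) := by
  obtain ⟨w, hw, hmax⟩ := (isCompact_Icc (a := (0 : Finset V → ℝ))
    (b := fun e => if e ∈ H then cap else 0)).exists_isMaxOn
    ⟨0, le_rfl, fun e => by simp only [Pi.zero_apply]; split_ifs <;> simp [hcap]⟩
    (continuous_penalised A).continuousOn
  have hw0 : ∀ e, 0 ≤ w e := fun e => hw.1 e
  have hw1 : ∀ e, w e ≤ if e ∈ H then cap else 0 := fun e => hw.2 e
  have hstep : ∀ e ∈ H, ∀ s : ℝ, 0 ≤ w e + s → w e + s ≤ cap →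
      s * (1 - ∑ v ∈ e, A * max (load w v - 1) 0) ≤ 3 * A / 2 * s ^ 2 := by
    intro e he s h1 h2
    have h3 := penalised_add_single hA.le w (hH e he) s
    have h4 : penalised A (fun f => w f + if f = e then s else 0) ≤ penalised A w := by
      apply hmax
      constructor
      · intro f
        have := hw0 f
        simp only [Pi.zero_apply]
        split_ifs with h
        · rwa [h]
        · simpa
      · intro f
        have := hw1 f
        dsimp only
        split_ifs at this ⊢ with h h' h'
        · rwa [h]
        · exact absurd (h ▸ he) h'
        · simpa
        · simpa
    linarith
  refine ⟨w, hw0, fun e => (hw1 e).trans ?_, fun e he => ?_, fun e he hlt => ?_,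
    fun e he hpos => ?_⟩
  · split_ifs <;> simp [hcap]
  · have := hw1 e
    rw [if_neg he] at this
    exact le_antisymm this (hw0 e)
  · by_contra hcon
    push Not at hcon
    set r := 1 - ∑ v ∈ e, A * max (load w v - 1) 0 with hr
    have hr0 : 0 < r := by linarith
    obtain ⟨s, hs⟩ : ∃ s, s = min (cap - w e) (r / (3 * A)) := ⟨_, rfl⟩
    have hs0 : 0 < s := by rw [hs]; exact lt_min (by linarith) (by positivity)
    have hs1 : s ≤ cap - w e := by rw [hs]; exact min_le_left _ _
    have hs2 : s ≤ r / (3 * A) := by rw [hs]; exact min_le_right _ _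
    rw [le_div_iff₀ (by positivity)] at hs2
    have h1 := hstep e he s (by linarith [hw0 e]) (by linarith)
    have h2 : s * (s * (3 * A)) ≤ s * r := mul_le_mul_of_nonneg_left hs2 hs0.le
    have h3 : 0 < s * r := by positivity
    linarith
  · by_contra hcon
    push Not at hcon
    set r := 1 - ∑ v ∈ e, A * max (load w v - 1) 0 with hr
    have hr0 : 0 < -r := by linarith
    obtain ⟨s, hs⟩ : ∃ s, s = min (w e) (-r / (3 * A)) := ⟨_, rfl⟩
    have hs0 : 0 < s := by rw [hs]; exact lt_min hpos (by positivity)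
    have hs1 : s ≤ w e := by rw [hs]; exact min_le_left _ _
    have hs2 : s ≤ -r / (3 * A) := by rw [hs]; exact min_le_right _ _
    rw [le_div_iff₀ (by positivity)] at hs2
    have hcap' := hw1 e
    rw [if_pos he] at hcap'
    have h1 := hstep e he (-s) (by linarith) (by linarith)
    have h2 : s * (s * (3 * A)) ≤ s * -r := mul_le_mul_of_nonneg_left hs2 hs0.le
    have h3 : 0 < s * -r := by positivity
    linarith

end

section
variable {V : Type*} [Fintype V] [DecidableEq V]

/-- Bounded almost-fractional matchings of weight almost `n / 3`. The function `c` records the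
number of edges at a vertex. -/
lemma exists_fractional (H : Finset (Finset V)) (hH : ∀ e ∈ H, e.card = 3) {γ A κ : ℝ} (hγ : 0 < γ)
    (hA : 1 ≤ A) (hκ : 0 < κ) (hn : 0 < Fintype.card V)
    (hdeg : ∀ v, (1 / 3 + γ) * (Fintype.card V : ℝ) ^ 2 ≤ 2 * ((H.filter fun e => v ∈ e).card : ℝ))
    (hbig : 3 * (univ.filter fun v =>
      2 * ((H.filter fun e => v ∈ e).card : ℝ) < (5 / 9 + γ) * (Fintype.card V : ℝ) ^ 2).card
        ≤ Fintype.card V) :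
    ∃ w : Finset V → ℝ, (∀ e, 0 ≤ w e) ∧ (∀ e, w e ≤ κ / (Fintype.card V : ℝ) ^ 2) ∧
      (∀ e ∉ H, w e = 0) ∧
      A * ∑ v, max (load w v - 1) 0 ≤ Fintype.card V / 2 ∧
      (Fintype.card V : ℝ) / 3 - 3 * Fintype.card V / (κ * γ) ≤ ∑ e, w e ∧
      ∑ e, w e ≤ Fintype.card V / 2 := by
  set n := Fintype.card V with hndef
  have hnR : (0 : ℝ) < n := by exact_mod_cast hn
  obtain ⟨w, hw0, hw1, hwH, hlow, hhigh⟩ := exists_weights H hH (A := A) (cap := κ / (n : ℝ) ^ 2)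
    (by linarith) (by positivity)
  have hw3 : ∀ e, e.card ≠ 3 → w e = 0 := fun e he => hwH e fun h => he (hH e h)
  obtain ⟨y, hy⟩ : ∃ y : V → ℝ, y = fun v => A * max (load w v - 1) 0 := ⟨_, rfl⟩
  have hyv : ∀ v, y v = A * max (load w v - 1) 0 := fun v => by rw [hy]
  have hy0 : ∀ v, 0 ≤ y v := fun v => by rw [hyv]; exact mul_nonneg (by linarith) (le_max_right _ _)
  simp only [← hyv] at hlow hhigh
  have hsy : ∑ v, y v = A * ∑ v, max (load w v - 1) 0 := by rw [mul_sum, hy]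
  -- the dual weights are bounded by the total weight
  have hyW : ∑ v, y v ≤ ∑ e, w e := by
    calc ∑ v, y v ≤ ∑ v, y v * load w v := by
          refine sum_le_sum fun v _ => ?_
          rcases le_or_gt (load w v) 1 with h | h
          · have : y v = 0 := by rw [hyv, max_eq_right (by linarith), mul_zero]
            simp [this]
          · exact le_mul_of_one_le_right (hy0 v) h.le
      _ = ∑ e, w e * ∑ v ∈ e, y v := sum_mul_load w y
      _ ≤ ∑ e, w e := by
          refine sum_le_sum fun e _ => ?_
          rcases (hw0 e).eq_or_lt with h | h
          · simp [← h]
          · have he : e ∈ H := by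
              by_contra he
              rw [hwH e he] at h
              exact lt_irrefl _ h
            exact mul_le_of_le_one_right h.le (hhigh e he h)
  have hexc : 0 ≤ ∑ v, max (load w v - 1) 0 := sum_nonneg fun v _ => le_max_right _ _
  have hWn : ∑ e, w e ≤ n / 2 := by
    have h1 : 3 * ∑ e, w e ≤ n + ∑ v, max (load w v - 1) 0 := by
      rw [← sum_load w hw3]
      calc ∑ v, load w v ≤ ∑ v, (1 + max (load w v - 1) 0) :=
            sum_le_sum fun v _ => by linarith [le_max_left (load w v - 1) 0]
        _ = _ := by rw [sum_add_distrib, sum_const, card_univ, nsmul_eq_mul, mul_one]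
    have h2 : 1 * ∑ v, max (load w v - 1) 0 ≤ A * ∑ v, max (load w v - 1) 0 :=
      mul_le_mul_of_nonneg_right hA hexc
    linarith
  refine ⟨w, hw0, hw1, hwH, by linarith, ?_, hWn⟩
  -- edges of deficient dual weight
  obtain ⟨D, hD⟩ : ∃ D, D = H.filter fun e => ∑ v ∈ e, y v < 1 := ⟨_, rfl⟩
  have hDcard : (D.card : ℝ) * (κ / (n : ℝ) ^ 2) ≤ n / 2 := by
    calc (D.card : ℝ) * (κ / (n : ℝ) ^ 2) = ∑ e ∈ D, κ / (n : ℝ) ^ 2 := by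
          rw [sum_const, nsmul_eq_mul]
      _ ≤ ∑ e ∈ D, w e := by
          refine sum_le_sum fun e he => ?_
          rw [hD, mem_filter] at he
          by_contra hcon
          push Not at hcon
          linarith [hlow e he.1 hcon]
      _ ≤ ∑ e, w e := sum_le_univ_sum_of_nonneg hw0
      _ ≤ n / 2 := hWn
  rw [mul_div_assoc', div_le_iff₀ (by positivity)] at hDcard
  obtain ⟨B, hB⟩ : ∃ B, B = univ.filter fun v =>
    γ * (n : ℝ) ^ 2 < 2 * ((D.filter fun e => v ∈ e).card : ℝ) := ⟨_, rfl⟩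
  have hBcard : (B.card : ℝ) ≤ 3 * n / (κ * γ) := by
    have h1 : (B.card : ℝ) * (γ * (n : ℝ) ^ 2) ≤ 2 * (3 * D.card) := by
      calc (B.card : ℝ) * (γ * (n : ℝ) ^ 2) = ∑ v ∈ B, γ * (n : ℝ) ^ 2 := by
            rw [sum_const, nsmul_eq_mul]
        _ ≤ ∑ v ∈ B, 2 * ((D.filter fun e => v ∈ e).card : ℝ) := by
            refine sum_le_sum fun v hv => ?_
            rw [hB, mem_filter] at hv
            exact hv.2.le
        _ ≤ ∑ v, 2 * ((D.filter fun e => v ∈ e).card : ℝ) :=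
            sum_le_univ_sum_of_nonneg fun v => by positivity
        _ = 2 * (3 * D.card) := by
            rw [← mul_sum]
            congr 1
            have := sum_load (fun e => if e ∈ D then (1 : ℝ) else 0) (fun e he => if_neg fun h => by
              rw [hD, mem_filter] at h
              exact he (hH e h.1))
            simp only [load, ← sum_filter, filter_filter, sum_const, nsmul_eq_mul, mul_one,
              filter_mem_eq_inter, univ_inter] at this
            rw [← this]
            refine sum_congr rfl fun v _ => ?_
            congr 2
            ext e
            simp only [mem_filter, mem_univ, true_and]
            tauto
    rw [le_div_iff₀ (by positivity)]
    have h2 : (B.card : ℝ) * (κ * γ) * (n : ℝ) ^ 2 ≤ 3 * n * (n : ℝ) ^ 2 := by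
      have := mul_le_mul_of_nonneg_right h1 hκ.le
      linarith
    exact le_of_mul_le_mul_right h2 (by positivity)
  obtain ⟨z, hz⟩ : ∃ z : V → ℝ, z = fun v => if v ∈ B then max (y v) 1 else y v := ⟨_, rfl⟩
  have hyz : ∀ v, y v ≤ z v := fun v => by
    rw [hz]
    dsimp only
    split_ifs
    · exact le_max_left _ _
    · exact le_rfl
  have hpairs : ∀ (v : V) (c : ℝ), c ≤ 1 → (c + γ) * (n : ℝ) ^ 2
      ≤ 2 * ((H.filter fun e => v ∈ e).card : ℝ) →
      c * (n : ℝ) ^ 2 ≤ ((univ.filter fun p : V × V => 1 - z v ≤ z p.1 + z p.2).card : ℝ) := by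
    intro v c hc hv
    by_cases hvB : v ∈ B
    · have hzv : 1 ≤ z v := by
        rw [hz]
        simp only [if_pos hvB]
        exact le_max_right _ _
      rw [filter_true_of_mem fun p _ => by linarith [hyz p.1, hyz p.2, hy0 p.1, hy0 p.2],
        card_univ, Fintype.card_prod]
      push_cast
      rw [← hndef, ← sq]
      exact mul_le_of_le_one_left (by positivity) hc
    · have hDv : 2 * ((D.filter fun e => v ∈ e).card : ℝ) ≤ γ * (n : ℝ) ^ 2 := by
        rw [hB, mem_filter] at hvB
        push Not at hvB
        exact hvB (mem_univ v)
      have hsplit : ((H.filter fun e => v ∈ e).card : ℝ)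
          = (D.filter fun e => v ∈ e).card + ((H \ D).filter fun e => v ∈ e).card := by
        have hDH : D ⊆ H := by rw [hD]; exact filter_subset _ _
        have h1 : H.filter (fun e => v ∈ e)
            = D.filter (fun e => v ∈ e) ∪ (H \ D).filter (fun e => v ∈ e) := by
          rw [← filter_union, union_sdiff_of_subset hDH]
        rw [h1, card_union_of_disjoint (disjoint_filter_filter disjoint_sdiff)]
        push_cast
        rfl
      have hcount := sum_pairs_eq (fun e => if e ∈ H \ D then (1 : ℝ) else 0)
        (fun e he => if_neg fun h => he (hH e (mem_sdiff.1 h).1)) v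
      rw [← Fintype.sum_prod_type' (fun u u' => if ({v, u, u'} : Finset V) ∈ H \ D then (1 : ℝ) else 0),
        sum_boole, ← sum_filter, sum_const, nsmul_eq_mul, mul_one] at hcount
      have h2 : (univ.filter fun p : V × V => ({v, p.1, p.2} : Finset V) ∈ H \ D).card
          ≤ (univ.filter fun p : V × V => 1 - z v ≤ z p.1 + z p.2).card := by
        apply card_le_card
        intro p
        simp only [mem_filter, mem_univ, true_and, mem_sdiff]
        rintro ⟨h3, h4⟩
        rw [hD, mem_filter, not_and, not_lt] at h4
        have h5 := h4 h3
        have hc3 := hH _ h3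
        rw [card_eq_three] at hc3
        have h6 : ∑ u ∈ ({v, p.1, p.2} : Finset V), y u ≤ y v + (y p.1 + y p.2) := by
          calc _ ≤ y v + ∑ u ∈ ({p.1, p.2} : Finset V), y u := by
                by_cases h : v ∈ ({p.1, p.2} : Finset V)
                · rw [insert_eq_of_mem h]; linarith [hy0 v]
                · rw [sum_insert h]
            _ ≤ _ := by
                by_cases h : p.1 ∈ ({p.2} : Finset V)
                · rw [insert_eq_of_mem h, sum_singleton]; linarith [hy0 p.1]
                · rw [sum_insert h, sum_singleton]
        linarith [hyz v, hyz p.1, hyz p.2]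
      have h3 : ((univ.filter fun e : Finset V => v ∈ e).filter fun e => e ∈ H \ D)
          = (H \ D).filter fun e => v ∈ e := by
        ext e
        simp only [mem_filter, mem_univ, true_and]
        tauto
      rw [h3] at hcount
      have h4 : ((univ.filter fun p : V × V => ({v, p.1, p.2} : Finset V) ∈ H \ D).card : ℝ)
          ≤ (univ.filter fun p : V × V => 1 - z v ≤ z p.1 + z p.2).card := by exact_mod_cast h2
      linarith
  have hne : (univ : Finset V).Nonempty := by
    rw [← card_pos, card_univ]; exact hn
  obtain ⟨v₀, -, hv₀⟩ := exists_min_image univ z hne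
  obtain ⟨S, hS⟩ : ∃ S, S = univ.filter fun v =>
    2 * ((H.filter fun e => v ∈ e).card : ℝ) < (5 / 9 + γ) * (n : ℝ) ^ 2 := ⟨_, rfl⟩
  rw [← hS] at hbig
  have hSne : (univ \ S).Nonempty := by
    rw [← card_pos, card_sdiff_of_subset (subset_univ S), card_univ, ← hndef]
    omega
  obtain ⟨v₁, hv₁S, hv₁⟩ := exists_min_image _ z hSne
  have key := weight_ineq hn z (y₀ := z v₀) (b := z v₁) (fun v => hv₀ v (mem_univ v))
    (by
      have := hpairs v₀ (1 / 3) (by norm_num) (hdeg v₀)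
      have h2 : ((n ^ 2 : ℕ) : ℝ)
          ≤ ((3 * (univ.filter fun p : V × V => 1 - z v₀ ≤ z p.1 + z p.2).card : ℕ) : ℝ) := by
        push_cast
        linarith
      exact_mod_cast h2)
    (by
      refine le_trans (Nat.mul_le_mul_left 3 (card_le_card fun v hv => ?_)) hbig
      by_contra h
      have := hv₁ v (mem_sdiff.2 ⟨mem_univ v, h⟩)
      rw [mem_filter] at hv
      linarith [hv.2])
    (by
      have h1 : (5 / 9 + γ) * (n : ℝ) ^ 2 ≤ 2 * ((H.filter fun e => v₁ ∈ e).card : ℝ) := by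
        rw [hS, mem_sdiff, mem_filter] at hv₁S
        push Not at hv₁S
        exact hv₁S.2 (mem_univ _)
      have := hpairs v₁ (5 / 9) (by norm_num) h1
      have h2 : ((5 * n ^ 2 : ℕ) : ℝ)
          ≤ ((9 * (univ.filter fun p : V × V => 1 - z v₁ ≤ z p.1 + z p.2).card : ℕ) : ℝ) := by
        push_cast
        linarith
      exact_mod_cast h2)
  have hzsum : ∑ v, z v ≤ ∑ v, y v + B.card := by
    calc ∑ v, z v ≤ ∑ v, (y v + if v ∈ B then 1 else 0) := by
          refine sum_le_sum fun v _ => ?_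
          rw [hz]
          dsimp only
          split_ifs
          · exact max_le (by linarith) (by linarith [hy0 v])
          · simp
      _ = _ := by
          rw [sum_add_distrib, sum_boole, filter_mem_eq_inter, univ_inter]
  linarith

end

section
variable {ι K : Type*} [Fintype ι] [Fintype K] [DecidableEq K]

/-- Resampling one coordinate of a uniformly random function. -/
lemma sum_sum_update (h : (K → ι) → ℝ) (j : K) :
    ∑ x : K → ι, ∑ y, h (Function.update x j y) = Fintype.card ι * ∑ x, h x := by
  rw [← Fintype.sum_prod_type' (fun x y => h (Function.update x j y))]
  have hinv : Function.Involutive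
      (fun p : (K → ι) × ι => (Function.update p.1 j p.2, p.1 j)) := fun p => by simp
  rw [Fintype.sum_bijective _ hinv.bijective _ (fun p => h p.1) fun p => rfl,
    Fintype.sum_prod_type]
  simp [mul_sum]

lemma sum_eval (f : ι → ℝ) (i : K) :
    Fintype.card ι * ∑ x : K → ι, f (x i) = (Fintype.card ι : ℝ) ^ Fintype.card K * ∑ y, f y := by
  rw [← sum_sum_update _ i]
  simp

lemma sum_eval_three (F : ι → ι → ι → ℝ) {i j l : K} (hij : i ≠ j) (hil : i ≠ l) (hjl : j ≠ l) :
    (Fintype.card ι : ℝ) ^ 3 * ∑ x : K → ι, F (x i) (x j) (x l)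
      = (Fintype.card ι : ℝ) ^ Fintype.card K * ∑ y, ∑ y', ∑ y'', F y y' y'' := by
  have h1 : ∀ y y', (Fintype.card ι : ℝ) * ∑ x : K → ι, F y y' (x l)
      = (Fintype.card ι : ℝ) ^ Fintype.card K * ∑ y'', F y y' y'' := fun y y' => sum_eval _ l
  have h2 : ∀ y, (Fintype.card ι : ℝ) * ∑ x : K → ι, F y (x j) (x l)
      = ∑ y', ∑ x : K → ι, F y y' (x l) := fun y => by
    rw [← sum_sum_update _ j, sum_comm]
    simp [hjl.symm]
  have h3 : (Fintype.card ι : ℝ) * ∑ x : K → ι, F (x i) (x j) (x l)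
      = ∑ y, ∑ x : K → ι, F y (x j) (x l) := by
    rw [← sum_sum_update _ i, sum_comm]
    simp [hij.symm, hil.symm]
  rw [pow_succ, pow_two, mul_assoc, h3, mul_assoc, mul_sum, mul_sum, mul_sum]
  refine sum_congr rfl fun y _ => ?_
  rw [h2, mul_sum, mul_sum]
  exact sum_congr rfl fun y' _ => h1 y y'

/-- Disjoint pairs of coordinates are conditionally uncorrelated. -/
lemma sum_mul_eq_zero (D : ι → ι → ι → ℝ) (hD : ∀ y, ∑ y', ∑ y'', D y y' y'' = 0) {i j l j' l' : K}
    (h1 : j ≠ i) (h2 : j ≠ j') (h3 : j ≠ l') (h4 : l ≠ i) (h5 : l ≠ j') (h6 : l ≠ l') (h7 : j ≠ l) :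
    ∑ x : K → ι, D (x i) (x j) (x l) * D (x i) (x j') (x l') = 0 := by
  rcases isEmpty_or_nonempty ι with hι | hι
  · exact sum_eq_zero fun x _ => (hι.false (x i)).elim
  have hN : (Fintype.card ι : ℝ) ≠ 0 := by exact_mod_cast Fintype.card_ne_zero
  have := sum_sum_update (fun x : K → ι => ∑ y, D (Function.update x l y i) (Function.update x l y j)
    (Function.update x l y l) * D (Function.update x l y i) (Function.update x l y j')
      (Function.update x l y l')) j
  rw [sum_sum_update (fun x => D (x i) (x j) (x l) * D (x i) (x j') (x l')) l] at this
  have hz : ∑ x : K → ι, ∑ y, ∑ y', D (x i) y y' * D (x i) (x j') (x l') = 0 := by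
    refine sum_eq_zero fun x _ => ?_
    simp only [← sum_mul]
    rw [hD, zero_mul]
  simp only [Function.update_self, Function.update_of_ne h7, Function.update_of_ne h4.symm,
    Function.update_of_ne h5.symm, Function.update_of_ne h6.symm, Function.update_of_ne h1.symm,
    Function.update_of_ne h2.symm, Function.update_of_ne h3.symm] at this
  rw [hz] at this
  simpa [hN] using this.symm

/-- The second moment bound for sums over pairs of coordinates. -/
lemma sum_sq_le (D : ι → ι → ι → ℝ) (hD : ∀ y, ∑ y', ∑ y'', D y y' y'' = 0) {B : ℝ}
    (hB : ∀ y y' y'', |D y y' y''| ≤ B) (i : K) :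
    ∑ x : K → ι, (∑ j, ∑ l, D (x i) (x j) (x l)) ^ 2
      ≤ (Fintype.card ι : ℝ) ^ Fintype.card K * (7 * (Fintype.card K : ℝ) ^ 3 * B ^ 2) := by
  have hexp : ∑ x : K → ι, (∑ j, ∑ l, D (x i) (x j) (x l)) ^ 2
      = ∑ j, ∑ l, ∑ j', ∑ l', ∑ x : K → ι, D (x i) (x j) (x l) * D (x i) (x j') (x l') := by
    simp only [sq, sum_mul, mul_sum]
    rw [sum_comm]
    refine sum_congr rfl fun j _ => ?_
    rw [sum_comm]
    refine sum_congr rfl fun l _ => ?_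
    rw [sum_comm]
    refine sum_congr rfl fun j' _ => ?_
    rw [sum_comm]
    exact sum_congr rfl fun l' _ => sum_congr rfl fun x _ => mul_comm _ _
  rw [hexp]
  set C := (Fintype.card ι : ℝ) ^ Fintype.card K * B ^ 2 with hC
  have hC0 : 0 ≤ C := by positivity
  have hterm : ∀ j l j' l', ∑ x : K → ι, D (x i) (x j) (x l) * D (x i) (x j') (x l')
      ≤ (if j = i then C else 0) + (if j = j' then C else 0) + (if j = l' then C else 0)
        + (if l = i then C else 0) + (if l = j' then C else 0) + (if l = l' then C else 0)
        + (if j = l then C else 0) := by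
    intro j l j' l'
    have hle : ∑ x : K → ι, D (x i) (x j) (x l) * D (x i) (x j') (x l') ≤ C := by
      calc _ ≤ ∑ x : K → ι, B ^ 2 := by
            refine sum_le_sum fun x _ => ?_
            refine (le_abs_self _).trans ?_
            rw [abs_mul, sq]
            exact mul_le_mul (hB _ _ _) (hB _ _ _) (abs_nonneg _)
              ((abs_nonneg _).trans (hB (x i) (x i) (x i)))
        _ = C := by simp [hC]
    have hpos : ∀ p : Prop, [Decidable p] → (0 : ℝ) ≤ if p then C else 0 := fun p _ => by
      split_ifs <;> simp [hC0]
    have a1 := hpos (j = i)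
    have a2 := hpos (j = j')
    have a3 := hpos (j = l')
    have a4 := hpos (l = i)
    have a5 := hpos (l = j')
    have a6 := hpos (l = l')
    have a7 := hpos (j = l)
    by_cases h1 : j = i
    · rw [if_pos h1]; linarith
    by_cases h2 : j = j'
    · rw [if_pos h2]; linarith
    by_cases h3 : j = l'
    · rw [if_pos h3]; linarith
    by_cases h4 : l = i
    · rw [if_pos h4]; linarith
    by_cases h5 : l = j'
    · rw [if_pos h5]; linarith
    by_cases h6 : l = l'
    · rw [if_pos h6]; linarith
    by_cases h7 : j = l
    · rw [if_pos h7]; linarith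
    rw [sum_mul_eq_zero D hD h1 h2 h3 h4 h5 h6 h7]
    linarith
  calc _ ≤ ∑ j, ∑ l, ∑ j', ∑ l', _ := sum_le_sum fun j _ => sum_le_sum fun l _ =>
        sum_le_sum fun j' _ => sum_le_sum fun l' _ => hterm j l j' l'
    _ = _ := by
      simp only [sum_add_distrib, sum_ite_eq, sum_ite_eq', sum_const, card_univ, nsmul_eq_mul,
        mem_univ, if_true, mul_ite, mul_zero, hC]
      ring

end

section
variable {ι K : Type*} [DecidableEq ι]

/-- The weight of a triple of vertices lying in three different blocks `{y} × Fin 3`. -/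
def kern (w : Finset (ι × Fin 3) → ℝ) (s t z : ι × Fin 3) : ℝ :=
  if s.1 ≠ t.1 ∧ s.1 ≠ z.1 ∧ t.1 ≠ z.1 then w {s, t, z} else 0

/-- The vertex at the position `p` of the sample `x`. -/
def pt (x : K → ι) (p : K × Fin 3) : ι × Fin 3 := (x p.1, p.2)

variable {w : Finset (ι × Fin 3) → ℝ}

lemma kern_nonneg (hw : ∀ e, 0 ≤ w e) (s t z : ι × Fin 3) : 0 ≤ kern w s t z := by
  unfold kern
  split_ifs
  exacts [hw _, le_rfl]

lemma kern_le (hw : ∀ e, 0 ≤ w e) (s t z : ι × Fin 3) : kern w s t z ≤ w {s, t, z} := by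
  unfold kern
  split_ifs
  exacts [le_rfl, hw _]

variable [Fintype ι] [Fintype K]

/-- The scaled weights on ordered triples of positions of the sample `x`. -/
def sampled (w : Finset (ι × Fin 3) → ℝ) (x : K → ι) (p q r : K × Fin 3) : ℝ :=
  (Fintype.card ι : ℝ) ^ 2 / (6 * (Fintype.card K : ℝ) ^ 2) * kern w (pt x p) (pt x q) (pt x r)

/-- The load of a position of the sample `x`. -/
def posLoad (w : Finset (ι × Fin 3) → ℝ) (x : K → ι) (p : K × Fin 3) : ℝ :=
  3 * ∑ q, ∑ r, sampled w x p q r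

/-- Summing over the second and third vertex of a triple inside given blocks. -/
def blockSum (w : Finset (ι × Fin 3) → ℝ) (a : Fin 3) (y y' y'' : ι) : ℝ :=
  ∑ b, ∑ c, kern w (y, a) (y', b) (y'', c)

omit [Fintype ι] in
lemma blockSum_nonneg (hw : ∀ e, 0 ≤ w e) (a : Fin 3) (y y' y'' : ι) :
    0 ≤ blockSum w a y y' y'' :=
  sum_nonneg fun _ _ => sum_nonneg fun _ _ => kern_nonneg hw _ _ _

omit [Fintype ι] in
lemma blockSum_le (hw : ∀ e, 0 ≤ w e) {β : ℝ} (hβ : ∀ e, w e ≤ β) (a : Fin 3) (y y' y'' : ι) :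
    blockSum w a y y' y'' ≤ 9 * β := by
  calc _ ≤ ∑ b : Fin 3, ∑ c : Fin 3, β :=
        sum_le_sum fun _ _ => sum_le_sum fun _ _ => (kern_le hw _ _ _).trans (hβ _)
    _ = _ := by simp; ring

omit [Fintype ι] in
lemma sum_sum_blockSum (f : K → ι) (a : Fin 3) (y : ι) :
    ∑ j, ∑ l, blockSum w a y (f j) (f l)
      = ∑ q : K × Fin 3, ∑ r : K × Fin 3, kern w (y, a) (f q.1, q.2) (f r.1, r.2) := by
  simp only [Fintype.sum_prod_type, blockSum]
  refine sum_congr rfl fun j _ => ?_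
  rw [sum_comm]

lemma posLoad_eq (x : K → ι) (i : K) (a : Fin 3) :
    posLoad w x (i, a) = 3 * ((Fintype.card ι : ℝ) ^ 2 / (6 * (Fintype.card K : ℝ) ^ 2)) *
      ∑ j, ∑ l, blockSum w a (x i) (x j) (x l) := by
  rw [posLoad, sum_sum_blockSum, mul_assoc]
  simp only [sampled, mul_sum]
  rfl

lemma sum_blockSum_le_load (hw : ∀ e, 0 ≤ w e) (hw3 : ∀ e, e.card ≠ 3 → w e = 0) (a : Fin 3)
    (y : ι) : ∑ y', ∑ y'', blockSum w a y y' y'' ≤ 2 * load w (y, a) := by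
  have := sum_sum_blockSum (w := w) (fun y : ι => y) a y
  rw [this, load, ← sum_pairs_eq w hw3]
  exact sum_le_sum fun _ _ => sum_le_sum fun _ _ => kern_le hw _ _ _

lemma pos_part_le {l m L η : ℝ} (hm : m ≤ L) (hη : 0 < η) :
    max (l - 1) 0 ≤ max (L - 1) 0 + (η / 2 + (l - m) ^ 2 / (2 * η)) := by
  have h1 : l - m ≤ η / 2 + (l - m) ^ 2 / (2 * η) := by
    have : η / 2 + (l - m) ^ 2 / (2 * η) - (l - m) = (η - (l - m)) ^ 2 / (2 * η) := by
      field_simp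
      ring
    have h2 : 0 ≤ (η - (l - m)) ^ 2 / (2 * η) := by positivity
    linarith
  have h3 : 0 ≤ η / 2 + (l - m) ^ 2 / (2 * η) := by positivity
  have h4 := le_max_left (L - 1) 0
  have h5 := le_max_right (L - 1) 0
  exact max_le (by linarith) (by linarith)

variable [DecidableEq K]

/-- The expected excess load of a position. -/
lemma sum_excess_le (hw : ∀ e, 0 ≤ w e) (hw3 : ∀ e, e.card ≠ 3 → w e = 0) {κ η : ℝ} (hη : 0 < η)
    (hκ : ∀ e, w e ≤ κ / (Fintype.card ι : ℝ) ^ 2) (hN : 0 < Fintype.card ι) (i : K) (a : Fin 3) :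
    ∑ x : K → ι, max (posLoad w x (i, a) - 1) 0 ≤ (Fintype.card ι : ℝ) ^ Fintype.card K *
      ((∑ y, max (load w (y, a) - 1) 0) / Fintype.card ι
        + (η / 2 + 71 * κ ^ 2 / (Fintype.card K * η))) := by
  set N := Fintype.card ι with hNdef
  set k := Fintype.card K with hkdef
  have hk : 0 < k := Fintype.card_pos_iff.2 ⟨i⟩
  have hNR : (0 : ℝ) < N := by exact_mod_cast hN
  have hkR : (0 : ℝ) < k := by exact_mod_cast hk
  obtain ⟨σ, hσ⟩ : ∃ σ : ℝ, σ = (N : ℝ) ^ 2 / (6 * (k : ℝ) ^ 2) := ⟨_, rfl⟩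
  have hσ0 : 0 < σ := by rw [hσ]; positivity
  obtain ⟨μ, hμ⟩ : ∃ μ : ι → ℝ, μ = fun y => (∑ y', ∑ y'', blockSum w a y y' y'') / (N : ℝ) ^ 2 :=
    ⟨_, rfl⟩
  obtain ⟨D, hD⟩ : ∃ D : ι → ι → ι → ℝ, D = fun y y' y'' => blockSum w a y y' y'' - μ y := ⟨_, rfl⟩
  have hD0 : ∀ y, ∑ y', ∑ y'', D y y' y'' = 0 := fun y => by
    simp only [hD, sum_sub_distrib, sum_const, card_univ, nsmul_eq_mul, ← hNdef, hμ]
    field_simp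
    ring
  have hμ0 : ∀ y, 0 ≤ μ y := fun y => by
    rw [hμ]
    exact div_nonneg (sum_nonneg fun _ _ => sum_nonneg fun _ _ => blockSum_nonneg hw _ _ _ _)
      (by positivity)
  have hμ1 : ∀ y, μ y ≤ 9 * (κ / (N : ℝ) ^ 2) := fun y => by
    rw [hμ]
    simp only
    rw [div_le_iff₀ (by positivity)]
    calc _ ≤ ∑ y' : ι, ∑ y'' : ι, 9 * (κ / (N : ℝ) ^ 2) :=
          sum_le_sum fun _ _ => sum_le_sum fun _ _ => blockSum_le hw hκ _ _ _ _
      _ = _ := by simp only [sum_const, card_univ, nsmul_eq_mul, ← hNdef]; ring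
  have hDB : ∀ y y' y'', |D y y' y''| ≤ 9 * (κ / (N : ℝ) ^ 2) := fun y y' y'' => by
    rw [hD, abs_le]
    have h1 := blockSum_nonneg hw a y y' y''
    have h2 := blockSum_le hw hκ a y y' y''
    have h3 := hμ0 y
    have h4 := hμ1 y
    constructor <;> simp only <;> linarith
  have hm : ∀ y, 3 * σ * ((k : ℝ) ^ 2 * μ y) ≤ load w (y, a) := fun y => by
    have h1 := sum_blockSum_le_load hw hw3 a y
    have h2 : 3 * σ * ((k : ℝ) ^ 2 * μ y) = (∑ y', ∑ y'', blockSum w a y y' y'') / 2 := by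
      rw [hσ, hμ]
      field_simp
      ring
    linarith
  have hdiff : ∀ x : K → ι, posLoad w x (i, a) - 3 * σ * ((k : ℝ) ^ 2 * μ (x i))
      = 3 * σ * ∑ j, ∑ l, D (x i) (x j) (x l) := fun x => by
    rw [posLoad_eq, ← hNdef, ← hkdef, ← hσ]
    simp only [hD, sum_sub_distrib, sum_const, card_univ, nsmul_eq_mul, ← hkdef]
    ring
  have hsq := sum_sq_le D hD0 hDB i
  rw [← hNdef, ← hkdef] at hsq
  have heval := sum_eval (fun y => max (load w (y, a) - 1) 0) i
  rw [← hNdef, ← hkdef] at heval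
  calc _ ≤ ∑ x : K → ι, (max (load w (x i, a) - 1) 0 +
        (η / 2 + (3 * σ * ∑ j, ∑ l, D (x i) (x j) (x l)) ^ 2 / (2 * η))) := by
        refine sum_le_sum fun x _ => ?_
        rw [← hdiff]
        exact pos_part_le (hm (x i)) hη
    _ = ∑ x : K → ι, max (load w (x i, a) - 1) 0 + (N : ℝ) ^ k * (η / 2) +
        9 * σ ^ 2 / (2 * η) * ∑ x : K → ι, (∑ j, ∑ l, D (x i) (x j) (x l)) ^ 2 := by
        rw [sum_add_distrib, sum_add_distrib, sum_const, card_univ, Fintype.card_fun, nsmul_eq_mul,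
          ← hNdef, ← hkdef, mul_sum, ← add_assoc, Nat.cast_pow]
        congr 1
        refine sum_congr rfl fun x _ => ?_
        ring
    _ ≤ ∑ x : K → ι, max (load w (x i, a) - 1) 0 + (N : ℝ) ^ k * (η / 2) +
        9 * σ ^ 2 / (2 * η) * ((N : ℝ) ^ k * (7 * (k : ℝ) ^ 3 * (9 * (κ / (N : ℝ) ^ 2)) ^ 2)) := by
        gcongr
    _ ≤ _ := by
        have h1 : ∑ x : K → ι, max (load w (x i, a) - 1) 0
            = (N : ℝ) ^ k * ((∑ y, max (load w (y, a) - 1) 0) / N) := by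
          rw [← mul_div_assoc, ← heval]
          field_simp
        have h2 : 9 * σ ^ 2 / (2 * η) * ((N : ℝ) ^ k * (7 * (k : ℝ) ^ 3 * (9 * (κ / (N : ℝ) ^ 2)) ^ 2))
            = (N : ℝ) ^ k * (567 / 8 * κ ^ 2 / (k * η)) := by
          rw [hσ]
          field_simp
          ring
        have h3 : 567 / 8 * κ ^ 2 / (k * η) ≤ 71 * κ ^ 2 / (k * η) := by
          gcongr
          norm_num
        rw [h1, h2, ← mul_add, ← mul_add, add_assoc]
        gcongr

omit [Fintype ι] [DecidableEq ι] [Fintype K] [DecidableEq K] in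
lemma sum_sum_sum_comm {α β δ : Type*} [Fintype α] [Fintype β] [Fintype δ] (f : α → β → δ → ℝ) :
    ∑ i, ∑ j, ∑ l, f i j l = ∑ l, ∑ i, ∑ j, f i j l := by
  rw [sum_congr rfl fun i _ => sum_comm, sum_comm]

lemma sum_kern_ge (hw : ∀ e, 0 ≤ w e) (hw3 : ∀ e, e.card ≠ 3 → w e = 0) {κ : ℝ}
    (hκ : ∀ e, w e ≤ κ / (Fintype.card ι : ℝ) ^ 2) (hN : 0 < Fintype.card ι) :
    6 * ∑ e, w e - 81 * κ ≤ ∑ s, ∑ t, ∑ z, kern w s t z := by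
  set N := Fintype.card ι with hNdef
  have hNR : (0 : ℝ) < N := by exact_mod_cast hN
  set β := κ / (N : ℝ) ^ 2 with hβ
  have hβ0 : 0 ≤ β := (hw ∅).trans (hκ ∅)
  have h6 : 6 * ∑ e, w e = ∑ s, ∑ t, ∑ z, w {s, t, z} := by
    rw [sum_congr rfl fun s _ => sum_pairs_eq w hw3 s, ← mul_sum]
    have := sum_load w hw3
    unfold load at this
    rw [this]
    ring
  have hblk : ∀ y : ι, ∑ t : ι × Fin 3, (if y = t.1 then β else 0) = 3 * β := fun y => by
    rw [Fintype.sum_prod_type]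
    simp only [Fin.sum_univ_three, sum_add_distrib, sum_ite_eq, mem_univ, if_true]
    ring
  have hlost : ∑ s : ι × Fin 3, ∑ t : ι × Fin 3, ∑ z : ι × Fin 3, ((if s.1 = t.1 then β else 0)
      + (if s.1 = z.1 then β else 0) + (if t.1 = z.1 then β else 0)) = 81 * κ := by
    simp only [sum_add_distrib, hblk, sum_const, card_univ, nsmul_eq_mul, Fintype.card_prod,
      Fintype.card_fin, ← mul_sum, ← hNdef]
    rw [hβ]
    push_cast
    field_simp
    ring
  rw [h6, ← hlost, sub_le_iff_le_add]
  simp only [← sum_add_distrib]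
  refine sum_le_sum fun s _ => sum_le_sum fun t _ => sum_le_sum fun z _ => ?_
  have h := hκ {s, t, z}
  have h0 := hw {s, t, z}
  unfold kern
  by_cases h1 : s.1 = t.1
  · rw [if_neg (fun h => h.1 h1), if_pos h1]
    split_ifs <;> linarith
  by_cases h2 : s.1 = z.1
  · rw [if_neg (fun h => h.2.1 h2), if_pos h2]
    split_ifs <;> linarith
  by_cases h3 : t.1 = z.1
  · rw [if_neg (fun h => h.2.2 h3), if_pos h3]
    split_ifs
    linarith
  rw [if_pos ⟨h1, h2, h3⟩]
  split_ifs
  linarith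

/-- The expected total weight of a sample. -/
lemma sum_sampled_ge (hw : ∀ e, 0 ≤ w e) (hw3 : ∀ e, e.card ≠ 3 → w e = 0) {κ : ℝ}
    (hκ : ∀ e, w e ≤ κ / (Fintype.card ι : ℝ) ^ 2) (hN : 0 < Fintype.card ι)
    (hk : 3 ≤ Fintype.card K) :
    (Fintype.card ι : ℝ) ^ Fintype.card K * ((Fintype.card K - 3) *
      (∑ e, w e - 27 / 2 * κ) / Fintype.card ι)
      ≤ ∑ x : K → ι, ∑ p, ∑ q, ∑ r, sampled w x p q r := by
  have hT := sum_kern_ge hw hw3 hκ hN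
  have hT0 : 0 ≤ ∑ s, ∑ t, ∑ z, kern w s t z :=
    sum_nonneg fun _ _ => sum_nonneg fun _ _ => sum_nonneg fun _ _ => kern_nonneg hw _ _ _
  have hev : ∀ (i j l : K), i ≠ j → i ≠ l → j ≠ l → _ :=
    fun i j l => sum_eval_three (K := K) (fun y y' y'' => ∑ a, blockSum w a y y' y'')
      (i := i) (j := j) (l := l)
  have hTb : ∑ y, ∑ y', ∑ y'', ∑ a, blockSum w a y y' y'' = ∑ s, ∑ t, ∑ z, kern w s t z := by
    rw [Fintype.sum_prod_type]
    refine sum_congr rfl fun y _ => ?_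
    rw [sum_sum_sum_comm]
    exact sum_congr rfl fun a _ => sum_sum_blockSum (w := w) (fun y : ι => y) a y
  rw [hTb] at hev
  set T := ∑ s, ∑ t, ∑ z, kern w s t z with hTdef
  set N := Fintype.card ι with hNdef
  set k := Fintype.card K with hkdef
  have hNR : (0 : ℝ) < N := by exact_mod_cast hN
  have hkR : (3 : ℝ) ≤ k := by exact_mod_cast hk
  have htot : ∀ x : K → ι, ∑ p, ∑ q, ∑ r, sampled w x p q r
      = (N : ℝ) ^ 2 / (6 * (k : ℝ) ^ 2) * ∑ i, ∑ j, ∑ l, ∑ a, blockSum w a (x i) (x j) (x l) := by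
    intro x
    have : ∑ i, ∑ j, ∑ l, ∑ a, blockSum w a (x i) (x j) (x l)
        = ∑ p : K × Fin 3, ∑ q, ∑ r, kern w (pt x p) (pt x q) (pt x r) := by
      rw [Fintype.sum_prod_type]
      refine sum_congr rfl fun i _ => ?_
      rw [sum_sum_sum_comm]
      exact sum_congr rfl fun a _ => sum_sum_blockSum (w := w) x a (x i)
    rw [this]
    simp only [sampled, mul_sum]
    rfl
  have hF0 : ∀ y y' y'', 0 ≤ ∑ a, blockSum w a y y' y'' := fun y y' y'' =>
    sum_nonneg fun a _ => blockSum_nonneg hw _ _ _ _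
  have hterm : ∀ i j l : K, (N : ℝ) ^ k * T * (1 - (if i = j then 1 else 0) - (if i = l then 1 else 0)
      - (if j = l then 1 else 0)) ≤ (N : ℝ) ^ 3 * ∑ x : K → ι, ∑ a, blockSum w a (x i) (x j) (x l) := by
    intro i j l
    have hP : 0 ≤ (N : ℝ) ^ k * T := by positivity
    have hS : 0 ≤ (N : ℝ) ^ 3 * ∑ x : K → ι, ∑ a, blockSum w a (x i) (x j) (x l) :=
      mul_nonneg (by positivity) (sum_nonneg fun x _ => hF0 _ _ _)
    by_cases h1 : i = j
    · rw [if_pos h1]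
      refine le_trans (mul_nonpos_of_nonneg_of_nonpos hP ?_) hS
      split_ifs <;> norm_num
    by_cases h2 : i = l
    · rw [if_neg h1, if_pos h2]
      refine le_trans (mul_nonpos_of_nonneg_of_nonpos hP ?_) hS
      split_ifs <;> norm_num
    by_cases h3 : j = l
    · rw [if_neg h1, if_neg h2, if_pos h3]
      refine le_trans (mul_nonpos_of_nonneg_of_nonpos hP ?_) hS
      norm_num
    rw [if_neg h1, if_neg h2, if_neg h3, hev i j l h1 h2 h3]
    simp
  have hsum : (N : ℝ) ^ k * T * ((k : ℝ) ^ 3 - 3 * (k : ℝ) ^ 2) ≤ (N : ℝ) ^ 3 *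
      ∑ i, ∑ j, ∑ l, ∑ x : K → ι, ∑ a, blockSum w a (x i) (x j) (x l) := by
    simp only [mul_sum] at hterm ⊢
    refine le_trans (le_of_eq ?_) (sum_le_sum fun i _ => sum_le_sum fun j _ => sum_le_sum
      fun l _ => hterm i j l)
    simp only [← mul_sum, sum_sub_distrib, sum_ite_eq, sum_const, card_univ, nsmul_eq_mul, ← hkdef,
      mem_univ, if_true]
    ring
  have hswap : ∑ x : K → ι, ∑ i, ∑ j, ∑ l, ∑ a, blockSum w a (x i) (x j) (x l)
      = ∑ i, ∑ j, ∑ l, ∑ x : K → ι, ∑ a, blockSum w a (x i) (x j) (x l) := by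
    rw [sum_comm]
    refine sum_congr rfl fun i _ => ?_
    rw [sum_comm]
    refine sum_congr rfl fun j _ => ?_
    rw [sum_comm]
  simp only [htot]
  rw [← mul_sum, hswap]
  set S := ∑ i, ∑ j, ∑ l, ∑ x : K → ι, ∑ a, blockSum w a (x i) (x j) (x l)
  have h1 : (N : ℝ) ^ k * (6 * ∑ e, w e - 81 * κ) * ((k : ℝ) ^ 3 - 3 * (k : ℝ) ^ 2)
      ≤ (N : ℝ) ^ k * T * ((k : ℝ) ^ 3 - 3 * (k : ℝ) ^ 2) := by
    have : (0 : ℝ) ≤ (k : ℝ) ^ 3 - 3 * (k : ℝ) ^ 2 := by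
      have : (k : ℝ) ^ 3 - 3 * (k : ℝ) ^ 2 = (k : ℝ) ^ 2 * (k - 3) := by ring
      rw [this]
      exact mul_nonneg (by positivity) (by linarith)
    gcongr
  have h2 := h1.trans hsum
  have h3 : (N : ℝ) ^ k * ((k - 3) * (∑ e, w e - 27 / 2 * κ) / N)
      = (N : ℝ) ^ k * (6 * ∑ e, w e - 81 * κ) * ((k : ℝ) ^ 3 - 3 * (k : ℝ) ^ 2)
          / (6 * (k : ℝ) ^ 2 * N) := by
    field_simp
    ring
  rw [h3, div_le_iff₀ (by positivity)]
  refine h2.trans (le_of_eq ?_)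
  field_simp

end

section
variable {ι K : Type*} [Fintype ι] [DecidableEq ι] [Fintype K] [DecidableEq K]

lemma card_not_injective_mul_le :
    ((univ.filter fun x : K → ι => ¬ Function.Injective x).card : ℝ) * Fintype.card ι
      ≤ (Fintype.card K : ℝ) ^ 2 * (Fintype.card ι : ℝ) ^ Fintype.card K := by
  have hpair : ∀ i j : K, i ≠ j → (Fintype.card ι : ℝ) * ∑ x : K → ι, (if x i = x j then 1 else 0)
      = (Fintype.card ι : ℝ) ^ Fintype.card K := fun i j hij => by
    rw [← sum_sum_update _ i]
    simp [hij.symm]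
  have hle : ((univ.filter fun x : K → ι => ¬ Function.Injective x).card : ℝ)
      ≤ ∑ i, ∑ j, if i ≠ j then ∑ x : K → ι, (if x i = x j then (1 : ℝ) else 0) else 0 := by
    rw [card_filter, Nat.cast_sum]
    have hsw : ∑ i, ∑ j, (if i ≠ j then ∑ x : K → ι, (if x i = x j then (1 : ℝ) else 0) else 0)
        = ∑ x : K → ι, ∑ i, ∑ j, if i ≠ j ∧ x i = x j then (1 : ℝ) else 0 := by
      rw [← sum_sum_sum_comm]
      refine sum_congr rfl fun i _ => sum_congr rfl fun j _ => ?_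
      split_ifs with h <;> simp [h]
    rw [hsw]
    refine sum_le_sum fun x _ => ?_
    have hnn : ∀ i j, 0 ≤ if i ≠ j ∧ x i = x j then (1 : ℝ) else 0 := fun i j => by
      split_ifs <;> norm_num
    by_cases h : Function.Injective x
    · rw [if_neg (not_not.2 h), Nat.cast_zero]
      exact sum_nonneg fun i _ => sum_nonneg fun j _ => hnn i j
    · rw [if_pos h, Nat.cast_one]
      unfold Function.Injective at h
      push Not at h
      obtain ⟨i, j, h1, h2⟩ := h
      have e1 := single_le_sum (fun j _ => hnn i j) (mem_univ j)
      have e2 := single_le_sum (f := fun i => ∑ j, if i ≠ j ∧ x i = x j then (1 : ℝ) else 0)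
        (fun i _ => sum_nonneg fun j _ => hnn i j) (mem_univ i)
      rw [if_pos ⟨h2, h1⟩] at e1
      exact e1.trans e2
  calc _ ≤ (∑ i, ∑ j, if i ≠ j then ∑ x : K → ι, (if x i = x j then (1 : ℝ) else 0) else 0)
        * Fintype.card ι := by gcongr
    _ ≤ ∑ i : K, ∑ j : K, (Fintype.card ι : ℝ) ^ Fintype.card K := by
      simp only [sum_mul]
      refine sum_le_sum fun i _ => sum_le_sum fun j _ => ?_
      split_ifs with h
      · rw [mul_comm, hpair i j h]
      · rw [zero_mul]; positivity
    _ = _ := by simp only [sum_const, card_univ, nsmul_eq_mul]; ring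

/-- The surplus of the truncated weight of a sample over the number of its blocks in `R`. -/
def surplus (w : Finset (ι × Fin 3) → ℝ) (R : Finset ι) (x : K → ι) : ℝ :=
  ∑ p, ∑ q, ∑ r, sampled w x p q r - ∑ p, max (posLoad w x p - 1) 0
    - ((univ.filter fun i => x i ∈ R).card : ℝ)

omit [DecidableEq K] in
lemma surplus_le (w : Finset (ι × Fin 3) → ℝ) (R : Finset ι) (x : K → ι) :
    surplus w R x ≤ Fintype.card K := by
  have h1 : ∑ p, ∑ q, ∑ r, sampled w x p q r - ∑ p, max (posLoad w x p - 1) 0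
      ≤ ∑ p : K × Fin 3, (1 / 3 : ℝ) := by
    rw [← sum_sub_distrib]
    refine sum_le_sum fun p _ => ?_
    have h2 : posLoad w x p = 3 * ∑ q, ∑ r, sampled w x p q r := rfl
    have h3 := le_max_left (posLoad w x p - 1) 0
    have h4 := le_max_right (posLoad w x p - 1) 0
    linarith
  have h2 : ∑ p : K × Fin 3, (1 / 3 : ℝ) = Fintype.card K := by
    simp
  have h3 : (0 : ℝ) ≤ ((univ.filter fun i => x i ∈ R).card : ℝ) := by positivity
  unfold surplus
  linarith

lemma sum_weights_le {w : Finset (ι × Fin 3) → ℝ} (hw3 : ∀ e, e.card ≠ 3 → w e = 0) {κ : ℝ}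
    (hκ : ∀ e, w e ≤ κ / (Fintype.card ι : ℝ) ^ 2) (hN : 0 < Fintype.card ι) :
    ∑ e, w e ≤ 9 / 2 * κ * Fintype.card ι := by
  have hNR : (0 : ℝ) < Fintype.card ι := by exact_mod_cast hN
  have h6 : 6 * ∑ e, w e = ∑ s, ∑ t, ∑ z, w {s, t, z} := by
    rw [sum_congr rfl fun s _ => sum_pairs_eq w hw3 s, ← mul_sum]
    have := sum_load w hw3
    unfold load at this
    rw [this]
    ring
  have h7 : ∑ s, ∑ t, ∑ z, w {s, t, z} ≤ ∑ s : ι × Fin 3, ∑ t : ι × Fin 3, ∑ z : ι × Fin 3,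
      κ / (Fintype.card ι : ℝ) ^ 2 :=
    sum_le_sum fun s _ => sum_le_sum fun t _ => sum_le_sum fun z _ => hκ _
  have h8 : ∑ s : ι × Fin 3, ∑ t : ι × Fin 3, ∑ z : ι × Fin 3, κ / (Fintype.card ι : ℝ) ^ 2
      = 27 * κ * Fintype.card ι := by
    simp only [sum_const, card_univ, nsmul_eq_mul, Fintype.card_prod, Fintype.card_fin]
    push_cast
    field_simp
    ring
  linarith

lemma sum_surplus_ge {w : Finset (ι × Fin 3) → ℝ} (hw : ∀ e, 0 ≤ w e)
    (hw3 : ∀ e, e.card ≠ 3 → w e = 0) {κ ε : ℝ} (hε : 0 < ε)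
    (hκ : ∀ e, w e ≤ κ / (Fintype.card ι : ℝ) ^ 2) (R : Finset ι)
    (hk : 3 ≤ Fintype.card K) (hkN : Fintype.card K ≤ Fintype.card ι)
    (hkε : 29 * κ + 1278 * κ ^ 2 / ε ≤ Fintype.card K * ε / 4)
    (hR : R.card + ∑ v, max (load w v - 1) 0 + ε * Fintype.card ι ≤ ∑ e, w e) :
    (Fintype.card ι : ℝ) ^ Fintype.card K * (Fintype.card K * ε / 2)
      ≤ ∑ x : K → ι, surplus w R x := by
  have hN : 0 < Fintype.card ι := by omega
  have h1 := sum_sampled_ge (K := K) hw hw3 hκ hN hk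
  have h2 : ∀ p : K × Fin 3, _ := fun p =>
    sum_excess_le hw hw3 (show 0 < ε / 6 by linarith) hκ hN p.1 p.2
  have h3 : ∀ i : K, _ := fun i => sum_eval (fun y => if y ∈ R then (1 : ℝ) else 0) i
  have hW := sum_weights_le hw3 hκ hN
  have hX : ∑ v, max (load w v - 1) 0 = ∑ a : Fin 3, ∑ y, max (load w (y, a) - 1) 0 := by
    rw [Fintype.sum_prod_type, sum_comm]
  have hκ0 : 0 ≤ κ / (Fintype.card ι : ℝ) ^ 2 := (hw ∅).trans (hκ ∅)
  set N := Fintype.card ι with hNdef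
  set k := Fintype.card K with hkdef
  have hNR : (0 : ℝ) < N := by exact_mod_cast hN
  have hkR : (3 : ℝ) ≤ k := by exact_mod_cast hk
  have hkNR : (k : ℝ) ≤ N := by exact_mod_cast hkN
  have hk0 : (0 : ℝ) < k := by linarith
  have hκ0 : 0 ≤ κ := by
    rw [div_nonneg_iff] at hκ0
    rcases hκ0 with h | h
    · exact h.1
    · nlinarith [h.2]
  set W := ∑ e, w e with hWdef
  set X := ∑ v, max (load w v - 1) 0 with hXdef
  have hexc : ∑ x : K → ι, ∑ p, max (posLoad w x p - 1) 0
      ≤ (N : ℝ) ^ k * (k * (X / N + (ε / 4 + 1278 * κ ^ 2 / (k * ε)))) := by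
    rw [sum_comm]
    refine (sum_le_sum fun p _ => h2 p).trans (le_of_eq ?_)
    have hsnd : ∀ g : Fin 3 → ℝ, ∑ p : K × Fin 3, g p.2 = k * ∑ a, g a := fun g => by
      rw [Fintype.sum_prod_type]
      simp [hkdef]
    rw [hsnd fun a => (N : ℝ) ^ k * ((∑ y, max (load w (y, a) - 1) 0) / N +
      (ε / 6 / 2 + 71 * κ ^ 2 / (k * (ε / 6)))), ← mul_sum, sum_add_distrib, ← sum_div,
    ← hX, sum_const, card_univ, Fintype.card_fin, nsmul_eq_mul]
    field_simp
    ring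
  have hreal : ∑ x : K → ι, ((univ.filter fun i => x i ∈ R).card : ℝ)
      = (N : ℝ) ^ k * (k * (R.card / N)) := by
    have : ∀ x : K → ι, ((univ.filter fun i => x i ∈ R).card : ℝ)
        = ∑ i, if x i ∈ R then (1 : ℝ) else 0 := fun x => by simp
    simp only [this]
    rw [sum_comm]
    have h4 : ∀ i : K, ∑ x : K → ι, (if x i ∈ R then (1 : ℝ) else 0) = (N : ℝ) ^ k * (R.card / N) := by
      intro i
      have := h3 i
      rw [show ∑ y, (if y ∈ R then (1 : ℝ) else 0) = R.card by simp] at this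
      rw [← mul_div_assoc, ← this]
      field_simp
    simp only [h4, sum_const, card_univ, ← hkdef, nsmul_eq_mul]
    ring
  unfold surplus
  rw [sum_sub_distrib, sum_sub_distrib, hreal]
  have hmain : k * ε / 2 ≤ (k - 3) * (W - 27 / 2 * κ) / N
      - k * (X / N + (ε / 4 + 1278 * κ ^ 2 / (k * ε))) - k * (R.card / N) := by
    have e1 : k * (1278 * κ ^ 2 / (k * ε)) = 1278 * κ ^ 2 / ε := by field_simp
    have e2 : (k - 3) * (W - 27 / 2 * κ) / N = k * (W / N) - 3 * (W / N)
        - (k - 3) / N * (27 / 2 * κ) := by ring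
    have e3 : W / N ≤ 9 / 2 * κ := by rwa [div_le_iff₀ hNR]
    have e4 : (k - 3) / N * (27 / 2 * κ) ≤ 1 * (27 / 2 * κ) := by
      gcongr
      rw [div_le_one hNR]
      linarith
    have e5 : R.card / N + X / N + ε ≤ W / N := by
      rw [← add_div, div_add' _ _ _ hNR.ne']
      gcongr
    have e6 : k * (R.card / N + X / N + ε) ≤ k * (W / N) := mul_le_mul_of_nonneg_left e5 hk0.le
    rw [e2]
    have e7 : k * (X / N + (ε / 4 + 1278 * κ ^ 2 / (k * ε)))
      = k * (X / N) + k * (ε / 4) + 1278 * κ ^ 2 / ε := by rw [mul_add, mul_add, e1]; ring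
    rw [e7]
    linarith
  have hfin := mul_le_mul_of_nonneg_left hmain (show (0 : ℝ) ≤ (N : ℝ) ^ k by positivity)
  linarith

/-- A positive proportion of all samples is injective and has large surplus. -/
lemma card_good_samples {w : Finset (ι × Fin 3) → ℝ} (hw : ∀ e, 0 ≤ w e)
    (hw3 : ∀ e, e.card ≠ 3 → w e = 0) {κ ε : ℝ} (hε : 0 < ε)
    (hκ : ∀ e, w e ≤ κ / (Fintype.card ι : ℝ) ^ 2) (R : Finset ι)
    (hk : 3 ≤ Fintype.card K) (hkN : Fintype.card K ≤ Fintype.card ι)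
    (hkε : 29 * κ + 1278 * κ ^ 2 / ε ≤ Fintype.card K * ε / 4)
    (hkN' : 8 * (Fintype.card K : ℝ) ^ 2 ≤ ε * Fintype.card ι)
    (hR : R.card + ∑ v, max (load w v - 1) 0 + ε * Fintype.card ι ≤ ∑ e, w e) :
    ε / 8 * (Fintype.card ι : ℝ) ^ Fintype.card K ≤ ((univ.filter fun x : K → ι =>
      Function.Injective x ∧ Fintype.card K * ε / 4 ≤ surplus w R x).card : ℝ) := by
  have h1 := sum_surplus_ge (K := K) hw hw3 hε hκ R hk hkN hkε hR
  have h2 := card_not_injective_mul_le (ι := ι) (K := K)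
  have hN : 0 < Fintype.card ι := by omega
  set N := Fintype.card ι with hNdef
  set k := Fintype.card K with hkdef
  have hNR : (0 : ℝ) < N := by exact_mod_cast hN
  have hkR : (3 : ℝ) ≤ k := by exact_mod_cast hk
  have hni : ((univ.filter fun x : K → ι => ¬ Function.Injective x).card : ℝ)
      ≤ ε / 8 * (N : ℝ) ^ k := by
    refine le_of_mul_le_mul_right (h2.trans ?_) hNR
    have := mul_le_mul_of_nonneg_right hkN' (show (0 : ℝ) ≤ (N : ℝ) ^ k by positivity)
    linarith
  have hbig : ε / 4 * (N : ℝ) ^ k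
      ≤ ((univ.filter fun x : K → ι => k * ε / 4 ≤ surplus w R x).card : ℝ) := by
    have h3 : ∑ x : K → ι, surplus w R x
        ≤ ∑ x : K → ι, (k * ε / 4 + if k * ε / 4 ≤ surplus w R x then (k : ℝ) else 0) := by
      refine sum_le_sum fun x _ => ?_
      have := surplus_le w R x
      rw [← hkdef] at this
      have : 0 < k * ε / 4 := by positivity
      split_ifs with h
      · linarith
      · push Not at h
        linarith
    rw [sum_add_distrib, sum_const, card_univ, Fintype.card_fun, nsmul_eq_mul, ← sum_filter,
      sum_const, nsmul_eq_mul, Nat.cast_pow, ← hkdef, ← hNdef] at h3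
    refine le_of_mul_le_mul_right ?_ (show (0 : ℝ) < k by linarith)
    linarith
  have hunion : (univ.filter fun x : K → ι => k * ε / 4 ≤ surplus w R x).card
      ≤ (univ.filter fun x : K → ι => Function.Injective x ∧ k * ε / 4 ≤ surplus w R x).card
        + (univ.filter fun x : K → ι => ¬ Function.Injective x).card := by
    refine (card_le_card fun x => ?_).trans (card_union_le _ _)
    simp only [mem_filter, mem_univ, true_and, mem_union]
    tauto
  have hunion' : ((univ.filter fun x : K → ι => k * ε / 4 ≤ surplus w R x).card : ℝ)
      ≤ (univ.filter fun x : K → ι => Function.Injective x ∧ k * ε / 4 ≤ surplus w R x).card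
        + (univ.filter fun x : K → ι => ¬ Function.Injective x).card := by exact_mod_cast hunion
  linarith

end

/-- Dense `k`-partite patterns contain complete blow-ups (Erdős). -/
lemma exists_blowup (k b : ℕ) : ∀ δ : ℝ, 0 < δ → ∃ N₀ : ℕ, ∀ N, N₀ ≤ N →
    ∀ G : Finset (Fin k → Fin N), δ * (N : ℝ) ^ k ≤ G.card →
      ∃ B : Fin k → Finset (Fin N), (∀ i, (B i).card = b + 1) ∧
        ∀ x : Fin k → Fin N, (∀ i, x i ∈ B i) → x ∈ G := by
  induction k with
  | zero =>
    intro δ hδ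
    refine ⟨0, fun N _ G hG => ⟨fun i => i.elim0, fun i => i.elim0, fun x _ => ?_⟩⟩
    have : 0 < G.card := by
      rw [pow_zero, mul_one] at hG
      exact_mod_cast hδ.trans_le hG
    obtain ⟨y, hy⟩ := card_pos.1 this
    rwa [Subsingleton.elim x y]
  | succ k ih =>
    intro δ hδ
    obtain ⟨N₁, hN₁⟩ := ih (δ ^ (b + 1) / 2) (by positivity)
    refine ⟨max (N₁ + 1) ⌈4 * ((b + 1 : ℕ) : ℝ) ^ 2 / δ ^ (b + 1)⌉₊, fun N hN G hG => ?_⟩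
    have hN1 : N₁ + 1 ≤ N := (le_max_left _ _).trans hN
    have hN2 : 4 * ((b + 1 : ℕ) : ℝ) ^ 2 ≤ δ ^ (b + 1) * N := by
      have := (Nat.le_ceil _).trans (Nat.cast_le.2 ((le_max_right _ _).trans hN))
      rwa [div_le_iff₀ (by positivity), mul_comm (N : ℝ)] at this
    have hNR : (0 : ℝ) < N := by exact_mod_cast (by omega : 0 < N)
    obtain ⟨A, hA⟩ : ∃ A : (Fin (b + 1) → Fin N) → Finset (Fin k → Fin N),
        ∀ z y, y ∈ A z ↔ ∀ j, (Fin.cons (z j) y : Fin (k + 1) → Fin N) ∈ G :=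
      ⟨fun z => univ.filter fun y => ∀ j, (Fin.cons (z j) y : Fin (k + 1) → Fin N) ∈ G, by simp⟩
    obtain ⟨d, hd⟩ : ∃ d : (Fin k → Fin N) → ℝ, ∀ y, d y =
        ∑ z : Fin N, if (Fin.cons z y : Fin (k + 1) → Fin N) ∈ G then 1 else 0 := ⟨_, fun _ => rfl⟩
    have hdG : ∑ y, d y = G.card := by
      simp only [hd]
      rw [sum_comm, ← Fintype.sum_prod_type' (fun (z : Fin N) (y : Fin k → Fin N) =>
        if (Fin.cons z y : Fin (k + 1) → Fin N) ∈ G then (1 : ℝ) else 0)]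
      refine (Fintype.sum_equiv (Fin.consEquiv fun _ => Fin N) _
          (fun x => if x ∈ G then (1 : ℝ) else 0) fun p => rfl).trans ?_
      simp
    have hd0 : ∀ y, 0 ≤ d y := fun y => by
      rw [hd]
      exact sum_nonneg fun z _ => by split_ifs <;> norm_num
    have hpow : ∀ y, d y ^ (b + 1) = ∑ z : Fin (b + 1) → Fin N, if y ∈ A z then (1 : ℝ) else 0 := by
      intro y
      have h1 : d y ^ (b + 1) = ∏ _j : Fin (b + 1),
          ∑ z : Fin N, if (Fin.cons z y : Fin (k + 1) → Fin N) ∈ G then (1 : ℝ) else 0 := by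
        rw [prod_const, card_univ, Fintype.card_fin, hd]
      rw [h1, prod_univ_sum, Fintype.piFinset_univ]
      refine sum_congr rfl fun z _ => ?_
      rw [prod_ite_zero]
      simp [hA]
    have hsum : ∑ y, d y ^ (b + 1) = ∑ z, ((A z).card : ℝ) := by
      simp only [hpow]
      rw [sum_comm]
      simp
    have hmean := pow_sum_div_card_le_sum_pow (s := univ) (fun y _ => hd0 y) b
    rw [hdG, hsum, card_univ, Fintype.card_fun, Fintype.card_fin, Fintype.card_fin,
      Nat.cast_pow, div_le_iff₀ (by positivity)] at hmean
    -- the average of `#(A z)` is large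
    have hlow : δ ^ (b + 1) * (N : ℝ) ^ (b + 1) * (N : ℝ) ^ k ≤ ∑ z, ((A z).card : ℝ) := by
      have h1 : (δ * (N : ℝ) ^ (k + 1)) ^ (b + 1) ≤ (G.card : ℝ) ^ (b + 1) := by gcongr
      refine le_of_mul_le_mul_right ((le_of_eq ?_).trans (h1.trans hmean))
        (show (0 : ℝ) < ((N : ℝ) ^ k) ^ b by positivity)
      ring
    obtain ⟨z, hz, hzA⟩ : ∃ z : Fin (b + 1) → Fin N, Function.Injective z ∧
        δ ^ (b + 1) / 2 * (N : ℝ) ^ k ≤ (A z).card := by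
      by_contra hcon
      push Not at hcon
      have h1 : ∀ z, ((A z).card : ℝ) ≤ δ ^ (b + 1) / 2 * (N : ℝ) ^ k
          + if ¬ Function.Injective z then (N : ℝ) ^ k else 0 := by
        intro z
        by_cases hz : Function.Injective z
        · rw [if_neg (not_not.2 hz), add_zero]
          exact (hcon z hz).le
        · rw [if_pos hz]
          have h2 : (A z).card ≤ N ^ k := by
            refine (card_le_univ _).trans (le_of_eq ?_)
            simp
          have h3 : ((A z).card : ℝ) ≤ (N : ℝ) ^ k := by exact_mod_cast h2
          have h4 : 0 ≤ δ ^ (b + 1) / 2 * (N : ℝ) ^ k := by positivity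
          linarith
      have h2 := sum_le_sum fun z (_ : z ∈ univ) => h1 z
      rw [sum_add_distrib, ← sum_filter, sum_const, sum_const, nsmul_eq_mul, nsmul_eq_mul, card_univ,
        Fintype.card_fun, Fintype.card_fin, Fintype.card_fin, Nat.cast_pow] at h2
      have h3 := card_not_injective_mul_le (ι := Fin N) (K := Fin (b + 1))
      rw [Fintype.card_fin, Fintype.card_fin] at h3
      have h4 : ((univ.filter fun z : Fin (b + 1) → Fin N => ¬ Function.Injective z).card : ℝ)
          ≤ δ ^ (b + 1) / 4 * (N : ℝ) ^ (b + 1) := by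
        refine le_of_mul_le_mul_right (h3.trans ?_) hNR
        have := mul_le_mul_of_nonneg_right hN2 (show (0 : ℝ) ≤ (N : ℝ) ^ (b + 1) by positivity)
        linarith
      have h5 := mul_le_mul_of_nonneg_right h4 (show (0 : ℝ) ≤ (N : ℝ) ^ k by positivity)
      have h6 : 0 < δ ^ (b + 1) * (N : ℝ) ^ (b + 1) * (N : ℝ) ^ k := by positivity
      linarith
    obtain ⟨B, hB, hBA⟩ := hN₁ N (by omega) (A z) hzA
    refine ⟨Fin.cons (univ.image z) B, fun i => ?_, fun x hx => ?_⟩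
    · refine Fin.cases ?_ (fun i => ?_) i
      · rw [Fin.cons_zero, card_image_of_injective _ hz, card_univ, Fintype.card_fin]
      · rw [Fin.cons_succ, hB]
    · have h0 := hx 0
      rw [Fin.cons_zero, mem_image] at h0
      obtain ⟨j, -, hj⟩ := h0
      have h1 := (hA z _).1 (hBA (fun i => x i.succ) fun i => by simpa using hx i.succ) j
      rw [hj] at h1
      convert h1 using 1
      exact (Fin.cons_self_tail x).symm

section
variable {ι K : Type*} [DecidableEq ι] [Fintype K] [DecidableEq K]

/-- Integral triple weights with position loads at most `b` embed as disjoint edges into a blow-up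
with parts of size `b`. -/
lemma exists_matching_of_blowup [Nonempty ι] (H : Finset (Finset (ι × Fin 3))) (B : K → Finset ι) {b : ℕ}
    (hb : ∀ i, (B i).card = b) (hB : ∀ i j, i ≠ j → Disjoint (B i) (B j))
    (c : K × Fin 3 → K × Fin 3 → K × Fin 3 → ℕ)
    (hc : ∀ p, ∑ q, ∑ r, c p q r + ∑ q, ∑ r, c q p r + ∑ q, ∑ r, c q r p ≤ b)
    (hE : ∀ p q r, c p q r ≠ 0 → ∀ y ∈ B p.1, ∀ y' ∈ B q.1, ∀ y'' ∈ B r.1,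
      ({(y, p.2), (y', q.2), (y'', r.2)} : Finset (ι × Fin 3)) ∈ H) :
    ∃ M ⊆ H, (∀ e ∈ M, ∀ f ∈ M, e ≠ f → Disjoint e f) ∧ M.card = ∑ p, ∑ q, ∑ r, c p q r ∧
      ∀ e ∈ M, ∀ s ∈ e, ∃ i, s.1 ∈ B i := by
  let J := Σ τ : (K × Fin 3) × (K × Fin 3) × (K × Fin 3), Fin (c τ.1 τ.2.1 τ.2.2)
  let S : K × Fin 3 → Finset J := fun p =>
    univ.filter fun j => j.1.1 = p ∨ j.1.2.1 = p ∨ j.1.2.2 = p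
  have hcount : ∀ P : (K × Fin 3) × (K × Fin 3) × (K × Fin 3) → Prop, [DecidablePred P] →
      (univ.filter fun j : J => P j.1).card = ∑ p, ∑ q, ∑ r, if P (p, q, r) then c p q r else 0 := by
    intro P _
    rw [card_filter, Fintype.sum_sigma, Fintype.sum_prod_type]
    refine sum_congr rfl fun p _ => ?_
    rw [Fintype.sum_prod_type]
    refine sum_congr rfl fun q _ => sum_congr rfl fun r _ => ?_
    split_ifs <;> simp
  have hS : ∀ p, (S p).card ≤ (B p.1).card := by
    intro p
    have h1 : (S p).card ≤ (univ.filter fun j : J => j.1.1 = p).card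
        + (univ.filter fun j : J => j.1.2.1 = p).card
        + (univ.filter fun j : J => j.1.2.2 = p).card := by
      refine (card_le_card fun j => ?_).trans ((card_union_le _ _).trans
        (Nat.add_le_add_right (card_union_le _ _) _))
      simp only [S, mem_filter, mem_univ, true_and, mem_union, or_assoc]
      exact id
    rw [hcount (fun τ => τ.1 = p), hcount (fun τ => τ.2.1 = p), hcount (fun τ => τ.2.2 = p)] at h1
    rw [hb]
    refine h1.trans (le_trans (le_of_eq ?_) (hc p))
    congr 1
    · congr 1
      · rw [sum_eq_single p (fun q _ hq => by simp [hq]) (by simp)]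
        simp
      · refine sum_congr rfl fun q _ => ?_
        rw [sum_eq_single p (fun q _ hq => by simp [hq]) (by simp)]
        simp
    · refine sum_congr rfl fun q _ => sum_congr rfl fun r _ => ?_
      rw [sum_eq_single p (fun q _ hq => by simp [hq]) (by simp)]
      simp
  have hf : ∀ p, ∃ f : J → ι, (∀ j ∈ S p, f j ∈ B p.1) ∧ ∀ j ∈ S p, ∀ j' ∈ S p, f j = f j' → j = j' := by
    intro p
    obtain ⟨g⟩ : Nonempty ({j // j ∈ S p} ↪ {y // y ∈ B p.1}) :=
      Function.Embedding.nonempty_of_card_le (by simpa using hS p)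
    refine ⟨fun j => if hj : j ∈ S p then (g ⟨j, hj⟩).1 else Classical.arbitrary ι, fun j hj => ?_,
      fun j hj j' hj' h => ?_⟩
    · simp only [dif_pos hj]
      exact (g _).2
    · simp only [dif_pos hj, dif_pos hj'] at h
      exact congrArg Subtype.val (g.injective (Subtype.ext h))
  choose f hf1 hf2 using hf
  let E : J → Finset (ι × Fin 3) := fun j =>
    {(f j.1.1 j, j.1.1.2), (f j.1.2.1 j, j.1.2.1.2), (f j.1.2.2 j, j.1.2.2.2)}
  have hmemE : ∀ j s, s ∈ E j → ∃ p, j ∈ S p ∧ s = (f p j, p.2) := by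
    intro j s hs
    simp only [E, mem_insert, mem_singleton] at hs
    simp only [S, mem_filter, mem_univ, true_and]
    rcases hs with h | h | h
    · exact ⟨_, Or.inl rfl, h⟩
    · exact ⟨_, Or.inr (Or.inl rfl), h⟩
    · exact ⟨_, Or.inr (Or.inr rfl), h⟩
  have hdisj : ∀ j j', j ≠ j' → Disjoint (E j) (E j') := by
    intro j j' hne
    rw [disjoint_left]
    intro s hs hs'
    obtain ⟨p, hp, rfl⟩ := hmemE j s hs
    obtain ⟨p', hp', h⟩ := hmemE j' _ hs'
    rw [Prod.mk.injEq] at h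
    have h1 : p.1 = p'.1 := by
      by_contra h1
      refine disjoint_left.1 (hB _ _ h1) (hf1 p j hp) ?_
      rw [h.1]
      exact hf1 p' j' hp'
    obtain rfl : p = p' := Prod.ext h1 h.2
    exact hne (hf2 p j hp j' hp' h.1)
  have hinj : Function.Injective E := by
    intro j j' h
    by_contra hne
    have := hdisj j j' hne
    rw [← h, disjoint_self_iff_empty] at this
    simp [E] at this
  refine ⟨univ.image E, fun e he => ?_, fun e he e' he' hne => ?_, ?_, fun e he s hs => ?_⟩
  · obtain ⟨j, -, rfl⟩ := mem_image.1 he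
    refine hE _ _ _ (fun h0 => ?_) _ (hf1 _ j ?_) _ (hf1 _ j ?_) _ (hf1 _ j ?_)
    · have := j.2
      rw [h0] at this
      exact this.elim0
    all_goals simp [S]
  · obtain ⟨j, -, rfl⟩ := mem_image.1 he
    obtain ⟨j', -, rfl⟩ := mem_image.1 he'
    exact hdisj j j' fun h => hne (by rw [h])
  · rw [card_image_of_injective _ hinj]
    have := hcount fun _ => True
    simpa using this
  · obtain ⟨j, -, rfl⟩ := mem_image.1 he
    obtain ⟨p, hp, rfl⟩ := hmemE j s hs
    exact ⟨p.1, hf1 p j hp⟩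

omit [Fintype K] [DecidableEq K] in
/-- Exchanging the blocks inside a blow-up for a larger matching. -/
lemma exists_larger_matching (H : Finset (Finset (ι × Fin 3))) (R : Finset ι)
    (hR : ∀ y ∈ R, univ.image (Prod.mk y) ∈ H) (B : K → Finset ι) {b : ℕ}
    (hb : ∀ i, (B i).card = b) (I : Finset K)
    (hI : ∀ i, ∀ y ∈ B i, y ∈ R ↔ i ∈ I) (M : Finset (Finset (ι × Fin 3))) (hMH : M ⊆ H)
    (hM : ∀ e ∈ M, ∀ f ∈ M, e ≠ f → Disjoint e f) (hMB : ∀ e ∈ M, ∀ s ∈ e, ∃ i, s.1 ∈ B i)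
    (hcard : b * I.card < M.card) :
    ∃ M' ⊆ H, (∀ e ∈ M', ∀ f ∈ M', e ≠ f → Disjoint e f) ∧ R.card < M'.card := by
  have hblk : ∀ y y' : ι, y ≠ y' →
      Disjoint (univ.image (Prod.mk y : Fin 3 → _)) (univ.image (Prod.mk y' : Fin 3 → _)) := by
    intro y y' hne
    simp only [disjoint_left, mem_image, mem_univ, true_and]
    rintro _ ⟨a, rfl⟩ ⟨a', h⟩
    exact hne (congrArg Prod.fst h).symm
  have hinj : Function.Injective fun y : ι => univ.image (Prod.mk y : Fin 3 → _) := by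
    intro y y' h
    by_contra hne
    have := hblk y y' hne
    simp only at h
    rw [← h, disjoint_self_iff_empty, image_eq_empty] at this
    exact univ_nonempty.ne_empty this
  have hMd : ∀ e ∈ M, ∀ y ∈ R \ I.biUnion B, Disjoint e (univ.image (Prod.mk y : Fin 3 → _)) := by
    intro e he y hy
    rw [disjoint_left]
    intro s hs hs'
    obtain ⟨a, -, rfl⟩ := mem_image.1 hs'
    obtain ⟨i, hi⟩ := hMB e he _ hs
    rw [mem_sdiff, mem_biUnion] at hy
    exact hy.2 ⟨i, (hI i y hi).1 hy.1, hi⟩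
  refine ⟨M ∪ (R \ I.biUnion B).image fun y => univ.image (Prod.mk y), ?_, ?_, ?_⟩
  · refine union_subset hMH fun e he => ?_
    obtain ⟨y, hy, rfl⟩ := mem_image.1 he
    exact hR y (mem_sdiff.1 hy).1
  · intro e he e' he' hne
    rcases mem_union.1 he with h | h <;> rcases mem_union.1 he' with h' | h'
    · exact hM e h e' h' hne
    · obtain ⟨y, hy, rfl⟩ := mem_image.1 h'
      exact hMd e h y hy
    · obtain ⟨y, hy, rfl⟩ := mem_image.1 h
      exact (hMd e' h' y hy).symm
    · obtain ⟨y, hy, rfl⟩ := mem_image.1 h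
      obtain ⟨y', hy', rfl⟩ := mem_image.1 h'
      exact hblk y y' fun hyy => hne (by rw [hyy])
  · have h1 : Disjoint M ((R \ I.biUnion B).image fun y => univ.image (Prod.mk y)) := by
      rw [disjoint_left]
      intro e he he'
      obtain ⟨y, hy, rfl⟩ := mem_image.1 he'
      have := hMd _ he y hy
      rw [disjoint_self_iff_empty, image_eq_empty] at this
      exact univ_nonempty.ne_empty this
    have h2 : (I.biUnion B).card ≤ b * I.card := by
      refine card_biUnion_le.trans (le_of_eq ?_)
      rw [sum_congr rfl fun i _ => hb i, sum_const, smul_eq_mul, mul_comm]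
    have h3 := le_card_sdiff (I.biUnion B) R
    rw [card_union_of_disjoint h1, card_image_of_injective _ hinj]
    omega

end

section
variable {ι K : Type*} [Fintype ι] [DecidableEq ι] [Fintype K]

/-- The factor by which a load `l` is scaled down to be at most one. -/
def trunc (l : ℝ) : ℝ := if l ≤ 1 then 1 else 1 / l

lemma trunc_pos (l : ℝ) : 0 < trunc l := by
  unfold trunc
  split_ifs with h
  · norm_num
  · exact one_div_pos.2 (by linarith)

lemma trunc_le_one (l : ℝ) : trunc l ≤ 1 := by
  unfold trunc
  split_ifs with h
  · exact le_rfl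
  · rw [div_le_one (by linarith)]
    linarith

lemma trunc_mul_le_one (l : ℝ) : trunc l * l ≤ 1 := by
  unfold trunc
  split_ifs with h
  · linarith
  · rw [one_div_mul_cancel (by linarith)]

lemma one_sub_trunc_mul (l : ℝ) : (1 - trunc l) * l = max (l - 1) 0 := by
  unfold trunc
  split_ifs with h
  · rw [max_eq_right (by linarith)]
    ring
  · rw [max_eq_left (by linarith), sub_mul, one_div_mul_cancel (by linarith), one_mul]

lemma one_sub_le_mul_three {a b c : ℝ} (hb : 0 ≤ b) (ha1 : a ≤ 1)
    (hb1 : b ≤ 1) (hc1 : c ≤ 1) : 1 - (1 - a) - (1 - b) - (1 - c) ≤ a * b * c := by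
  have h1 : 0 ≤ (1 - a) * (1 - b) := mul_nonneg (by linarith) (by linarith)
  have h2 : 0 ≤ (1 - a * b) * (1 - c) :=
    mul_nonneg (by nlinarith [mul_le_one₀ ha1 hb hb1]) (by linarith)
  linarith

variable (w : Finset (ι × Fin 3) → ℝ) (x : K → ι) (b : ℕ)

lemma sampled_rotate (p q r : K × Fin 3) : sampled w x q p r = sampled w x p q r := by
  unfold sampled kern
  rw [insert_comm (pt x q)]
  congr 2
  rw [ne_comm (a := (pt x q).1) (b := (pt x p).1)]
  exact propext ⟨fun h => ⟨h.1, h.2.2, h.2.1⟩, fun h => ⟨h.1, h.2.2, h.2.1⟩⟩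

lemma sampled_swap (p q r : K × Fin 3) : sampled w x p r q = sampled w x p q r := by
  unfold sampled kern
  rw [pair_comm (pt x r)]
  congr 2
  rw [ne_comm (a := (pt x r).1) (b := (pt x q).1)]
  exact propext ⟨fun h => ⟨h.2.1, h.1, h.2.2⟩, fun h => ⟨h.2.1, h.1, h.2.2⟩⟩

/-- The sampled weights, truncated, scaled by `b` and rounded down. -/
def rounded (p q r : K × Fin 3) : ℕ :=
  ⌊b * (sampled w x p q r * (trunc (posLoad w x p) * trunc (posLoad w x q) * trunc (posLoad w x r)))⌋₊

variable {w}

lemma sampled_nonneg (hw : ∀ e, 0 ≤ w e) (p q r : K × Fin 3) : 0 ≤ sampled w x p q r :=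
  mul_nonneg (by positivity) (kern_nonneg hw _ _ _)

lemma rounded_le (hw : ∀ e, 0 ≤ w e) (p q r : K × Fin 3) : (rounded w x b p q r : ℝ) ≤
    b * (sampled w x p q r *
      (trunc (posLoad w x p) * trunc (posLoad w x q) * trunc (posLoad w x r))) := by
  refine Nat.floor_le ?_
  have h1 := sampled_nonneg x hw p q r
  have h2 := trunc_pos (posLoad w x p)
  have h3 := trunc_pos (posLoad w x q)
  have h4 := trunc_pos (posLoad w x r)
  positivity

lemma rounded_le_left (hw : ∀ e, 0 ≤ w e) (p q r : K × Fin 3) : (rounded w x b p q r : ℝ) ≤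
    b * trunc (posLoad w x p) * sampled w x p q r := by
  refine (rounded_le x b hw p q r).trans ?_
  have h1 := sampled_nonneg x hw p q r
  have h2 := trunc_pos (posLoad w x p)
  have h3 := trunc_pos (posLoad w x q)
  have h4 := trunc_pos (posLoad w x r)
  have h5 : trunc (posLoad w x q) * trunc (posLoad w x r) ≤ 1 :=
    mul_le_one₀ (trunc_le_one _) h4.le (trunc_le_one _)
  have h6 : 0 ≤ b * trunc (posLoad w x p) * sampled w x p q r := by positivity
  have h7 := mul_le_mul_of_nonneg_left h5 h6
  linarith

lemma rounded_rotate (p q r : K × Fin 3) : rounded w x b q p r = rounded w x b p q r := by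
  unfold rounded
  rw [sampled_rotate, mul_comm (trunc (posLoad w x q))]

lemma rounded_swap (p q r : K × Fin 3) : rounded w x b p r q = rounded w x b p q r := by
  unfold rounded
  rw [sampled_swap, mul_right_comm (trunc (posLoad w x p))]

lemma three_mul_sum_rounded_le (hw : ∀ e, 0 ≤ w e) (p : K × Fin 3) :
    3 * ∑ q, ∑ r, rounded w x b p q r ≤ b := by
  have h1 : (∑ q, ∑ r, (rounded w x b p q r : ℝ))
      ≤ ∑ q, ∑ r, b * trunc (posLoad w x p) * sampled w x p q r :=
    sum_le_sum fun q _ => sum_le_sum fun r _ => rounded_le_left x b hw p q r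
  simp only [← mul_sum] at h1
  have h2 : posLoad w x p = 3 * ∑ q, ∑ r, sampled w x p q r := rfl
  have h3 := mul_le_mul_of_nonneg_left (trunc_mul_le_one (posLoad w x p)) (Nat.cast_nonneg (α := ℝ) b)
  have h4 : b * (trunc (posLoad w x p) * posLoad w x p)
      = 3 * (b * trunc (posLoad w x p) * ∑ q, ∑ r, sampled w x p q r) := by
    nth_rewrite 2 [h2]
    ring
  have h5 : 3 * (∑ q, ∑ r, (rounded w x b p q r : ℝ)) ≤ b := by linarith
  exact_mod_cast h5

lemma sum_rounded_le (hw : ∀ e, 0 ≤ w e) (p : K × Fin 3) :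
    ∑ q, ∑ r, rounded w x b p q r + ∑ q, ∑ r, rounded w x b q p r + ∑ q, ∑ r, rounded w x b q r p
      ≤ b := by
  have h1 : ∀ q r, rounded w x b q p r = rounded w x b p q r := fun q r => rounded_rotate x b p q r
  have h2 : ∀ q r, rounded w x b q r p = rounded w x b p q r := fun q r => by
    rw [rounded_swap, rounded_rotate]
  simp only [h1, h2]
  have := three_mul_sum_rounded_le x b hw p
  omega

lemma rounded_le_self (hw : ∀ e, 0 ≤ w e) (p q r : K × Fin 3) : rounded w x b p q r ≤ b := by
  have h1 := three_mul_sum_rounded_le x b hw p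
  have h2 := single_le_sum (f := fun r => rounded w x b p q r) (fun r _ => Nat.zero_le _) (mem_univ r)
  have h3 := single_le_sum (f := fun q => ∑ r, rounded w x b p q r) (fun r _ => Nat.zero_le _)
    (mem_univ q)
  omega

lemma sum_rounded_ge (hw : ∀ e, 0 ≤ w e) (R : Finset ι) :
    b * (surplus w R x + ((univ.filter fun i => x i ∈ R).card : ℝ)) - 27 * (Fintype.card K : ℝ) ^ 3
      ≤ ((∑ p, ∑ q, ∑ r, rounded w x b p q r : ℕ) : ℝ) := by
  have hterm : ∀ p q r, b * (sampled w x p q r - (1 - trunc (posLoad w x p)) * sampled w x p q r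
      - (1 - trunc (posLoad w x q)) * sampled w x p q r
      - (1 - trunc (posLoad w x r)) * sampled w x p q r) - 1 ≤ (rounded w x b p q r : ℝ) := by
    intro p q r
    have h1 := Nat.sub_one_lt_floor (b * (sampled w x p q r *
      (trunc (posLoad w x p) * trunc (posLoad w x q) * trunc (posLoad w x r))))
    have h2 := one_sub_le_mul_three (a := trunc (posLoad w x p))
      (trunc_pos (posLoad w x q)).le (trunc_le_one _) (trunc_le_one _) (trunc_le_one (posLoad w x r))
    have h3 := mul_le_mul_of_nonneg_left h2 (mul_nonneg (Nat.cast_nonneg (α := ℝ) b)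
      (sampled_nonneg x hw p q r))
    unfold rounded
    linarith
  have hp : ∀ p, ∑ q, ∑ r, (1 - trunc (posLoad w x p)) * sampled w x p q r
      = max (posLoad w x p - 1) 0 / 3 := by
    intro p
    simp only [← mul_sum]
    rw [← one_sub_trunc_mul, posLoad]
    ring
  have e1 : ∑ p, ∑ q, ∑ r, (1 - trunc (posLoad w x p)) * sampled w x p q r
      = (∑ p, max (posLoad w x p - 1) 0) / 3 := by
    simp only [hp, sum_div]
  have e2 : ∑ p, ∑ q, ∑ r, (1 - trunc (posLoad w x q)) * sampled w x p q r
      = (∑ p, max (posLoad w x p - 1) 0) / 3 := by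
    rw [sum_comm, ← e1]
    refine sum_congr rfl fun q _ => sum_congr rfl fun p _ => sum_congr rfl fun r _ => ?_
    rw [sampled_rotate]
  have e3 : ∑ p, ∑ q, ∑ r, (1 - trunc (posLoad w x r)) * sampled w x p q r
      = (∑ p, max (posLoad w x p - 1) 0) / 3 := by
    rw [sum_sum_sum_comm, ← e1]
    refine sum_congr rfl fun r _ => sum_congr rfl fun p _ => sum_congr rfl fun q _ => ?_
    rw [sampled_swap w x p r q, sampled_rotate]
  have hsum := sum_le_sum fun p (_ : p ∈ univ) => sum_le_sum fun q (_ : q ∈ univ) =>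
    sum_le_sum fun r (_ : r ∈ univ) => hterm p q r
  simp only [sum_sub_distrib, ← mul_sum] at hsum e1 e2 e3
  rw [e1, e2] at hsum
  simp only [e3, sum_const, card_univ, nsmul_eq_mul, Fintype.card_prod, Fintype.card_fin] at hsum
  push_cast at hsum ⊢
  unfold surplus
  linarith

lemma rounded_ne_zero {p q r : K × Fin 3} (h : rounded w x b p q r ≠ 0) :
    kern w (pt x p) (pt x q) (pt x r) ≠ 0 := by
  intro h0
  apply h
  unfold rounded sampled
  rw [h0]
  simp

end

section

lemma exists_monochromatic_blowup {k : ℕ} {C : Type*} [Fintype C] [Nonempty C] (b : ℕ) {δ : ℝ}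
    (hδ : 0 < δ) : ∃ N₀, ∀ N, N₀ ≤ N → ∀ (G : Finset (Fin k → Fin N)) (col : (Fin k → Fin N) → C),
      δ * (N : ℝ) ^ k ≤ G.card → ∃ (B : Fin k → Finset (Fin N)) (c : C),
        (∀ i, (B i).card = b + 1) ∧ ∀ x, (∀ i, x i ∈ B i) → x ∈ G ∧ col x = c := by
  have hQ : (0 : ℝ) < Fintype.card C := by exact_mod_cast Fintype.card_pos
  obtain ⟨N₀, h⟩ := exists_blowup k b (δ / Fintype.card C) (by positivity)
  refine ⟨N₀, fun N hN G col hG => ?_⟩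
  obtain ⟨c, -, hc⟩ := exists_le_card_fiber_of_nsmul_le_card_of_maps_to (s := G)
    (t := (univ : Finset C)) (f := col) (b := δ / Fintype.card C * (N : ℝ) ^ k)
    (fun _ _ => mem_univ _) univ_nonempty (by
      rw [card_univ, nsmul_eq_mul]
      refine le_trans (le_of_eq ?_) hG
      field_simp)
  obtain ⟨B, hB, hx⟩ := h N hN _ hc
  exact ⟨B, c, hB, fun x hxB => (mem_filter.1 (hx x hxB))⟩

lemma exists_transversal_through {ι K : Type*} [DecidableEq K] {B : K → Finset ι}
    (hB : ∀ i, (B i).Nonempty) {i : K} {y : ι} (hy : y ∈ B i) :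
    ∃ x : K → ι, (∀ j, x j ∈ B j) ∧ x i = y := by
  choose z hz using hB
  refine ⟨Function.update z i y, fun j => ?_, by simp⟩
  rcases eq_or_ne j i with rfl | h
  · simpa using hy
  · simpa [h] using hz j

lemma exists_transversal_through_pair {ι K : Type*} [DecidableEq K] {B : K → Finset ι}
    (hB : ∀ i, (B i).Nonempty) {i j : K} (hij : i ≠ j) {y y' : ι} (hy : y ∈ B i) (hy' : y' ∈ B j) :
    ∃ x : K → ι, (∀ j, x j ∈ B j) ∧ x i = y ∧ x j = y' := by
  obtain ⟨z, hz, hzi⟩ := exists_transversal_through hB hy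
  refine ⟨Function.update z j y', fun l => ?_, by simp [hij, hzi], by simp⟩
  rcases eq_or_ne l j with rfl | h
  · simpa using hy'
  · simpa [h] using hz l

lemma exists_transversal_through_triple {ι K : Type*} [DecidableEq K] {B : K → Finset ι}
    (hB : ∀ i, (B i).Nonempty) {i j l : K} (hij : i ≠ j) (hil : i ≠ l) (hjl : j ≠ l) {y y' y'' : ι}
    (hy : y ∈ B i) (hy' : y' ∈ B j) (hy'' : y'' ∈ B l) :
    ∃ x : K → ι, (∀ j, x j ∈ B j) ∧ x i = y ∧ x j = y' ∧ x l = y'' := by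
  obtain ⟨z, hz, hzi, hzj⟩ := exists_transversal_through_pair hB hij hy hy'
  refine ⟨Function.update z l y'', fun m => ?_, by simp [hil, hzi], by simp [hjl, hzj], by simp⟩
  rcases eq_or_ne m l with rfl | h
  · simpa using hy''
  · simpa [h] using hz m

/-- If a nearly fractional matching of bounded weights beats the blocks of `R`, all of which are
edges, then there is a matching with more than `R.card` edges. -/
lemma exists_matching_gt_of_weights {κ ε : ℝ} (hε : 0 < ε) :
    ∃ N₀ : ℕ, ∀ N, N₀ ≤ N → ∀ (H : Finset (Finset (Fin N × Fin 3))) (R : Finset (Fin N))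
      (w : Finset (Fin N × Fin 3) → ℝ), (∀ e ∈ H, e.card = 3) →
      (∀ y ∈ R, univ.image (Prod.mk y) ∈ H) → (∀ e, 0 ≤ w e) → (∀ e, w e ≤ κ / (N : ℝ) ^ 2) →
      (∀ e ∉ H, w e = 0) →
      R.card + ∑ v, max (load w v - 1) 0 + ε * N ≤ ∑ e, w e →
      ∃ M ⊆ H, (∀ e ∈ M, ∀ f ∈ M, e ≠ f → Disjoint e f) ∧ R.card < M.card := by
  obtain ⟨k, hk⟩ := exists_nat_ge (max 3 ((29 * κ + 1278 * κ ^ 2 / ε) * 4 / ε))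
  have hk3 : 3 ≤ k := by exact_mod_cast (le_max_left _ _).trans hk
  have hkε : 29 * κ + 1278 * κ ^ 2 / ε ≤ k * ε / 4 := by
    have := (le_max_right _ _).trans hk
    rw [div_le_iff₀ hε] at this
    linarith
  obtain ⟨b, hb⟩ := exists_nat_gt (108 * (k : ℝ) ^ 2 / ε)
  rw [div_lt_iff₀ hε] at hb
  have hkR : (0 : ℝ) < k := by exact_mod_cast (by omega : 0 < k)
  obtain ⟨N₁, hN₁⟩ := exists_monochromatic_blowup (k := k)
    (C := (Fin k × Fin 3 → Fin k × Fin 3 → Fin k × Fin 3 → Fin (b + 1 + 1)) × Finset (Fin k)) b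
    (δ := ε / 8) (by positivity)
  obtain ⟨N₂, hN₂⟩ := exists_nat_ge (8 * (k : ℝ) ^ 2 / ε)
  rw [div_le_iff₀ hε] at hN₂
  refine ⟨max (max k N₁) N₂, fun N hN H R w hH hR hw hκ hwH hsum => ?_⟩
  have hkN : k ≤ N := (le_max_left _ _).trans ((le_max_left _ _).trans hN)
  have hNN₁ : N₁ ≤ N := (le_max_right _ _).trans ((le_max_left _ _).trans hN)
  have hNN₂ : (N₂ : ℝ) ≤ N := by exact_mod_cast (le_max_right _ _).trans hN
  have : NeZero N := ⟨by omega⟩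
  have hgood := card_good_samples (K := Fin k) hw (fun e he => hwH e fun h => he (hH e h)) hε
    (by simpa using hκ) R (by simpa using hk3) (by simpa using hkN) (by simpa using hkε)
    (by
      simp only [Fintype.card_fin]
      have := mul_le_mul_of_nonneg_right hNN₂ hε.le
      linarith)
    (by simpa using hsum)
  simp only [Fintype.card_fin] at hgood
  obtain ⟨B, ⟨c, I⟩, hBcard, hB⟩ := hN₁ N hNN₁ _ (fun x =>
    (fun p q r => ⟨rounded w x (b + 1) p q r,
        Nat.lt_succ_of_le (rounded_le_self x (b + 1) hw p q r)⟩,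
      univ.filter fun i => x i ∈ R)) hgood
  have hBne : ∀ i, (B i).Nonempty := fun i => card_pos.1 (by rw [hBcard]; omega)
  have hB' : ∀ x, (∀ i, x i ∈ B i) → Function.Injective x ∧ k * ε / 4 ≤ surplus w R x ∧
      (∀ p q r, rounded w x (b + 1) p q r = c p q r) ∧ (univ.filter fun i => x i ∈ R) = I := by
    intro x hx
    obtain ⟨h1, h2⟩ := hB x hx
    rw [mem_filter] at h1
    rw [Prod.mk.injEq] at h2
    refine ⟨h1.2.1, h1.2.2, fun p q r => ?_, h2.2⟩
    rw [← h2.1]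
  obtain ⟨x₀, hx₀⟩ : ∃ x₀ : Fin k → Fin N, ∀ i, x₀ i ∈ B i :=
    ⟨fun i => (hBne i).choose, fun i => (hBne i).choose_spec⟩
  obtain ⟨-, hs₀, hc₀, hI₀⟩ := hB' x₀ hx₀
  have hI : ∀ i, ∀ y ∈ B i, y ∈ R ↔ i ∈ I := by
    intro i y hy
    obtain ⟨x, hx, rfl⟩ := exists_transversal_through hBne hy
    rw [← (hB' x hx).2.2.2]
    simp
  have hdisj : ∀ i j, i ≠ j → Disjoint (B i) (B j) := by
    intro i j hij
    rw [disjoint_left]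
    intro y hy hy'
    obtain ⟨x, hx, hxi, hxj⟩ := exists_transversal_through_pair hBne hij hy hy'
    exact hij ((hB' x hx).1 (hxi.trans hxj.symm))
  have hc : ∀ p, ∑ q, ∑ r, (c p q r : ℕ) + ∑ q, ∑ r, (c q p r : ℕ) + ∑ q, ∑ r, (c q r p : ℕ)
      ≤ b + 1 := by
    intro p
    simp only [← hc₀]
    exact sum_rounded_le x₀ (b + 1) hw p
  have hE : ∀ p q r, (c p q r : ℕ) ≠ 0 → ∀ y ∈ B p.1, ∀ y' ∈ B q.1, ∀ y'' ∈ B r.1,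
      ({(y, p.2), (y', q.2), (y'', r.2)} : Finset (Fin N × Fin 3)) ∈ H := by
    intro p q r hne y hy y' hy' y'' hy''
    have hk0 := rounded_ne_zero x₀ (b + 1) (by rw [hc₀]; exact hne)
    have hd : p.1 ≠ q.1 ∧ p.1 ≠ r.1 ∧ q.1 ≠ r.1 := by
      unfold kern at hk0
      split_ifs at hk0 with h
      · exact ⟨fun e => h.1 (congrArg x₀ e), fun e => h.2.1 (congrArg x₀ e),
          fun e => h.2.2 (congrArg x₀ e)⟩
      · exact absurd rfl hk0
    obtain ⟨x, hx, rfl, rfl, rfl⟩ := exists_transversal_through_triple hBne hd.1 hd.2.1 hd.2.2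
      hy hy' hy''
    have hk1 := rounded_ne_zero x (b + 1) (by rw [(hB' x hx).2.2.1]; exact hne)
    by_contra hnot
    apply hk1
    unfold kern
    split_ifs
    · exact hwH _ hnot
    · rfl
  obtain ⟨M, hMH, hMd, hMc, hMB⟩ := exists_matching_of_blowup H B hBcard hdisj
    (fun p q r => (c p q r : ℕ)) hc hE
  refine exists_larger_matching H R hR B hBcard I hI M hMH hMd hMB ?_
  rw [hMc]
  have h1 := sum_rounded_ge x₀ (b + 1) hw R
  rw [hI₀] at h1
  simp only [hc₀, Fintype.card_fin] at h1
  have h2 : ((b + 1 : ℕ) : ℝ) * (k * ε / 4) ≤ ((b + 1 : ℕ) : ℝ) * surplus w R x₀ :=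
    mul_le_mul_of_nonneg_left hs₀ (by positivity)
  have h3 : 27 * (k : ℝ) ^ 3 < ((b + 1 : ℕ) : ℝ) * (k * ε / 4) := by
    push_cast
    have := mul_lt_mul_of_pos_right hb hkR
    nlinarith [mul_pos hkR hε]
  have h4 : (((b + 1) * I.card : ℕ) : ℝ) < ((∑ p, ∑ q, ∑ r, (c p q r : ℕ) : ℕ) : ℝ) := by
    refine lt_of_lt_of_le ?_ h1
    push_cast at h2 h3 ⊢
    linarith
  exact_mod_cast h4

end

section
variable {V : Type*} [Fintype V] [DecidableEq V]

lemma three_mul_card_le {M : Finset (Finset V)} (hM3 : ∀ e ∈ M, e.card = 3)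
    (hM : ∀ e ∈ M, ∀ f ∈ M, e ≠ f → Disjoint e f) : 3 * M.card ≤ Fintype.card V := by
  have h := card_biUnion (s := M) (t := id) hM
  rw [sum_congr rfl (fun e he => by rw [id, hM3 e he]), sum_const, smul_eq_mul] at h
  rw [mul_comm, ← h]
  exact card_le_univ _

omit [Fintype V] in
lemma exists_injective_image_eq {e : Finset V} (he : e.card = 3) :
    ∃ g : Fin 3 → V, Function.Injective g ∧ univ.image g = e := by
  obtain ⟨a, b, c, hab, hac, hbc, rfl⟩ := card_eq_three.1 he
  refine ⟨![a, b, c], ?_, ?_⟩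
  · intro i j
    fin_cases i <;> fin_cases j <;> simp [hab, hac, hbc, hab.symm, hac.symm, hbc.symm]
  · ext x
    simp [Fin.exists_fin_succ, eq_comm]

lemma exists_block_embedding [Nonempty V] {N : ℕ} (hN : 3 * N ≤ Fintype.card V)
    {M : Finset (Finset V)} (hM3 : ∀ e ∈ M, e.card = 3)
    (hM : ∀ e ∈ M, ∀ f ∈ M, e ≠ f → Disjoint e f) (hMN : M.card ≤ N) :
    ∃ (f : Fin N × Fin 3 ↪ V) (R : Finset (Fin N)), R.card = M.card ∧
      ∀ y ∈ R, (univ.image (Prod.mk y)).map f ∈ M := by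
  obtain ⟨R, -, hRc⟩ := exists_subset_card_eq (s := (univ : Finset (Fin N))) (n := M.card)
    (by simpa using hMN)
  let u : R ≃ M := equivOfCardEq hRc
  choose g hgi hg using fun e : M => exists_injective_image_eq (hM3 e e.2)
  let f₀ : Fin N × Fin 3 → V := fun s =>
    if h : s.1 ∈ R then g (u ⟨s.1, h⟩) s.2 else Classical.arbitrary V
  have hf₀ : ∀ (y : Fin N) (hy : y ∈ R) (a : Fin 3), f₀ (y, a) = g (u ⟨y, hy⟩) a :=
    fun y hy a => dif_pos hy
  have hmem : ∀ e : M, ∀ a, g e a ∈ (e : Finset V) := fun e a => by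
    rw [← hg e]
    exact mem_image_of_mem _ (mem_univ a)
  have hinj : Set.InjOn f₀ (R ×ˢ (univ : Finset (Fin 3)) : Finset (Fin N × Fin 3)) := by
    rintro ⟨y, a⟩ hs ⟨y', a'⟩ hs' h
    have hy : y ∈ R := (mem_product.1 hs).1
    have hy' : y' ∈ R := (mem_product.1 hs').1
    rw [hf₀ y hy, hf₀ y' hy'] at h
    have hyy : y = y' := by
      by_contra hne
      have h1 : (u ⟨y, hy⟩ : Finset V) ≠ u ⟨y', hy'⟩ := fun e =>
        hne (congrArg Subtype.val (u.injective (Subtype.ext e)))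
      have h2 := hM _ (u ⟨y, hy⟩).2 _ (u ⟨y', hy'⟩).2 h1
      exact disjoint_left.1 h2 (hmem _ a) (h ▸ hmem _ a')
    subst hyy
    rw [hgi _ h]
  obtain ⟨T, hT, -, hTc⟩ := exists_subsuperset_card_eq
    (s := (R ×ˢ (univ : Finset (Fin 3))).image f₀) (t := univ) (n := 3 * N) (subset_univ _) (by
      refine card_image_le.trans ?_
      rw [card_product, card_univ, Fintype.card_fin, hRc]
      omega) (by simpa using hN)
  obtain ⟨F, hF⟩ := exists_equiv_extend_of_card_eq (α := Fin N × Fin 3) (t := T)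
    (by simp [hTc, mul_comm]) hT hinj
  refine ⟨F.toEmbedding.trans (Function.Embedding.subtype _), R, hRc, fun y hy => ?_⟩
  have : (univ.image (Prod.mk y)).map (F.toEmbedding.trans (Function.Embedding.subtype _))
      = (u ⟨y, hy⟩ : Finset V) := by
    rw [← hg, map_eq_image, image_image]
    refine image_congr fun a _ => ?_
    simp only [Function.comp_apply, Function.Embedding.trans_apply, Equiv.coe_toEmbedding,
      Function.Embedding.subtype_apply]
    rw [hF _ (by simp [hy]), hf₀ y hy]
  rw [this]
  exact (u ⟨y, hy⟩).2

lemma load_le {w : Finset V → ℝ} (hw3 : ∀ e, e.card ≠ 3 → w e = 0) {c : ℝ} (hc : 0 ≤ c)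
    (hwc : ∀ e, w e ≤ c) (v : V) : load w v ≤ c * (Fintype.card V : ℝ) ^ 2 := by
  have h1 : load w v = ∑ e ∈ univ.filter (fun e : Finset V => v ∈ e ∧ e.card = 3), w e := by
    unfold load
    rw [← filter_filter]
    refine (sum_filter_of_ne fun e _ he => ?_).symm
    by_contra h
    exact he (hw3 e h)
  have h2 : (univ.filter (fun e : Finset V => v ∈ e ∧ e.card = 3)).card
      ≤ (powersetCard 2 (univ : Finset V)).card := by
    refine card_le_card_of_injOn (fun e => e.erase v) ?_ ?_
    · intro e he
      have he := (mem_filter.1 he).2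
      exact mem_powersetCard.2 ⟨subset_univ _, by rw [card_erase_of_mem he.1, he.2]⟩
    · intro e he e' he' h
      rw [← insert_erase (mem_filter.1 he).2.1, ← insert_erase (mem_filter.1 he').2.1]
      exact congrArg _ h
  rw [card_powersetCard, card_univ] at h2
  have h3 := h2.trans (Nat.choose_le_pow _ 2)
  rw [h1]
  refine (sum_le_card_nsmul _ _ c fun e _ => hwc e).trans ?_
  rw [nsmul_eq_mul, mul_comm]
  refine mul_le_mul_of_nonneg_left ?_ hc
  exact_mod_cast h3

variable {U : Type*} [Fintype U] [DecidableEq U]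

lemma load_map_le {w : Finset V → ℝ} (hw : ∀ e, 0 ≤ w e) (f : U ↪ V) (s : U) :
    load (fun e => w (e.map f)) s ≤ load w (f s) := by
  unfold load
  refine (sum_map (univ.filter (s ∈ ·)) (mapEmbedding f).toEmbedding w).symm.le.trans ?_
  refine sum_le_sum_of_subset_of_nonneg (fun e he => ?_) fun e _ _ => hw e
  obtain ⟨e', he', rfl⟩ := mem_map.1 he
  simp only [mem_filter, mem_univ, true_and] at he' ⊢
  exact mem_map_of_mem f he'

lemma sum_excess_map_le {w : Finset V → ℝ} (hw : ∀ e, 0 ≤ w e) (f : U ↪ V) :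
    ∑ s, max (load (fun e => w (e.map f)) s - 1) 0 ≤ ∑ v, max (load w v - 1) 0 := by
  calc ∑ s, max (load (fun e => w (e.map f)) s - 1) 0
      ≤ ∑ s, max (load w (f s) - 1) 0 :=
        sum_le_sum fun s _ => max_le_max (sub_le_sub_right (load_map_le hw f s) 1) le_rfl
    _ = ∑ v ∈ univ.map f, max (load w v - 1) 0 := by rw [sum_map]
    _ ≤ _ := sum_le_sum_of_subset_of_nonneg (subset_univ _) fun _ _ _ => le_max_right _ _

omit [DecidableEq U] in
lemma sum_le_sum_map_add {w : Finset V → ℝ} (hw : ∀ e, 0 ≤ w e) (f : U ↪ V) :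
    ∑ e, w e ≤ ∑ e : Finset U, w (e.map f) + ∑ v ∈ univ \ univ.map f, load w v := by
  have h1 : ∑ e : Finset U, w (e.map f) = ∑ e ∈ univ.map (mapEmbedding f).toEmbedding, w e := by
    rw [sum_map]
    rfl
  have h2 : ∑ v ∈ univ \ univ.map f, load w v
      = ∑ e, ∑ v ∈ univ \ univ.map f, if v ∈ e then w e else 0 := by
    rw [sum_comm]
    exact sum_congr rfl fun v _ => sum_filter _ _
  rw [h1, h2, ← sum_add_sum_compl (univ.map (mapEmbedding f).toEmbedding) w]
  refine add_le_add le_rfl ?_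
  have hnn : ∀ e, ∀ v ∈ univ \ univ.map f, 0 ≤ if v ∈ e then w e else 0 := fun e v _ => by
    split_ifs
    exacts [hw e, le_rfl]
  refine (sum_le_sum fun e he => ?_).trans
    (sum_le_sum_of_subset_of_nonneg (subset_univ _) fun e _ _ => sum_nonneg (hnn e))
  obtain ⟨v, hv, hvf⟩ : ∃ v ∈ e, v ∉ univ.map f := by
    by_contra! h
    obtain ⟨e', -, rfl⟩ := subset_map_iff.1 (show e ⊆ univ.map f from h)
    exact mem_compl.1 he (mem_map_of_mem (mapEmbedding f).toEmbedding (mem_univ e'))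
  refine le_trans ?_ (single_le_sum (hnn e) (mem_sdiff.2 ⟨mem_univ v, hvf⟩))
  rw [if_pos hv]

end

section

/-- The degree conditions force a matching covering all but a small proportion of the vertices. -/
lemma exists_almost_perfect {γ ε : ℝ} (hγ : 0 < γ) (hε : 0 < ε) :
    ∃ n₀ : ℕ, ∀ n, n₀ ≤ n → ∀ H : Finset (Finset (Fin n)), (∀ e ∈ H, e.card = 3) →
      (∀ v, (1 / 3 + γ) * (n : ℝ) ^ 2 ≤ 2 * ((H.filter fun e => v ∈ e).card : ℝ)) →
      3 * (univ.filter fun v =>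
        2 * ((H.filter fun e => v ∈ e).card : ℝ) < (5 / 9 + γ) * (n : ℝ) ^ 2).card ≤ n →
      ∃ M ⊆ H, (∀ e ∈ M, ∀ f ∈ M, e ≠ f → Disjoint e f) ∧ (1 / 3 - ε) * n ≤ M.card := by
  set κ : ℝ := 12 / (γ * ε) with hκdef
  have hκ : 0 < κ := by positivity
  obtain ⟨N₀, hN₀⟩ := exists_matching_gt_of_weights (κ := κ) (ε := ε / 4) (by positivity)
  obtain ⟨n₁, hn₁⟩ := exists_nat_ge (8 * κ / ε)
  rw [div_le_iff₀ hε] at hn₁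
  refine ⟨max (3 * N₀ + 3) n₁, fun n hn H hH hdeg hbig => ?_⟩
  have hn3 : 3 * N₀ + 3 ≤ n := (le_max_left _ _).trans hn
  have hnn₁ : (n₁ : ℝ) ≤ n := by exact_mod_cast (le_max_right _ _).trans hn
  have hnR : (0 : ℝ) < n := by exact_mod_cast (by omega : 0 < n)
  have : NeZero n := ⟨by omega⟩
  obtain ⟨M, hM, hmax⟩ := exists_max_image
    (H.powerset.filter fun M => ∀ e ∈ M, ∀ f ∈ M, e ≠ f → Disjoint e f) card
    ⟨∅, by simp⟩
  rw [mem_filter, mem_powerset] at hM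
  refine ⟨M, hM.1, hM.2, ?_⟩
  by_contra! hlt
  have hMc := three_mul_card_le (fun e he => hH e (hM.1 he)) hM.2
  rw [Fintype.card_fin] at hMc
  set N := n / 3 with hNdef
  obtain ⟨f, R, hRc, hR⟩ := exists_block_embedding (N := N) (by simp; omega)
    (fun e he => hH e (hM.1 he)) hM.2 (by omega)
  obtain ⟨w, hw, hwκ, hwH, hexc, hlow, -⟩ := exists_fractional H hH hγ (A := 1 + 2 / ε)
    (by have : 0 < 2 / ε := by positivity
        linarith) hκ (by simp; omega) (by simpa using hdeg) (by simpa using hbig)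
  simp only [Fintype.card_fin] at hwκ hexc hlow
  have hNR : (0 : ℝ) < N := by exact_mod_cast (by omega : 0 < N)
  have hNn : (N : ℝ) ≤ n := by exact_mod_cast (by omega : N ≤ n)
  have h1 := sum_excess_map_le hw f
  have h2 := sum_le_sum_map_add hw f
  have h3 : ∑ v ∈ univ \ univ.map f, load w v ≤ 2 * κ := by
    have hload : ∀ v, load w v ≤ κ := fun v => by
      have := load_le (fun e he => hwH e fun h => he (hH e h))
        (show 0 ≤ κ / (n : ℝ) ^ 2 by positivity) hwκ v
      rwa [Fintype.card_fin, div_mul_cancel₀ _ (by positivity)] at this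
    refine (sum_le_card_nsmul _ _ κ fun v _ => hload v).trans ?_
    rw [nsmul_eq_mul, card_sdiff_of_subset (subset_univ _), card_map, card_univ, card_univ,
      Fintype.card_fin, Fintype.card_prod, Fintype.card_fin, Fintype.card_fin]
    refine mul_le_mul_of_nonneg_right ?_ hκ.le
    exact_mod_cast (by omega : n - N * 3 ≤ 2)
  have h4 : ∑ v, max (load w v - 1) 0 ≤ ε / 4 * n := by
    have h0 : 0 ≤ ∑ v, max (load w v - 1) 0 := sum_nonneg fun _ _ => le_max_right _ _
    have h5 : 2 / ε * ∑ v, max (load w v - 1) 0 ≤ n / 2 := by linarith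
    have h6 := mul_le_mul_of_nonneg_left h5 hε.le
    have h7 : ε * (2 / ε * ∑ v, max (load w v - 1) 0) = 2 * ∑ v, max (load w v - 1) 0 := by
      field_simp
    linarith
  have h5 : 3 * (n : ℝ) / (κ * γ) = ε / 4 * n := by
    rw [hκdef]
    field_simp
    ring
  rw [h5] at hlow
  have h6 := mul_le_mul_of_nonneg_right hnn₁ hε.le
  have h7 := mul_le_mul_of_nonneg_left hNn hε.le
  obtain ⟨M', hM'H, hM'd, hM'c⟩ := hN₀ N (by omega) (univ.filter fun e => e.map f ∈ H) R
    (fun e => w (e.map f)) (fun e he => by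
      rw [← card_map f]
      exact hH _ (mem_filter.1 he).2)
    (fun y hy => by simpa using hM.1 (hR y hy)) (fun e => hw _)
    (fun e => (hwκ _).trans (div_le_div_of_nonneg_left hκ.le (by positivity)
      (pow_le_pow_left₀ hNR.le hNn 2)))
    (fun e he => hwH _ fun h => he (by simpa using h))
    (by
      rw [hRc]
      linarith)
  have h8 := hmax (M'.map (mapEmbedding f).toEmbedding) (by
    rw [mem_filter, mem_powerset]
    refine ⟨fun e he => ?_, fun e he e' he' hne => ?_⟩
    · obtain ⟨e₀, he₀, rfl⟩ := mem_map.1 he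
      exact (mem_filter.1 (hM'H he₀)).2
    · obtain ⟨e₀, he₀, rfl⟩ := mem_map.1 he
      obtain ⟨e₁, he₁, rfl⟩ := mem_map.1 he'
      have := hM'd e₀ he₀ e₁ he₁ fun h => hne (by rw [h])
      exact (disjoint_map f).2 this)
  rw [card_map, ← hRc] at h8
  omega

end

section
variable {n : ℕ}

lemma card_leave {M : Finset (Finset (Fin n))} (hM3 : ∀ e ∈ M, e.card = 3)
    (hM : ∀ e ∈ M, ∀ f ∈ M, e ≠ f → Disjoint e f) : (leave M).card + 3 * M.card = n := by
  have h : (cover M).card = ∑ e ∈ M, (id e).card := card_biUnion hM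
  rw [sum_congr rfl (fun e he => by rw [id, hM3 e he]), sum_const, smul_eq_mul] at h
  have h2 := card_sdiff_add_card_eq_card (subset_univ (cover M))
  rw [card_univ, Fintype.card_fin] at h2
  unfold leave
  omega

/-- A matching that is almost perfect contains a matching of a prescribed smaller size whose leave
contains only a small proportion of a given set of at most a third of the vertices. -/
lemma exists_submatching {M : Finset (Finset (Fin n))} (hM3 : ∀ e ∈ M, e.card = 3)
    (hM : ∀ e ∈ M, ∀ f ∈ M, e ≠ f → Disjoint e f) {τ : ℕ} (hτ : τ ≤ M.card)
    (hτM : 2 * n + 3 * τ ≤ 9 * M.card) {Z : Finset (Fin n)} (hZ : 3 * Z.card ≤ n) :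
    ∃ M' ⊆ M, M'.card = τ ∧ 3 * (leave M' ∩ Z).card ≤ (leave M').card := by
  set S := M.filter fun e => (e ∩ Z).Nonempty with hS
  have hSM : S ⊆ M := filter_subset _ _
  rcases le_total τ S.card with h | h
  · obtain ⟨M', hM'S, hM'c⟩ := exists_subset_card_eq h
    have hM'M := hM'S.trans hSM
    refine ⟨M', hM'M, hM'c, ?_⟩
    have h1 := card_leave (fun e he => hM3 e (hM'M he))
      fun e he f hf => hM e (hM'M he) f (hM'M hf)
    have h2 : M'.card ≤ (cover M' ∩ Z).card := by
      unfold cover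
      rw [biUnion_inter, card_biUnion (t := fun e => id e ∩ Z) fun e he f hf hne =>
        (hM e (hM'M he) f (hM'M hf) hne).mono inter_subset_left inter_subset_left, card_eq_sum_ones]
      exact sum_le_sum fun e he => card_pos.2 (mem_filter.1 (hM'S he)).2
    have h3 : (leave M' ∩ Z).card + (cover M' ∩ Z).card ≤ Z.card := by
      rw [← card_union_of_disjoint]
      · exact card_le_card (union_subset inter_subset_right inter_subset_right)
      · exact (sdiff_disjoint).mono inter_subset_left inter_subset_left
    omega
  · obtain ⟨M', hSM', hM'M, hM'c⟩ := exists_subsuperset_card_eq hSM h hτ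
    refine ⟨M', hM'M, hM'c, ?_⟩
    have h1 := card_leave (fun e he => hM3 e (hM'M he))
      fun e he f hf => hM e (hM'M he) f (hM'M hf)
    have h2 := card_leave hM3 hM
    have h3 : leave M' ∩ Z ⊆ leave M := by
      intro v hv
      rw [mem_inter] at hv
      refine mem_sdiff.2 ⟨mem_univ v, fun hvc => ?_⟩
      obtain ⟨e, he, hve⟩ := mem_biUnion.1 hvc
      refine (mem_sdiff.1 hv.1).2 (mem_biUnion.2 ⟨e, hSM' (mem_filter.2 ⟨he, v, ?_⟩), hve⟩)
      exact mem_inter.2 ⟨hve, hv.2⟩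
    have h4 := card_le_card h3
    omega

lemma DegSeq4.le_deg {γ : ℝ} {t : ℕ} {H : Finset (Finset (Fin n))} {σ : Fin n ≃ Fin n}
    (h : DegSeq4 γ t H σ) (v : Fin n) : (1 / 3 + 4 * γ) * (n.choose 2 : ℝ) ≤ deg H v := by
  obtain ⟨i, rfl⟩ := σ.surjective v
  obtain ⟨h1, h2, h3⟩ := h.2 i
  have hc : (0 : ℝ) ≤ n.choose 2 := by positivity
  have ht : (0 : ℝ) ≤ ((i : ℕ) + 1) * t := by positivity
  rcases le_or_gt ((i : ℕ) + 1) t with hi | hi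
  · linarith [h1 hi]
  · rcases le_or_gt (3 * ((i : ℕ) + 1)) n with hi' | hi'
    · linarith [h2 hi hi']
    · linarith [h3 hi']

lemma DegSeq4.card_small_le {γ : ℝ} {t : ℕ} {H : Finset (Finset (Fin n))} {σ : Fin n ≃ Fin n}
    (h : DegSeq4 γ t H σ) {S : Finset (Fin n)}
    (hS : ∀ v ∈ S, (deg H v : ℝ) < (5 / 9 + 4 * γ) * (n.choose 2 : ℝ)) : 3 * S.card ≤ n := by
  have h1 : S.card ≤ (range (n / 3)).card := by
    refine card_le_card_of_injOn (fun v => (σ.symm v : ℕ)) (fun v hv => ?_)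
      ((Fin.val_injective.comp σ.symm.injective).injOn)
    by_contra hn
    have h2 := (h.2 (σ.symm v)).2.2 (by
      simp only [coe_range, Set.mem_Iio] at hn
      omega)
    rw [σ.apply_symm_apply] at h2
    exact absurd h2 (not_le.2 (hS v hv))
  rw [card_range] at h1
  omega

end

/-- Theorem (almost-perfect matching): for `γ > 0` there exists `n''` such that for every
`n ≥ n''` and `t` with `1 ≤ t ≤ n/(3√2)`, every `3`-graph `H` on `n` vertices with the
degree sequence condition `DegSeq4` contains a matching `M` of size `⌊(n − γn)/3⌋` with
`|L(M) ∩ V_{5/9}| ≥ (2/3)·|L(M)|`. -/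
theorem almost_perfect_matching (γ : ℝ) (hγ : 0 < γ) :
    ∃ n'' : ℕ, ∀ n : ℕ, n'' ≤ n →
      ∀ t : ℕ, 1 ≤ t → (t : ℝ) ≤ (n : ℝ) / (3 * Real.sqrt 2) →
      ∀ H : Finset (Finset (Fin n)), Is3Graph n H →
      (∃ σ : Fin n ≃ Fin n, DegSeq4 γ t H σ) →
      ∃ M, IsMatching H M ∧ M.card = ⌊((n : ℝ) - γ * n) / 3⌋₊ ∧
        (2 : ℝ)/3 * ((leave M).card) ≤ (((leave M) ∩ V59 γ H).card : ℝ) := by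
  set γ₀ := min γ 1 with hγ₀
  have hγ₀pos : 0 < γ₀ := lt_min hγ one_pos
  have hγ₀γ : γ₀ ≤ γ := min_le_left _ _
  have hγ₀1 : γ₀ ≤ 1 := min_le_right _ _
  obtain ⟨n₀, hn₀⟩ := exists_almost_perfect hγ (show 0 < γ₀ / 9 by positivity)
  obtain ⟨n₁, hn₁⟩ := exists_nat_ge ((5 / 9 + 4 * γ) / (3 * γ))
  rw [div_le_iff₀ (by positivity)] at hn₁
  refine ⟨max n₀ n₁, fun n hn t _ _ H hH ⟨σ, hσ⟩ => ?_⟩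
  have hnn₁ : (n₁ : ℝ) ≤ n := by exact_mod_cast (le_max_right _ _).trans hn
  have hnR : (0 : ℝ) ≤ n := Nat.cast_nonneg n
  have hchoose : 2 * (n.choose 2 : ℝ) = (n : ℝ) ^ 2 - n := by
    rw [Nat.cast_choose_two]
    ring
  have hlarge : ∀ c ≤ (5 / 9 : ℝ),
      (c + γ) * (n : ℝ) ^ 2 ≤ 2 * ((c + 4 * γ) * (n.choose 2 : ℝ)) := by
    intro c hc
    have h1 : 2 * ((c + 4 * γ) * (n.choose 2 : ℝ)) = (c + 4 * γ) * ((n : ℝ) ^ 2 - n) := by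
      rw [← hchoose]
      ring
    have h2 := mul_le_mul_of_nonneg_right hnn₁ (show 0 ≤ 3 * γ by positivity)
    have h3 : (c + 4 * γ) * n ≤ n * (3 * γ) * n :=
      mul_le_mul_of_nonneg_right (by linarith) hnR
    rw [h1]
    linarith
  obtain ⟨M, hMH, hM, hMc⟩ := hn₀ n ((le_max_left _ _).trans hn) H hH
    (fun v => (hlarge (1 / 3) (by norm_num)).trans
      (mul_le_mul_of_nonneg_left (hσ.le_deg v) (by norm_num)))
    (hσ.card_small_le fun v hv => by
      have h1 := (mem_filter.1 hv).2
      have h2 := hlarge (5 / 9) le_rfl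
      unfold deg
      linarith)
  have hM3 : ∀ e ∈ M, e.card = 3 := fun e he => hH e (hMH he)
  have hτ : 3 * (⌊((n : ℝ) - γ * n) / 3⌋₊ : ℝ) ≤ (1 - γ₀) * n := by
    have h0 : 0 ≤ (1 - γ₀) * n / 3 :=
      div_nonneg (mul_nonneg (by linarith) hnR) (by norm_num)
    have h1 := mul_le_mul_of_nonneg_right hγ₀γ hnR
    have h2 : ((n : ℝ) - γ * n) / 3 ≤ (1 - γ₀) * n / 3 := by linarith
    have h3 := (Nat.cast_le (α := ℝ)).2 (Nat.floor_le_floor h2)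
    have h4 := Nat.floor_le h0
    linarith
  have hγn : 0 ≤ γ₀ * n := by positivity
  have hZ : 3 * (univ \ V59 γ H).card ≤ n := by
    refine hσ.card_small_le fun v hv => ?_
    have h1 : ¬ big γ H v := fun h => (mem_sdiff.1 hv).2 (mem_filter.2 ⟨mem_univ v, h⟩)
    refine (not_le.1 h1).trans_le (mul_le_mul_of_nonneg_right (by linarith) (by positivity))
  obtain ⟨M', hM'M, hM'c, hM'⟩ := exists_submatching hM3 hM
    (τ := ⌊((n : ℝ) - γ * n) / 3⌋₊)
    (by
      rw [← Nat.cast_le (α := ℝ)]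
      linarith)
    (by
      rw [← Nat.cast_le (α := ℝ)]
      push_cast
      linarith) hZ
  refine ⟨M', ⟨hM'M.trans hMH, fun e he f hf => hM e (hM'M he) f (hM'M hf)⟩, hM'c, ?_⟩
  have h1 : (leave M').card ≤ (leave M' ∩ V59 γ H).card + (leave M' ∩ (univ \ V59 γ H)).card := by
    rw [← card_inter_add_card_sdiff (leave M') (V59 γ H)]
    refine Nat.add_le_add_left (card_le_card fun v hv => ?_) _
    rw [mem_sdiff] at hv
    exact mem_inter.2 ⟨hv.1, mem_sdiff.2 ⟨mem_univ v, hv.2⟩⟩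
  have h2 : 2 * ((leave M').card : ℝ) ≤ 3 * (leave M' ∩ V59 γ H).card := by
    exact_mod_cast (by omega : 2 * (leave M').card ≤ 3 * (leave M' ∩ V59 γ H).card)
  linarith
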